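/- Fix integers 1 ≤ m < n, l ∈ {1,…,m+2}, an exponent p > m·l, and constants E, d > 0. Let 𝒜(E,d) denote the set of all compact m-dimensional embedded Lipschitz submanifolds Σ ⊂ ℝⁿ with 𝓔_p^l(Σ) ≤ E and diam(Σ) ≤ d. Then for every reference manifold M₀ ∈ 𝒜(E,d) there exists Σ₀ ∈ 𝒜(E,d) that is ambient isotopic to M₀ and satisfies 𝓔_p^l(Σ₀) = inf{ 𝓔_p^l(Σ) : Σ ∈ 𝒜(E,d) and Σ is ambient isotopic to M₀ }. -/

import Mathlib

open Set Metric MeasureTheory Filter Topology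
open scoped ENNReal NNReal

noncomputable section

/-- Discrete Menger curvature (`ℝ≥0∞`-valued): `𝒦 = H^{m+1}(conv)/diam^{m+2}`. -/
def mengerCurv (m n : ℕ) (x : Fin (m + 2) → EuclideanSpace ℝ (Fin n)) : ℝ≥0∞ :=
  μH[(m + 1 : ℝ)] (convexHull ℝ (Set.range x)) / EMetric.diam (Set.range x) ^ (m + 2)

/-- `z : Fin (m+2) → ℝⁿ` extends the `l`-tuple `y`, with all remaining entries in `S`. -/
def ExtendsIn (m n l : ℕ) (S : Set (EuclideanSpace ℝ (Fin n)))
    (y : Fin l → EuclideanSpace ℝ (Fin n)) (z : Fin (m + 2) → EuclideanSpace ℝ (Fin n)) : Prop :=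
  (∀ (i : Fin (m + 2)) (h : (i : ℕ) < l), z i = y ⟨i, h⟩) ∧
  (∀ i : Fin (m + 2), l ≤ (i : ℕ) → z i ∈ S)

/-- `𝒦_l[S](y) = sup_{x_l,…,x_{m+1} ∈ S} 𝒦(y₀,…,y_{l−1},x_l,…,x_{m+1})`
(no supremum is taken when `l = m+2`). -/
def mengerSup (m n l : ℕ) (S : Set (EuclideanSpace ℝ (Fin n)))
    (y : Fin l → EuclideanSpace ℝ (Fin n)) : ℝ≥0∞ :=
  ⨆ (z : Fin (m + 2) → EuclideanSpace ℝ (Fin n)) (_ : ExtendsIn m n l S y z), mengerCurv m n z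

open scoped Classical in
/-- The integrand of `𝓔_p^l`, set to `0` on the diagonal `x₀ = … = x_{l−1}`. -/
def mengerIntegrand (m n l : ℕ) (S : Set (EuclideanSpace ℝ (Fin n)))
    (y : Fin l → EuclideanSpace ℝ (Fin n)) : ℝ≥0∞ :=
  if ∀ i j : Fin l, y i = y j then 0 else mengerSup m n l S y

/-- The geometric curvature energy `𝓔_p^l(S)`: the `p`-th power of `𝒦_l[S]` integrated over
`S^l` with respect to the `l`-fold product of `m`-dimensional Hausdorff measure restricted
to `S`. -/
def mengerEnergy (m n l : ℕ) (p : ℝ) (S : Set (EuclideanSpace ℝ (Fin n))) : ℝ≥0∞ :=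
  ∫⁻ y, mengerIntegrand m n l S y ^ p
    ∂(Measure.pi fun _ : Fin l =>
        (μH[(m : ℝ)] : Measure (EuclideanSpace ℝ (Fin n))).restrict S)

/-- A compact `m`-dimensional embedded Lipschitz submanifold of `ℝⁿ`: a nonempty compact
set which near each of its points is a Lipschitz graph over some `m`-plane. -/
def IsLipschitzSubmanifold (m n : ℕ) (S : Set (EuclideanSpace ℝ (Fin n))) : Prop :=
  S.Nonempty ∧ IsCompact S ∧
  ∀ x ∈ S, ∃ r : ℝ, 0 < r ∧ ∃ T : Submodule ℝ (EuclideanSpace ℝ (Fin n)),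
    Module.finrank ℝ T = m ∧ ∃ f : T → Tᗮ, (∃ K : ℝ≥0, LipschitzWith K f) ∧
      S ∩ Metric.ball x r
        = (Set.range fun ξ : T =>
            x + (ξ : EuclideanSpace ℝ (Fin n)) + (f ξ : EuclideanSpace ℝ (Fin n)))
          ∩ Metric.ball x r

/-- Two subsets of `ℝⁿ` are ambient isotopic: there is a continuous family of topological
embeddings of `ℝⁿ` into itself, ending at the identity, carrying `S₂` onto `S₁` at time `0`. -/
def AmbientIsotopic (n : ℕ) (S₁ S₂ : Set (EuclideanSpace ℝ (Fin n))) : Prop :=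
  ∃ H : EuclideanSpace ℝ (Fin n) × ℝ → EuclideanSpace ℝ (Fin n),
    Continuous H ∧
    (∀ t ∈ Set.Icc (0 : ℝ) 1, IsEmbedding fun x => H (x, t)) ∧
    (∀ x, H (x, 1) = x) ∧
    (fun x => H (x, 0)) '' S₂ = S₁

set_option linter.unusedSectionVars false
set_option linter.unusedVariables false

section Part1

section LinAlg

variable {V : Type*} [NormedAddCommGroup V] [InnerProductSpace ℝ V] [FiniteDimensional ℝ V]

/-- distance of a vector to a subspace -/
def offp (T : Submodule ℝ V) (v : V) : ℝ := ‖v - T.starProjection v‖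

lemma offp_nonneg (T : Submodule ℝ V) (v : V) : 0 ≤ offp T v := norm_nonneg _

lemma offp_add_le (T : Submodule ℝ V) (v w : V) : offp T (v + w) ≤ offp T v + offp T w := by
  unfold offp
  rw [map_add, add_sub_add_comm]
  exact norm_add_le _ _

lemma offp_smul (T : Submodule ℝ V) (a : ℝ) (v : V) : offp T (a • v) = |a| * offp T v := by
  unfold offp
  rw [map_smul, ← smul_sub, norm_smul, Real.norm_eq_abs]

lemma offp_neg (T : Submodule ℝ V) (v : V) : offp T (-v) = offp T v := by
  have := offp_smul T (-1) v
  simpa using this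

lemma offp_sub_le (T : Submodule ℝ V) (v w : V) : offp T (v - w) ≤ offp T v + offp T w := by
  rw [sub_eq_add_neg, ← offp_neg T w]
  exact offp_add_le _ _ _

lemma offp_sub_comm (T : Submodule ℝ V) (v w : V) : offp T (v - w) = offp T (w - v) := by
  rw [← offp_neg, neg_sub]

lemma offp_le_of_mem (T : Submodule ℝ V) (v : V) {w : V} (hw : w ∈ T) : offp T v ≤ ‖v - w‖ := by
  unfold offp
  rw [T.starProjection_minimal v]
  exact ciInf_le ⟨0, by rintro _ ⟨x, rfl⟩; exact norm_nonneg _⟩ (⟨w, hw⟩ : T)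

lemma offp_le_norm (T : Submodule ℝ V) (v : V) : offp T v ≤ ‖v‖ := by
  simpa using offp_le_of_mem T v T.zero_mem

lemma offp_le_add (T : Submodule ℝ V) (v w : V) : offp T v ≤ offp T w + ‖v - w‖ := by
  have h := offp_add_le T w (v - w)
  rw [add_sub_cancel] at h
  linarith [offp_le_norm T (v - w)]

lemma offp_sum_le (T : Submodule ℝ V) {ι : Type*} (s : Finset ι) (f : ι → V) :
    offp T (∑ i ∈ s, f i) ≤ ∑ i ∈ s, offp T (f i) := by
  classical
  induction s using Finset.induction_on with
  | empty => simp [offp]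
  | insert a s ha ih =>
    rw [Finset.sum_insert ha, Finset.sum_insert ha]
    linarith [offp_add_le T (f a) (∑ i ∈ s, f i)]

lemma proj_norm_le (T : Submodule ℝ V) (v : V) : ‖T.starProjection v‖ ≤ ‖v‖ :=
  T.norm_starProjection_apply_le v

lemma norm_le_proj_add (T : Submodule ℝ V) (v : V) : ‖v‖ ≤ ‖T.starProjection v‖ + offp T v := by
  have := norm_add_le (T.starProjection v) (v - T.starProjection v)
  rw [add_sub_cancel] at this
  exact this

lemma proj_of_mem {T : Submodule ℝ V} {v : V} (h : v ∈ T) : T.starProjection v = v :=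
  Submodule.starProjection_eq_self_iff.2 h

lemma proj_mem (T : Submodule ℝ V) (v : V) : T.starProjection v ∈ T :=
  T.starProjection_apply_mem v

lemma norm_sub_le_of_proj_eq (T : Submodule ℝ V) {v w : V}
    (h : T.starProjection v = T.starProjection w) : ‖v - w‖ ≤ offp T v + offp T w := by
  have h1 := norm_le_proj_add T (v - w)
  rw [map_sub, h, sub_self, norm_zero, zero_add] at h1
  exact h1.trans (offp_sub_le _ _ _)

/-- `F` nearly contains a robust family; comparison with another plane. -/
lemma plane_compare {m : ℕ} {T F F' : Submodule ℝ V} (hT : Module.finrank ℝ T = m)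
    (hF : Module.finrank ℝ F = m) {t K η : ℝ} (ht : 0 < t) (hK : 0 ≤ K) (hη : 0 ≤ η)
    (hmη : (m : ℝ) * η ≤ 1 / 2)
    (h : ∀ u ∈ T, ‖u‖ = t → ∃ w, T.starProjection w = u ∧ ‖w - u‖ ≤ K * t ∧
      offp F w ≤ η * t ∧ offp F' w ≤ η * t) :
    ∀ f ∈ F, offp F' f ≤ 4 * m * η * ‖f‖ ∧ ‖f‖ ≤ 2 * m * (1 + K) * ‖T.starProjection f‖ := by
  classical
  let e := stdOrthonormalBasis ℝ T
  have hex : ∀ i, ∃ w, T.starProjection w = t • (e i : V) ∧ ‖w - t • (e i : V)‖ ≤ K * t ∧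
      offp F w ≤ η * t ∧ offp F' w ≤ η * t := by
    intro i
    refine h _ (T.smul_mem _ (e i).2) ?_
    rw [norm_smul, Real.norm_eq_abs, abs_of_pos ht]
    have : ‖(e i : V)‖ = 1 := by
      exact e.orthonormal.1 i
    rw [this, mul_one]
  choose w hw1 hw2 hw3 hw4 using hex
  have henorm : ∀ i, ‖(e i : V)‖ = 1 := by
    intro i
    exact e.orthonormal.1 i
  let B : T →ₗ[ℝ] F :=
    ∑ i, (LinearMap.toSpanSingleton ℝ F (t⁻¹ • (⟨F.starProjection (w i), proj_mem F _⟩ : F))) ∘ₗ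
      (innerₗ T (e i))
  have hB : ∀ u : T, ((B u : F) : V) = ∑ i, (inner ℝ (e i) u * t⁻¹) • F.starProjection (w i) := by
    intro u
    simp only [B, LinearMap.sum_apply, LinearMap.comp_apply, LinearMap.toSpanSingleton_apply,
      Submodule.coe_sum, Submodule.coe_smul, innerₗ_apply_apply, smul_smul]
  have hu : ∀ u : T, (u : V) = ∑ i, (inner ℝ (e i) u) • (e i : V) := by
    intro u
    conv_lhs => rw [← e.sum_repr' u]
    simp only [Submodule.coe_sum, Submodule.coe_smul]
  have hcoef : ∀ (u : T) i, |inner ℝ (e i) u| ≤ ‖u‖ := by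
    intro u i
    have := abs_real_inner_le_norm (e i) u
    rwa [e.orthonormal.1 i, one_mul] at this
  have hcard : Fintype.card (Fin (Module.finrank ℝ T)) = m := by simp [hT]
  have hsum : ∀ (g : Fin (Module.finrank ℝ T) → ℝ) (c : ℝ), (∀ i, g i ≤ c) →
      ∑ i, g i ≤ m * c := by
    intro g c hg
    refine (Finset.sum_le_sum (fun i _ => hg i)).trans ?_
    simp [hT]
  have hBu1 : ∀ u : T, ‖T.starProjection ((B u : F) : V) - u‖ ≤ 1 / 2 * ‖u‖ := by
    intro u
    rw [hB u]
    nth_rewrite 1 [hu u]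
    rw [map_sum, ← Finset.sum_sub_distrib]
    refine (norm_sum_le _ _).trans ((hsum _ (η * ‖u‖) ?_).trans ?_)
    · intro i
      have h1 : T.starProjection ((inner ℝ (e i) u * t⁻¹) • F.starProjection (w i))
          - (inner ℝ (e i) u) • (e i : V)
          = (inner ℝ (e i) u * t⁻¹) • T.starProjection (F.starProjection (w i) - w i) := by
        rw [map_smul, map_sub, hw1, smul_sub, smul_smul, mul_assoc, inv_mul_cancel₀ ht.ne',
          mul_one]
      rw [h1, norm_smul, Real.norm_eq_abs, abs_mul, abs_of_pos (inv_pos.2 ht)]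
      have h2 : ‖T.starProjection (F.starProjection (w i) - w i)‖ ≤ η * t := by
        refine (proj_norm_le _ _).trans ?_
        rw [norm_sub_rev]; exact hw3 i
      calc |inner ℝ (e i) u| * t⁻¹ * ‖T.starProjection (F.starProjection (w i) - w i)‖
          ≤ ‖u‖ * t⁻¹ * (η * t) := by gcongr; exact hcoef u i
        _ = η * ‖u‖ := by field_simp
    · have := norm_nonneg u
      nlinarith
  have hlow : ∀ u : T, ‖u‖ ≤ 2 * ‖T.starProjection ((B u : F) : V)‖ := by
    intro u
    have h1 := hBu1 u
    have h2 := norm_le_insert' (u : V) (T.starProjection ((B u : F) : V))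
    rw [norm_sub_rev] at h2
    have h3 : ‖(u : V)‖ = ‖u‖ := rfl
    linarith
  have hinj : Function.Injective B := by
    rw [← LinearMap.ker_eq_bot, LinearMap.ker_eq_bot']
    intro u hu0
    have := hlow u
    rw [hu0] at this
    simpa using this
  have hsurj : Function.Surjective B :=
    (LinearMap.injective_iff_surjective_of_finrank_eq_finrank (hT.trans hF.symm)).1 hinj
  intro f hf
  obtain ⟨u, hu0⟩ := hsurj ⟨f, hf⟩
  have hfu : f = ((B u : F) : V) := by rw [hu0]
  have h1 := hlow u
  rw [← hfu] at h1
  have hun := norm_nonneg u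
  constructor
  · have h2 : offp F' f ≤ m * (2 * η * ‖u‖) := by
      rw [hfu, hB u]
      refine (offp_sum_le _ _ _).trans (hsum _ _ ?_)
      intro i
      rw [offp_smul, abs_mul, abs_of_pos (inv_pos.2 ht)]
      have h3 : offp F' (F.starProjection (w i)) ≤ 2 * η * t := by
        have := offp_le_add F' (F.starProjection (w i)) (w i)
        rw [norm_sub_rev] at this
        have h5 := hw3 i
        unfold offp at h5
        linarith [hw4 i]
      calc |inner ℝ (e i) u| * t⁻¹ * offp F' (F.starProjection (w i))
          ≤ ‖u‖ * t⁻¹ * (2 * η * t) := by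
            gcongr
            · exact offp_nonneg _ _
            · exact hcoef u i
        _ = 2 * η * ‖u‖ := by field_simp
    have h4 : ‖u‖ ≤ 2 * ‖f‖ := h1.trans (by linarith [proj_norm_le T f])
    calc offp F' f ≤ m * (2 * η * ‖u‖) := h2
      _ ≤ m * (2 * η * (2 * ‖f‖)) := by gcongr
      _ = _ := by ring
  · have h2 : ‖f‖ ≤ m * ((1 + K) * ‖u‖) := by
      nth_rewrite 1 [hfu]
      rw [hB u]
      refine (norm_sum_le _ _).trans (hsum _ _ ?_)
      intro i
      rw [norm_smul, Real.norm_eq_abs, abs_mul, abs_of_pos (inv_pos.2 ht)]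
      have h3 : ‖F.starProjection (w i)‖ ≤ (1 + K) * t := by
        refine (proj_norm_le _ _).trans ?_
        have := norm_le_insert' (w i) (t • (e i : V))
        rw [norm_smul, henorm, Real.norm_eq_abs, abs_of_pos ht] at this
        linarith [hw2 i]
      calc |inner ℝ (e i) u| * t⁻¹ * ‖F.starProjection (w i)‖
          ≤ ‖u‖ * t⁻¹ * ((1 + K) * t) := by
            gcongr
            · exact hcoef u i
        _ = (1 + K) * ‖u‖ := by field_simp
    calc ‖f‖ ≤ m * ((1 + K) * ‖u‖) := h2
      _ ≤ m * ((1 + K) * (2 * ‖T.starProjection f‖)) := by gcongr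
      _ = _ := by ring

end LinAlg

end Part1

section Part2

section Charts

variable {V : Type*} [NormedAddCommGroup V] [InnerProductSpace ℝ V] [FiniteDimensional ℝ V]

/-- angle bound between subspaces -/
def Ang (F F' : Submodule ℝ V) (θ : ℝ) : Prop := ∀ f ∈ F, offp F' f ≤ θ * ‖f‖

lemma Ang.trans {F F' F'' : Submodule ℝ V} {a b : ℝ} (h1 : Ang F F' a) (h2 : Ang F' F'' b)
    (hb : 0 ≤ b) : Ang F F'' (a + b) := by
  intro f hf
  have e1 := h1 f hf
  have e2 := h2 _ (proj_mem F' f)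
  have e3 := offp_le_add F'' f (F'.starProjection f)
  have e4 := proj_norm_le F' f
  unfold offp at e1
  nlinarith [mul_le_mul_of_nonneg_left e4 hb]

lemma Ang.mono {F F' : Submodule ℝ V} {a b : ℝ} (h1 : Ang F F' a) (hab : a ≤ b) : Ang F F' b := by
  intro f hf
  exact (h1 f hf).trans (by gcongr)

/-- `S` covers, near each point, a disc of radius `r` in some plane, with slope at most `K`. -/
def UProp (m : ℕ) (S : Set V) (r K : ℝ) : Prop :=
  ∀ x ∈ S, ∃ T : Submodule ℝ V, Module.finrank ℝ T = m ∧
    ∀ u ∈ T, ‖u‖ ≤ r → ∃ y ∈ S, ‖y - x - u‖ ≤ K * ‖u‖ ∧ T.starProjection (y - x) = u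

/-- `S` is near each point, at scale `ρ`, a graph with slope at most `ε`. -/
def ChProp (m : ℕ) (S : Set V) (ρ ε : ℝ) : Prop :=
  ∀ x ∈ S, ∃ T : Submodule ℝ V, Module.finrank ℝ T = m ∧
    (∀ y ∈ S, ∀ z ∈ S, ‖y - x‖ ≤ ρ → ‖z - x‖ ≤ ρ → offp T (y - z) ≤ ε * ‖y - z‖) ∧
    (∀ u ∈ T, ‖u‖ ≤ ρ / 2 → ∃ y ∈ S, ‖y - x‖ ≤ 2 * ‖u‖ ∧ T.starProjection (y - x) = u)

lemma ChProp.toU {m : ℕ} {S : Set V} {ρ ε : ℝ} (h : ChProp m S ρ ε) (hε : ε ≤ 1 / 2)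
    (hρ : 0 < ρ) : UProp m S (ρ / 2) 1 := by
  intro x hx
  obtain ⟨T, hT, h1, h2⟩ := h x hx
  refine ⟨T, hT, fun u hu hur => ?_⟩
  obtain ⟨y, hy, hy1, hy2⟩ := h2 u hu hur
  refine ⟨y, hy, ?_, hy2⟩
  have e1 := h1 y hy x hx (by linarith) (by simpa using hρ.le)
  unfold offp at e1
  rw [hy2] at e1
  have := norm_nonneg (y - x)
  nlinarith

def DK (m : ℕ) (K α : ℝ) : ℝ := 512 * m * (1 + K) * (2 ^ α / (2 ^ α - 1))

set_option maxHeartbeats 4000000 in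
lemma chart_of_flat {m : ℕ} {S : Set V} (hS : IsCompact S) {r K ρ A α ε : ℝ} 
    (hK : 0 ≤ K) (hA : 0 ≤ A) (hα : 0 < α) (hε1 : ε ≤ 1 / 16) (hρ : 0 < ρ)
    (hρr : ρ ≤ 4 * r) (hU : UProp m S r K)
    (hflat : ∀ x ∈ S, ∀ s, 0 < s → s ≤ 4 * ρ → ∃ F : Submodule ℝ V, Module.finrank ℝ F = m ∧
      ∀ y ∈ S, ‖y - x‖ ≤ s → offp F (y - x) ≤ A * s ^ α * s)
    (hsmall : (2 * m * (1 + K) + 1) * ((1 + K) + 2 * DK m K α) * (A * (4 * ρ) ^ α) ≤ ε) :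
    ChProp m S ρ ε := by
  intro x hx
  have h2α : (1 : ℝ) < 2 ^ α := Real.one_lt_rpow (by norm_num) hα
  set D := DK m K α with hD
  set e0 := A * (4 * ρ) ^ α with he0
  have he0n : 0 ≤ e0 := by positivity
  have hq : (1 : ℝ) ≤ 2 ^ α / (2 ^ α - 1) := by
    rw [le_div_iff₀ (by linarith)]; linarith
  have hmK : (0 : ℝ) ≤ m * (1 + K) := by positivity
  have hDge : 512 * (m * (1 + K)) ≤ D := by
    rw [hD, DK]; nlinarith
  have hD0 : 0 ≤ D := by linarith
  have hDe : ((1 + K) + 2 * D) * e0 ≤ ε := by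
    have : 0 ≤ ((1 + K) + 2 * D) * e0 := by positivity
    nlinarith
  have hDe0 : 0 ≤ D * e0 := by positivity
  have hKe0 : 0 ≤ K * e0 := by positivity
  have hesmall : e0 + 2 * (D * e0) ≤ ε := by linarith
  have hMe : 512 * (m * (1 + K)) * e0 ≤ D * e0 := by gcongr
  have hfl : ∀ y s, ∃ F : Submodule ℝ V, y ∈ S → 0 < s → s ≤ 4 * ρ → Module.finrank ℝ F = m ∧
      ∀ z ∈ S, ‖z - y‖ ≤ s → offp F (z - y) ≤ A * s ^ α * s := by
    intro y s
    by_cases h : y ∈ S ∧ 0 < s ∧ s ≤ 4 * ρ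
    · obtain ⟨F, hF⟩ := hflat y h.1 s h.2.1 h.2.2
      exact ⟨F, fun _ _ _ => hF⟩
    · exact ⟨⊥, fun h1 h2 h3 => absurd ⟨h1, h2, h3⟩ h⟩
  choose F hF using hfl
  have hpow : ∀ s, 0 < s → s ≤ 4 * ρ → A * s ^ α ≤ e0 := by
    intro s hs hs4
    rw [he0]; gcongr
  set T := F x (4 * ρ) with hTdef
  have hT := (hF x (4 * ρ) hx (by positivity) le_rfl).1
  have hTfl := (hF x (4 * ρ) hx (by positivity) le_rfl).2
  rw [← hTdef] at hT hTfl
  -- base comparison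
  have hbase : ∀ y ∈ S, ‖y - x‖ ≤ 2 * ρ → ∀ s, ρ < s → s ≤ 2 * ρ →
      Ang (F y s) T (D * e0) ∧ Ang T (F y s) (D * e0) := by
    intro y hy hyx s hs1 hs2
    have hs : 0 < s := hρ.trans hs1
    obtain ⟨Ty, hTy, hcov⟩ := hU y hy
    obtain ⟨hFy, hFfl⟩ := hF y s hy hs (by linarith)
    have hK1 : 0 < 1 + K := by linarith
    set t := s / (16 * (1 + K)) with ht
    have ht0 : 0 < t := by positivity
    have hts : 16 * (1 + K) * t = s := by rw [ht]; field_simp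
    have hKt := mul_nonneg hK ht0.le
    have htr : t ≤ r := by linarith
    have key : ∀ u ∈ Ty, ‖u‖ = t → ∃ w, Ty.starProjection w = u ∧ ‖w - u‖ ≤ K * t ∧
        offp (F y s) w ≤ (128 * (1 + K) * e0) * t ∧ offp T w ≤ (128 * (1 + K) * e0) * t := by
      intro u hu hut
      obtain ⟨z, hz, hz1, hz2⟩ := hcov u hu (by linarith)
      have hzy : ‖z - y‖ ≤ (1 + K) * t := by
        have := norm_le_insert' (z - y) u
        rw [hut] at this hz1
        linarith
      refine ⟨z - y, hz2, by rw [← hut]; exact hz1, ?_, ?_⟩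
      · have h1 := hFfl z hz (by linarith)
        have h2 := hpow s hs (by linarith)
        have h3 : A * s ^ α * s ≤ e0 * s := by gcongr
        have h4 : e0 * s = 16 * (1 + K) * e0 * t := by rw [← hts]; ring
        have h5 : 0 ≤ (1 + K) * e0 * t := by positivity
        linarith
      · have hzx : ‖z - x‖ ≤ 4 * ρ := by
          have := norm_sub_le_norm_sub_add_norm_sub z y x
          linarith
        have h1 := hTfl z hz hzx
        have h2 := hTfl y hy (by linarith)
        have h3 := offp_sub_le T (z - x) (y - x)
        rw [sub_sub_sub_cancel_right] at h3
        have h4 : e0 * (4 * ρ) ≤ e0 * (4 * s) := by gcongr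
        have h5 : e0 * (4 * s) = 64 * (1 + K) * e0 * t := by rw [← hts]; ring
        linarith
    have hη : (0 : ℝ) ≤ 128 * (1 + K) * e0 := by positivity
    have hmη : (m : ℝ) * (128 * (1 + K) * e0) ≤ 1 / 2 := by linarith
    have c1 := plane_compare hTy hFy ht0 hK hη hmη key
    have c2 := plane_compare hTy hT ht0 hK hη hmη
      (fun u hu hut => by
        obtain ⟨w, a, b, c, d⟩ := key u hu hut
        exact ⟨w, a, b, d, c⟩)
    constructor
    · intro f hf
      refine (c1 f hf).1.trans ?_
      refine mul_le_mul_of_nonneg_right ?_ (norm_nonneg _)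
      linarith [hMe]
    · intro f hf
      refine (c2 f hf).1.trans ?_
      refine mul_le_mul_of_nonneg_right ?_ (norm_nonneg _)
      linarith [hMe]
  -- comparison of consecutive scales
  have hstep : ∀ y ∈ S, ∀ s, 0 < s → s ≤ ρ →
      Ang (F y s) (F y (2 * s)) (D * ((2 * s) ^ α - s ^ α) * A) ∧
        Ang (F y (2 * s)) (F y s) (D * ((2 * s) ^ α - s ^ α) * A) := by
    intro y hy s hs hs2
    obtain ⟨Ty, hTy, hcov⟩ := hU y hy
    obtain ⟨hFy, hFfl⟩ := hF y s hy hs (by linarith)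
    obtain ⟨hFy', hFfl'⟩ := hF y (2 * s) hy (by linarith) (by linarith)
    have hK1 : 0 < 1 + K := by linarith
    set e1 := A * (2 * s) ^ α with he1
    have he1n : 0 ≤ e1 := by positivity
    have he10 : e1 ≤ e0 := hpow _ (by linarith) (by linarith)
    set t := s / (16 * (1 + K)) with ht
    have ht0 : 0 < t := by positivity
    have hts : 16 * (1 + K) * t = s := by rw [ht]; field_simp
    have hKt := mul_nonneg hK ht0.le
    have htr : t ≤ r := by linarith
    have key : ∀ u ∈ Ty, ‖u‖ = t → ∃ w, Ty.starProjection w = u ∧ ‖w - u‖ ≤ K * t ∧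
        offp (F y s) w ≤ (32 * (1 + K) * e1) * t ∧
        offp (F y (2 * s)) w ≤ (32 * (1 + K) * e1) * t := by
      intro u hu hut
      obtain ⟨z, hz, hz1, hz2⟩ := hcov u hu (by linarith)
      have hzy : ‖z - y‖ ≤ (1 + K) * t := by
        have := norm_le_insert' (z - y) u
        rw [hut] at this hz1
        linarith
      refine ⟨z - y, hz2, by rw [← hut]; exact hz1, ?_, ?_⟩
      · have h1 := hFfl z hz (by linarith)
        have h2 : A * s ^ α ≤ e1 := by rw [he1]; gcongr; linarith
        have h3 : A * s ^ α * s ≤ e1 * s := by gcongr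
        have h4 : e1 * s = 16 * (1 + K) * e1 * t := by rw [← hts]; ring
        have h5 : 0 ≤ (1 + K) * e1 * t := by positivity
        linarith
      · have h1 := hFfl' z hz (by linarith)
        have h4 : e1 * (2 * s) = 32 * (1 + K) * e1 * t := by rw [← hts]; ring
        linarith
    have hη : (0 : ℝ) ≤ 32 * (1 + K) * e1 := by positivity
    have hmη : (m : ℝ) * (32 * (1 + K) * e1) ≤ 1 / 2 := by
      have : (m : ℝ) * (1 + K) * e1 ≤ m * (1 + K) * e0 := by gcongr
      linarith
    have c1 := plane_compare hTy hFy ht0 hK hη hmη key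
    have c2 := plane_compare hTy hFy' ht0 hK hη hmη
      (fun u hu hut => by
        obtain ⟨w, a, b, c, d⟩ := key u hu hut
        exact ⟨w, a, b, d, c⟩)
    have hcmp : 4 * m * (32 * (1 + K) * e1) ≤ D * ((2 * s) ^ α - s ^ α) * A := by
      have h1 : (2 * s) ^ α = 2 ^ α * s ^ α := Real.mul_rpow (by norm_num) hs.le
      have h2 : D * ((2 * s) ^ α - s ^ α) * A = 512 * (m * (1 + K)) * e1 := by
        rw [he1, hD, DK, h1]
        have : (2 : ℝ) ^ α - 1 ≠ 0 := by linarith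
        field_simp
      rw [h2]
      have : 0 ≤ (m * (1 + K)) * e1 := by positivity
      linarith
    constructor
    · intro f hf
      exact (c1 f hf).1.trans (mul_le_mul_of_nonneg_right hcmp (norm_nonneg _))
    · intro f hf
      exact (c2 f hf).1.trans (mul_le_mul_of_nonneg_right hcmp (norm_nonneg _))
  have hang : ∀ y ∈ S, ‖y - x‖ ≤ 2 * ρ → ∀ s, 0 < s → s ≤ 2 * ρ →
      Ang (F y s) T (2 * (D * e0)) ∧ Ang T (F y s) (2 * (D * e0)) := by
    intro y hy hyx
    have main : ∀ k : ℕ, ∀ s, 0 < s → s ≤ 2 * ρ → ρ < 2 ^ k * s →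
        Ang (F y s) T (D * (2 * (4 * ρ) ^ α - s ^ α) * A) ∧
        Ang T (F y s) (D * (2 * (4 * ρ) ^ α - s ^ α) * A) := by
      have hdn : ∀ s, 0 < s → s ≤ 2 * ρ → D * e0 ≤ D * (2 * (4 * ρ) ^ α - s ^ α) * A := by
        intro s hs hs2
        have h1 : s ^ α ≤ (4 * ρ) ^ α := by gcongr; linarith
        rw [he0]
        have : 0 ≤ D * A * ((4 * ρ) ^ α - s ^ α) := by
          have : 0 ≤ (4 * ρ) ^ α - s ^ α := by linarith
          positivity
        linarith
      intro k
      induction k with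
      | zero =>
        intro s hs hs2 hk
        obtain ⟨a, b⟩ := hbase y hy hyx s (by simpa using hk) hs2
        exact ⟨a.mono (hdn s hs hs2), b.mono (hdn s hs hs2)⟩
      | succ k ih =>
        intro s hs hs2 hk
        by_cases hsρ : ρ < s
        · obtain ⟨a, b⟩ := hbase y hy hyx s hsρ hs2
          exact ⟨a.mono (hdn s hs hs2), b.mono (hdn s hs hs2)⟩
        · push Not at hsρ
          obtain ⟨a, b⟩ := ih (2 * s) (by linarith) (by linarith) (by rw [pow_succ] at hk; linarith)
          obtain ⟨c, d⟩ := hstep y hy s hs hsρ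
          have hn1 := hdn (2 * s) (by linarith) (by linarith)
          have hn2 : 0 ≤ D * ((2 * s) ^ α - s ^ α) * A := by
            have : s ^ α ≤ (2 * s) ^ α := by gcongr; linarith
            have : 0 ≤ (2 * s) ^ α - s ^ α := by linarith
            positivity
          exact ⟨(c.trans a (by linarith)).mono (by linarith),
            (b.trans d hn2).mono (by linarith)⟩
    intro s hs hs2
    obtain ⟨k, hk⟩ := pow_unbounded_of_one_lt (ρ / s) (one_lt_two)
    obtain ⟨a, b⟩ := main k s hs hs2 (by rwa [div_lt_iff₀ hs] at hk)
    have : D * (2 * (4 * ρ) ^ α - s ^ α) * A ≤ 2 * (D * e0) := by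
      rw [he0]
      have : 0 ≤ D * s ^ α * A := by positivity
      linarith
    exact ⟨a.mono this, b.mono this⟩
  have hi : ∀ y ∈ S, ∀ z ∈ S, ‖y - x‖ ≤ ρ → ‖z - x‖ ≤ ρ → offp T (y - z) ≤ ε * ‖y - z‖ := by
    intro y hy z hz hyx hzx
    by_cases hyz : y = z
    · simp [hyz, offp]
    have hs : 0 < ‖y - z‖ := norm_pos_iff.2 (sub_ne_zero.2 hyz)
    have hs2 : ‖y - z‖ ≤ 2 * ρ := by
      have := norm_sub_le (y - x) (z - x)
      rw [sub_sub_sub_cancel_right] at this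
      linarith
    obtain ⟨a, -⟩ := hang z hz (by linarith) _ hs hs2
    have h1 := (hF z _ hz hs (by linarith)).2 y hy le_rfl
    have h2 := hpow _ hs (by linarith)
    have h3 := a _ (proj_mem (F z ‖y - z‖) (y - z))
    have h4 := offp_le_add T (y - z) ((F z ‖y - z‖).starProjection (y - z))
    have h5 := proj_norm_le (F z ‖y - z‖) (y - z)
    unfold offp at h1
    have h6 : A * ‖y - z‖ ^ α * ‖y - z‖ ≤ e0 * ‖y - z‖ := by gcongr
    have h7 : 2 * (D * e0) * ‖(F z ‖y - z‖).starProjection (y - z)‖ ≤ 2 * (D * e0) * ‖y - z‖ := by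
      gcongr
    linarith [mul_le_mul_of_nonneg_right hesmall hs.le]
  refine ⟨T, hT, hi, ?_⟩
  -- coverage by minimisation
  intro u hu hur
  have hcomp : IsCompact (S ∩ closedBall x (2 * ρ)) := hS.inter_right isClosed_closedBall
  have hcont : ContinuousOn (fun y => ‖T.starProjection (y - x) - u‖) (S ∩ closedBall x (2 * ρ)) := by
    fun_prop
  obtain ⟨y, ⟨hy, hyb⟩, hmin⟩ := hcomp.exists_isMinOn
    ⟨x, hx, mem_closedBall_self (by positivity)⟩ hcont
  rw [mem_closedBall, dist_eq_norm] at hyb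
  set h := ‖T.starProjection (y - x) - u‖ with hh
  have hhu : h ≤ ‖u‖ := by
    have : h ≤ ‖T.starProjection (x - x) - u‖ :=
      hmin (a := x) ⟨hx, mem_closedBall_self (by positivity)⟩
    rwa [sub_self, map_zero, zero_sub, norm_neg] at this
  have hTy : ‖T.starProjection (y - x)‖ ≤ ρ := by
    have := norm_le_insert' (T.starProjection (y - x)) u
    rw [← hh] at this
    linarith
  have hoff : offp T (y - x) ≤ ρ / 4 := by
    have h1 := hTfl y hy (by linarith)
    rw [← he0] at h1
    linarith [mul_le_mul_of_nonneg_right (show e0 ≤ 1 / 16 by linarith) (show 0 ≤ 4 * ρ by linarith)]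
  have hzero : h = 0 := by
    by_contra hne
    have hpos : 0 < h := lt_of_le_of_ne (norm_nonneg _) (Ne.symm hne)
    have hK1 : 0 < 1 + K := by linarith
    set τ := 1 / (4 * (1 + K)) with hτ
    have hτ0 : 0 < τ := by positivity
    have hτ1 : (1 + K) * τ = 1 / 4 := by rw [hτ]; field_simp
    have hτ2 : τ ≤ 1 / 4 := by linarith [mul_nonneg hK hτ0.le]
    set v := τ • (u - T.starProjection (y - x)) with hv
    have hvT : v ∈ T := T.smul_mem _ (T.sub_mem hu (proj_mem _ _))
    have hvn : ‖v‖ = τ * h := by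
      rw [hv, norm_smul, norm_sub_rev, Real.norm_eq_abs, abs_of_pos hτ0]
    have hvpos : 0 < ‖v‖ := by rw [hvn]; positivity
    obtain ⟨Ty, hTyr, hcov⟩ := hU y hy
    have hPv := proj_norm_le Ty v
    have hvh : τ * h ≤ 1 / 4 * h := mul_le_mul_of_nonneg_right hτ2 hpos.le
    have hKP := mul_le_mul_of_nonneg_left hPv hK
    obtain ⟨z, hz, hz1, hz2⟩ := hcov (Ty.starProjection v) (proj_mem _ _) (by linarith)
    set s := (1 + K) * ‖v‖ with hs
    have hs0 : 0 < s := by positivity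
    have hsh : s = h / 4 := by rw [hs, hvn, ← mul_assoc, hτ1]; ring
    have hwn : ‖z - y‖ ≤ s := by
      have := norm_le_insert' (z - y) (Ty.starProjection v)
      linarith
    obtain ⟨hFy, hFfl⟩ := hF y s hy hs0 (by linarith)
    obtain ⟨-, hTF⟩ := hang y hy hyb s hs0 (by linarith)
    have hw := hFfl z hz hwn
    have hpw := hpow s hs0 (by linarith)
    have hw' : offp (F y s) (z - y) ≤ e0 * s := hw.trans (by gcongr)
    have hvF := hTF v hvT
    -- robust injectivity
    have key : ∀ u ∈ Ty, ‖u‖ = s / (16 * (1 + K)) → ∃ w, Ty.starProjection w = u ∧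
        ‖w - u‖ ≤ K * (s / (16 * (1 + K))) ∧
        offp (F y s) w ≤ (32 * (1 + K) * e0) * (s / (16 * (1 + K))) ∧
        offp (F y s) w ≤ (32 * (1 + K) * e0) * (s / (16 * (1 + K))) := by
      intro u' hu' hut
      have hts : 16 * (1 + K) * (s / (16 * (1 + K))) = s := by field_simp
      set t := s / (16 * (1 + K)) with ht
      have ht0 : 0 < t := by positivity
      have hKt := mul_nonneg hK ht0.le
      obtain ⟨z', hz', hz1', hz2'⟩ := hcov u' hu' (by linarith)
      have hzy : ‖z' - y‖ ≤ (1 + K) * t := by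
        have := norm_le_insert' (z' - y) u'
        rw [hut] at this hz1'
        linarith
      have h1 := hFfl z' hz' (by linarith)
      have h3 : A * s ^ α * s ≤ e0 * s := by gcongr
      have h4 : e0 * s = 16 * (1 + K) * e0 * t := by rw [← hts]; ring
      have h5 : 0 ≤ (1 + K) * e0 * t := by positivity
      refine ⟨z' - y, hz2', by rw [← hut]; exact hz1', by linarith, by linarith⟩
    have hη : (0 : ℝ) ≤ 32 * (1 + K) * e0 := by positivity
    have hmη : (m : ℝ) * (32 * (1 + K) * e0) ≤ 1 / 2 := by linarith
    have hrob := plane_compare hTyr hFy (by positivity) hK hη hmη key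
    set f := (F y s).starProjection (z - y - v) with hf
    have hfb := (hrob f (proj_mem _ _)).2
    have hoffd : offp (F y s) (z - y - v) ≤ (e0 * (1 + K) + 2 * (D * e0)) * ‖v‖ := by
      refine (offp_sub_le _ _ _).trans ?_
      rw [hs] at hw'
      linarith
    have hPf : ‖Ty.starProjection f‖ ≤ offp (F y s) (z - y - v) := by
      have h1 : Ty.starProjection (z - y - v) = 0 := by
        rw [map_sub, hz2, sub_self]
      have h2 : Ty.starProjection f = Ty.starProjection (f - (z - y - v)) := by
        rw [map_sub, h1, sub_zero]
      rw [h2]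
      refine (proj_norm_le _ _).trans ?_
      rw [norm_sub_rev]; exact le_rfl
    have hfin : ‖z - y - v‖ ≤ 1 / 2 * ‖v‖ := by
      have h1 := norm_le_proj_add (F y s) (z - y - v)
      rw [← hf] at h1
      have h2 : ‖f‖ ≤ 2 * m * (1 + K) * offp (F y s) (z - y - v) := hfb.trans (by gcongr)
      have h3 : ‖z - y - v‖ ≤ (2 * m * (1 + K) + 1) * offp (F y s) (z - y - v) := by linarith
      have h4 : (2 * m * (1 + K) + 1) * offp (F y s) (z - y - v) ≤
          (2 * m * (1 + K) + 1) * ((e0 * (1 + K) + 2 * (D * e0)) * ‖v‖) := by gcongr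
      have h5 : (2 * m * (1 + K) + 1) * ((e0 * (1 + K) + 2 * (D * e0)) * ‖v‖)
          = ((2 * m * (1 + K) + 1) * ((1 + K) + 2 * D) * e0) * ‖v‖ := by ring
      have h6 : ((2 * m * (1 + K) + 1) * ((1 + K) + 2 * D) * e0) * ‖v‖ ≤ 1 / 2 * ‖v‖ := by
        gcongr; linarith
      linarith
    have hzb : z ∈ closedBall x (2 * ρ) := by
      rw [mem_closedBall, dist_eq_norm]
      have h1 := norm_le_proj_add T (y - x)
      have h2 := norm_sub_le_norm_sub_add_norm_sub z y x
      linarith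
    have hlt := hmin (a := z) ⟨hz, hzb⟩
    have : ‖T.starProjection (z - x) - u‖ < h := by
      have e1 : T.starProjection (z - x) - u = T.starProjection (z - y - v)
          + (1 - τ) • (T.starProjection (y - x) - u) := by
        have e2 : z - x = (z - y - v) + v + (y - x) := by abel
        rw [e2, map_add, map_add, proj_of_mem hvT, hv]
        module
      rw [e1]
      refine (norm_add_le _ _).trans_lt ?_
      rw [norm_smul, Real.norm_eq_abs, abs_of_nonneg (by linarith), ← hh]
      have := proj_norm_le T (z - y - v)
      linarith
    exact absurd hlt (not_le.2 this)
  have hPu : T.starProjection (y - x) = u := by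
    rw [hh, norm_eq_zero, sub_eq_zero] at hzero
    exact hzero
  refine ⟨y, hy, ?_, hPu⟩
  have h1 := norm_le_proj_add T (y - x)
  rw [hPu] at h1
  have h2 := hi y hy x hx (by linarith) (by simpa using hρ.le)
  have := norm_nonneg (y - x)
  linarith [mul_le_mul_of_nonneg_right hε1 this]

end Charts

end Part2

section Part3

section Mass

variable {V : Type*} [NormedAddCommGroup V] [InnerProductSpace ℝ V] [FiniteDimensional ℝ V]

lemma frame_proj {m : ℕ} {e : Fin m → V} (he : Orthonormal ℝ e) (v : V) :
    (Submodule.span ℝ (Set.range e)).starProjection v = ∑ i, inner ℝ (e i) v • e i := by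
  refine Submodule.eq_starProjection_of_mem_of_inner_eq_zero ?_ ?_
  · exact Submodule.sum_mem _ fun i _ => Submodule.smul_mem _ _ (Submodule.subset_span ⟨i, rfl⟩)
  · intro w hw
    induction hw using Submodule.span_induction with
    | mem x hx =>
      obtain ⟨j, rfl⟩ := hx
      rw [inner_sub_left, sum_inner]
      have : ∀ i, inner ℝ (inner ℝ (e i) v • e i) (e j) = if i = j then inner ℝ (e j) v else 0 := by
        intro i
        rw [inner_smul_left, orthonormal_iff_ite.1 he i j]
        split_ifs with h
        · simp [h]
        · simp
      rw [Finset.sum_congr rfl fun i _ => this i]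
      simp [real_inner_comm]
    | zero => simp
    | add x y _ _ hx hy => rw [inner_add_right, hx, hy, add_zero]
    | smul a x _ hx => rw [inner_smul_right, hx, mul_zero]

lemma frame_finrank {m : ℕ} {e : Fin m → V} (he : Orthonormal ℝ e) :
    Module.finrank ℝ (Submodule.span ℝ (Set.range e)) = m := by
  rw [finrank_span_eq_card he.linearIndependent]; simp

lemma exists_frame {m : ℕ} {T : Submodule ℝ V} (hT : Module.finrank ℝ T = m) :
    ∃ e : Fin m → V, Orthonormal ℝ e ∧ Submodule.span ℝ (Set.range e) = T := by
  let b := (stdOrthonormalBasis ℝ T).reindex (finCongr hT)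
  refine ⟨fun i => (b i : V), ?_, ?_⟩
  · exact b.orthonormal.comp_linearIsometry T.subtypeₗᵢ
  · have h1 : (Set.range fun i => (b i : V)) = T.subtype '' (Set.range b) := by
      rw [← Set.range_comp]; rfl
    rw [h1, ← Submodule.map_span]
    have h2 : Submodule.span ℝ (Set.range b) = ⊤ := by
      have := b.toBasis.span_eq
      rwa [b.coe_toBasis] at this
    rw [h2, Submodule.map_subtype_top]

variable [MeasurableSpace V] [BorelSpace V]

lemma mass_lower {m : ℕ} (hm : 1 ≤ m) {S : Set V} {r K s : ℝ} (hK : 0 ≤ K)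
    (hU : UProp m S r K) {x : V} (hx : x ∈ S) (hs : 0 < s) (hsr : s ≤ (1 + K) * r) :
    ENNReal.ofReal ((1 / ((1 + K) * m) * s) ^ m) ≤ μH[(m : ℝ)] (S ∩ closedBall x s) := by
  obtain ⟨T, hT, hcov⟩ := hU x hx
  obtain ⟨e, he, rfl⟩ := exists_frame hT
  have hm0 : (0 : ℝ) < m := by exact_mod_cast hm
  have hK1 : 0 < 1 + K := by linarith
  let g : V → (Fin m → ℝ) := fun v i => inner ℝ (e i) v
  have hg : LipschitzWith 1 g := by
    refine LipschitzWith.of_dist_le_mul fun v w => ?_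
    rw [NNReal.coe_one, one_mul, dist_pi_le_iff dist_nonneg]
    intro i
    rw [Real.dist_eq, ← inner_sub_right, dist_eq_norm]
    refine (abs_real_inner_le_norm _ _).trans ?_
    rw [he.1 i, one_mul]
  set t := 1 / ((1 + K) * m) * s with ht
  have ht0 : 0 < t := by positivity
  have hsub : closedBall (g x) t ⊆ g '' (S ∩ closedBall x s) := by
    intro c hc
    rw [mem_closedBall, dist_pi_le_iff ht0.le] at hc
    set u : V := ∑ i, (c i - g x i) • e i with hu
    have huT : u ∈ Submodule.span ℝ (Set.range e) :=
      Submodule.sum_mem _ fun i _ => Submodule.smul_mem _ _ (Submodule.subset_span ⟨i, rfl⟩)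
    have hun : ‖u‖ ≤ m * t := by
      refine (norm_sum_le _ _).trans ?_
      have : ∀ i ∈ Finset.univ, ‖(c i - g x i) • e i‖ ≤ t := by
        intro i _
        rw [norm_smul, he.1 i, mul_one, ← dist_eq_norm]
        exact hc i
      refine (Finset.sum_le_sum this).trans ?_
      simp
    have hmt : (1 + K) * (m * t) = s := by rw [ht]; field_simp
    have hur : ‖u‖ ≤ r := by
      refine hun.trans ?_
      rw [← hmt] at hsr
      exact le_of_mul_le_mul_left hsr hK1
    obtain ⟨y, hy, hy1, hy2⟩ := hcov u huT hur
    refine ⟨y, ⟨hy, ?_⟩, ?_⟩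
    · rw [mem_closedBall, dist_eq_norm]
      have h1 := norm_le_insert' (y - x) u
      have h2 := mul_le_mul_of_nonneg_left hun hK1.le
      linarith
    · ext i
      have h1 : inner ℝ (e i) u = c i - g x i := by
        rw [hu]; exact he.inner_right_fintype _ i
      have h2 : inner ℝ (e i) u = inner ℝ (e i) (y - x) := by
        rw [← hy2, frame_proj he]
        exact he.inner_right_fintype _ i
      rw [h2, inner_sub_right] at h1
      simp only [g] at h1 ⊢
      linarith
  have h1 : μH[(m : ℝ)] (g '' (S ∩ closedBall x s)) ≤ μH[(m : ℝ)] (S ∩ closedBall x s) := by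
    have := hg.hausdorffMeasure_image_le (d := (m : ℝ)) (by positivity) (S ∩ closedBall x s)
    simpa using this
  have hvol : (μH[(m : ℝ)] : Measure (Fin m → ℝ)) = volume := by
    have := hausdorffMeasure_pi_real (ι := Fin m)
    simpa using this
  refine le_trans ?_ ((measure_mono hsub).trans h1)
  rw [hvol, Real.volume_pi_closedBall _ ht0.le]
  refine ENNReal.ofReal_le_ofReal ?_
  simp only [Fintype.card_fin]
  gcongr
  linarith

end Mass

end Part3

section Part4

section Greedy

variable {V : Type*} [NormedAddCommGroup V] [InnerProductSpace ℝ V] [FiniteDimensional ℝ V]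

lemma exists_extend {m : ℕ} (hmV : m ≤ Module.finrank ℝ V) (W : Submodule ℝ V)
    (hW : Module.finrank ℝ W ≤ m) : ∃ T : Submodule ℝ V, W ≤ T ∧ Module.finrank ℝ T = m := by
  obtain ⟨k, hk⟩ := Nat.exists_eq_add_of_le hW
  induction k generalizing W with
  | zero => exact ⟨W, le_rfl, by omega⟩
  | succ k ih =>
    have hne : W ≠ ⊤ := by
      rintro rfl
      rw [finrank_top] at hk
      omega
    obtain ⟨v, -, hv⟩ := SetLike.exists_of_lt (lt_top_iff_ne_top.2 hne)
    have hlt : W < W ⊔ Submodule.span ℝ {v} :=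
      lt_of_le_of_ne le_sup_left (fun h => hv (h ▸ Submodule.mem_sup_right
        (Submodule.mem_span_singleton_self v)))
    have h1 := Submodule.finrank_lt_finrank_of_lt hlt
    have h2 := Submodule.finrank_add_le_finrank_add_finrank W (Submodule.span ℝ {v})
    have h3 := finrank_span_le_card (R := ℝ) ({v} : Set V)
    simp at h3
    obtain ⟨T, hT, hT2⟩ := ih (W ⊔ Submodule.span ℝ {v}) (by omega) (by omega)
    exact ⟨T, le_sup_left.trans hT, hT2⟩

lemma offp_add_mem (T : Submodule ℝ V) {w q : V} (hq : q ∈ T) : offp T (w + q) = offp T w := by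
  unfold offp
  rw [map_add, proj_of_mem hq]
  congr 1; abel

lemma greedy {m : ℕ} (hmV : m ≤ Module.finrank ℝ V) {S : Set V} {x : V} {s ε : ℝ}
    (hs : 0 < s) (hε : 0 < ε) (hε1 : ε ≤ 1)
    (hnot : ∀ T : Submodule ℝ V, Module.finrank ℝ T = m →
      ∃ y ∈ S, ‖y - x‖ ≤ s ∧ ε * s < offp T (y - x)) (k : ℕ) (hk : k ≤ m + 1) :
    ∃ v : Fin k → V, (∀ i, x + v i ∈ S ∧ ‖v i‖ ≤ s) ∧
      ∀ a : Fin k → ℝ, (ε / 2) ^ k * s * ‖a‖ ≤ ‖∑ i, a i • v i‖ := by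
  induction k with
  | zero =>
    refine ⟨Fin.elim0, fun i => i.elim0, fun a => ?_⟩
    have : a = 0 := Subsingleton.elim _ _
    rw [this, norm_zero, mul_zero]
    exact norm_nonneg _
  | succ k ih =>
    obtain ⟨v, hv1, hv2⟩ := ih (by omega)
    have hW := finrank_range_le_card (R := ℝ) v
    rw [Set.finrank, Fintype.card_fin] at hW
    obtain ⟨T, hWT, hT⟩ := exists_extend hmV (Submodule.span ℝ (Set.range v)) (hW.trans (by omega))
    obtain ⟨y, hy, hyx, hoff⟩ := hnot T hT
    refine ⟨Fin.cons (y - x) v, ?_, ?_⟩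
    · intro i
      refine Fin.cases ?_ (fun j => ?_) i
      · simpa using ⟨hy, hyx⟩
      · simpa using hv1 j
    · intro a
      rw [Fin.sum_univ_succ]
      simp only [Fin.cons_zero, Fin.cons_succ]
      set q := ∑ i : Fin k, a i.succ • v i with hq
      have hqT : q ∈ T := Submodule.sum_mem _ fun i _ => Submodule.smul_mem _ _
        (hWT (Submodule.subset_span ⟨i, rfl⟩))
      have hq2 := hv2 (fun i => a i.succ)
      rw [← hq] at hq2
      set b : Fin k → ℝ := fun i => a i.succ with hb
      set N := ‖a 0 • (y - x) + q‖ with hN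
      have n1 : |a 0| * (ε * s) ≤ N := by
        have h1 := offp_le_norm T (a 0 • (y - x) + q)
        rw [offp_add_mem T hqT, offp_smul] at h1
        exact le_trans (by gcongr) h1
      have n2 : ‖q‖ - |a 0| * s ≤ N := by
        have h1 := norm_sub_le (a 0 • (y - x) + q) (a 0 • (y - x))
        rw [add_sub_cancel_left, norm_smul, Real.norm_eq_abs] at h1
        have : |a 0| * ‖y - x‖ ≤ |a 0| * s := by gcongr
        linarith
      have hpk : (ε / 2) ^ (k + 1) = (ε / 2) ^ k * (ε / 2) := pow_succ _ _
      have hN0 : 0 ≤ N := norm_nonneg _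
      have hp1 : (ε / 2) ^ k ≤ 1 := pow_le_one₀ (by linarith) (by linarith)
      have hp0 : 0 < (ε / 2) ^ k := by positivity
      have c0 : (ε / 2) ^ (k + 1) * s * |a 0| ≤ N := by
        refine le_trans ?_ n1
        have : (ε / 2) ^ (k + 1) ≤ ε := by rw [hpk]; nlinarith
        calc (ε / 2) ^ (k + 1) * s * |a 0| ≤ ε * s * |a 0| := by gcongr
          _ = _ := by ring
      have c1 : (ε / 2) ^ (k + 1) * s * ‖b‖ ≤ N := by
        have h1 : (1 - ε / 2) * (|a 0| * (ε * s)) ≤ (1 - ε / 2) * N :=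
          mul_le_mul_of_nonneg_left n1 (by linarith)
        have h2 : (ε / 2) * (‖q‖ - |a 0| * s) ≤ (ε / 2) * N :=
          mul_le_mul_of_nonneg_left n2 (by linarith)
        have h3 : (ε / 2) * ((ε / 2) ^ k * s * ‖b‖) ≤ (ε / 2) * ‖q‖ :=
          mul_le_mul_of_nonneg_left hq2 (by linarith)
        have h4 : 0 ≤ (ε / 2) * (1 - ε) * (|a 0| * s) := by
          have : 0 ≤ 1 - ε := by linarith
          positivity
        rw [hpk]
        nlinarith
      have hA : 0 < (ε / 2) ^ (k + 1) * s := by positivity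
      rw [← le_div_iff₀' hA, pi_norm_le_iff_of_nonneg (by positivity)]
      intro i
      rw [le_div_iff₀' hA]
      refine Fin.cases c0 (fun j => ?_) i
      refine le_trans ?_ c1
      gcongr
      exact norm_le_pi_norm b j

lemma perturb {k : ℕ} {v w : Fin k → V} {κ δ : ℝ} (hk : k * δ ≤ κ / 2)
    (hv : ∀ a : Fin k → ℝ, κ * ‖a‖ ≤ ‖∑ i, a i • v i‖)
    (hw : ∀ i, ‖w i - v i‖ ≤ δ) (a : Fin k → ℝ) : κ / 2 * ‖a‖ ≤ ‖∑ i, a i • w i‖ := by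
  have h1 : ‖∑ i, a i • (w i - v i)‖ ≤ k * δ * ‖a‖ := by
    refine (norm_sum_le _ _).trans ?_
    have : ∀ i ∈ Finset.univ, ‖a i • (w i - v i)‖ ≤ ‖a‖ * δ := by
      intro i _
      rw [norm_smul]
      gcongr
      · exact norm_le_pi_norm a i
      · exact hw i
    refine (Finset.sum_le_sum this).trans ?_
    simp
    linarith
  have h2 : ∑ i, a i • v i = ∑ i, a i • w i - ∑ i, a i • (w i - v i) := by
    rw [← Finset.sum_sub_distrib]
    congr 1; ext i; rw [smul_sub]; abel
  have h3 := hv a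
  rw [h2] at h3
  have h4 := norm_sub_le (∑ i, a i • w i) (∑ i, a i • (w i - v i))
  have h5 : k * δ * ‖a‖ ≤ κ / 2 * ‖a‖ := by gcongr
  linarith

variable [MeasurableSpace V] [BorelSpace V]

lemma simplex_vol {k : ℕ} (hk : 1 ≤ k) (z : Fin (k + 1) → V) {κ : ℝ} (hκ : 0 < κ)
    (h : ∀ a : Fin k → ℝ, κ * ‖a‖ ≤ ‖∑ i, a i • (z i.succ - z 0)‖) :
    ENNReal.ofReal ((κ / k) ^ k) ≤ μH[(k : ℝ)] (convexHull ℝ (Set.range z)) := by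
  have hk0 : (0 : ℝ) < k := by exact_mod_cast hk
  let Φ : (Fin k → ℝ) → V := fun a => z 0 + ∑ i, a i • (z i.succ - z 0)
  have hΦ : AntilipschitzWith (Real.toNNReal (1 / κ)) Φ := by
    refine AntilipschitzWith.of_le_mul_dist fun a b => ?_
    rw [Real.coe_toNNReal _ (by positivity), dist_eq_norm, dist_eq_norm]
    have h1 := h (a - b)
    have h2 : Φ a - Φ b = ∑ i, (a - b) i • (z i.succ - z 0) := by
      simp only [Φ, Pi.sub_apply, sub_smul, Finset.sum_sub_distrib]; abel
    rw [h2, one_div, ← div_eq_inv_mul, le_div_iff₀' hκ]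
    exact h1
  have hbox := hΦ.le_hausdorffMeasure_image (d := (k : ℝ)) (by positivity)
    (closedBall (fun _ => 1 / (2 * (k : ℝ))) (1 / (2 * (k : ℝ))))
  have hvol : (μH[(k : ℝ)] : Measure (Fin k → ℝ)) = volume := by
    have := hausdorffMeasure_pi_real (ι := Fin k)
    simpa using this
  rw [hvol, Real.volume_pi_closedBall _ (by positivity), Fintype.card_fin] at hbox
  have hsub : Φ '' (closedBall (fun _ => 1 / (2 * (k : ℝ))) (1 / (2 * (k : ℝ)))) ⊆
      convexHull ℝ (Set.range z) := by
    rintro _ ⟨a, ha, rfl⟩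
    rw [mem_closedBall, dist_pi_le_iff (by positivity)] at ha
    have ha0 : ∀ i, 0 ≤ a i ∧ a i ≤ 1 / k := by
      intro i
      have := abs_le.1 ((Real.dist_eq _ _) ▸ ha i)
      have e : 1 / (k : ℝ) = 2 * (1 / (2 * (k : ℝ))) := by field_simp
      constructor <;> linarith [this.1, this.2]
    have hsum : ∑ i, a i ≤ 1 := by
      refine (Finset.sum_le_sum fun i _ => (ha0 i).2).trans ?_
      simp
      rw [mul_inv_cancel₀ hk0.ne']
    have e : Φ a = ∑ i : Fin (k + 1), (Fin.cons (1 - ∑ i, a i) a : Fin (k + 1) → ℝ) i • z i := by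
      rw [Fin.sum_univ_succ]
      simp only [Φ, Fin.cons_zero, Fin.cons_succ, smul_sub, Finset.sum_sub_distrib,
        ← Finset.sum_smul]
      module
    rw [e]
    refine (convex_convexHull ℝ _).sum_mem ?_ ?_ ?_
    · intro i _
      refine Fin.cases ?_ (fun j => ?_) i
      · simpa using hsum
      · simpa using (ha0 j).1
    · rw [Fin.sum_univ_succ]; simp
    · intro i _
      exact subset_convexHull ℝ _ ⟨i, rfl⟩
  have h1 := hbox.trans (mul_le_mul_right (measure_mono hsub) _)
  rw [ENNReal.rpow_natCast] at h1
  have h2 : ENNReal.ofReal (κ ^ k) * ((Real.toNNReal (1 / κ) : ℝ≥0) : ℝ≥0∞) ^ k = 1 := by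
    change ENNReal.ofReal (κ ^ k) * ENNReal.ofReal (1 / κ) ^ k = 1
    rw [← ENNReal.ofReal_pow (by positivity), ← ENNReal.ofReal_mul (by positivity), ← mul_pow,
      mul_one_div_cancel hκ.ne']
    simp
  calc ENNReal.ofReal ((κ / k) ^ k)
      = ENNReal.ofReal (κ ^ k) * ENNReal.ofReal ((2 * (1 / (2 * (k : ℝ)))) ^ k) := by
        rw [← ENNReal.ofReal_mul (by positivity), ← mul_pow]
        congr 2; field_simp
    _ ≤ ENNReal.ofReal (κ ^ k) * (((Real.toNNReal (1 / κ) : ℝ≥0) : ℝ≥0∞) ^ k *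
        μH[(k : ℝ)] (convexHull ℝ (Set.range z))) := mul_le_mul_right h1 _
    _ = _ := by rw [← mul_assoc, h2, one_mul]

end Greedy

end Part4

section Part5

lemma ediam_ofReal_le {n k : ℕ} {z : Fin k → EuclideanSpace ℝ (Fin n)} {D : ℝ}
    (h : ∀ i j, ‖z i - z j‖ ≤ D) : EMetric.diam (Set.range z) ≤ ENNReal.ofReal D := by
  refine Metric.ediam_le ?_
  rintro _ ⟨i, rfl⟩ _ ⟨j, rfl⟩
  rw [edist_dist, dist_eq_norm]
  exact ENNReal.ofReal_le_ofReal (h i j)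

lemma curv_lower {m n : ℕ} {z : Fin (m + 2) → EuclideanSpace ℝ (Fin n)} {κ D : ℝ} (hκ : 0 < κ)
    (hD : 0 < D) (h : ∀ a : Fin (m + 1) → ℝ, κ * ‖a‖ ≤ ‖∑ i, a i • (z i.succ - z 0)‖)
    (hd : ∀ i j, ‖z i - z j‖ ≤ D) :
    ENNReal.ofReal ((κ / (m + 1)) ^ (m + 1) / D ^ (m + 2)) ≤ mengerCurv m n z := by
  have h1 := simplex_vol (k := m + 1) (by omega) z hκ h
  push_cast at h1
  rw [ENNReal.ofReal_div_of_pos (by positivity), ENNReal.ofReal_pow hD.le]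
  exact ENNReal.div_le_div h1 (pow_le_pow_left' (ediam_ofReal_le hd) _)

set_option maxHeartbeats 1000000 in
lemma energy_lower {m n l : ℕ} {p : ℝ} (hm : 1 ≤ m) (hmn : m ≤ n) (hl2 : 2 ≤ l) (hlm : l ≤ m + 2)
    (hp : 0 < p) {S : Set (EuclideanSpace ℝ (Fin n))} (hfin : μH[(m : ℝ)] S ≠ ⊤)
    {x : EuclideanSpace ℝ (Fin n)} (hx : x ∈ S) {s ε a κ : ℝ} (hs : 0 < s) (hε : 0 < ε)
    (hε1 : ε ≤ 1) (ha : 0 < a) (hκ : κ = (ε / 2) ^ (m + 1))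
    (hmass : ∀ y ∈ S, ∀ t, 0 < t → t ≤ s / 100 →
      ENNReal.ofReal ((a * t) ^ m) ≤ μH[(m : ℝ)] (S ∩ closedBall y t))
    (hnot : ∀ T : Submodule ℝ (EuclideanSpace ℝ (Fin n)), Module.finrank ℝ T = m →
      ∃ y ∈ S, ‖y - x‖ ≤ s ∧ ε * s < offp T (y - x)) :
    ENNReal.ofReal (((a * (κ / (100 * (m + 1)) * s)) ^ m) ^ l *
      ((κ / (2 * (m + 1))) ^ (m + 1) / (4 ^ (m + 2) * s)) ^ p) ≤ mengerEnergy m n l p S := by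
  obtain ⟨v, hv1, hv2⟩ := greedy (m := m) (by simpa using hmn) hs hε hε1 hnot (m + 1) le_rfl
  rw [← hκ] at hv2
  have hκ0 : 0 < κ := by rw [hκ]; positivity
  have hκ1 : κ ≤ 1 := by rw [hκ]; exact pow_le_one₀ (by linarith) (by linarith)
  set δ := κ / (100 * (m + 1)) * s with hδ
  have hδ0 : 0 < δ := by positivity
  have hδs : (m + 1) * δ = κ * s / 100 := by rw [hδ]; field_simp
  have hκs : κ * s ≤ s := by nlinarith
  have hδ1 : δ ≤ s / 100 := by
    have : 0 ≤ m * δ := by positivity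
    linarith
  set X : Fin (m + 2) → EuclideanSpace ℝ (Fin n) := Fin.cons x (fun i => x + v i) with hX
  have hXS : ∀ i, X i ∈ S := by
    intro i
    refine Fin.cases ?_ (fun j => ?_) i
    · simpa [hX] using hx
    · simpa [hX] using (hv1 j).1
  have hXx : ∀ i, ‖X i - x‖ ≤ s := by
    intro i
    refine Fin.cases ?_ (fun j => ?_) i
    · simpa [hX] using hs.le
    · simpa [hX] using (hv1 j).2
  set L := ENNReal.ofReal ((κ / (2 * (m + 1))) ^ (m + 1) / (4 ^ (m + 2) * s)) with hL
  have key : ∀ z : Fin (m + 2) → EuclideanSpace ℝ (Fin n), (∀ i, ‖z i - X i‖ ≤ δ) →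
      L ≤ mengerCurv m n z ∧ z 0 ≠ z 1 := by
    intro z hz
    have hw : ∀ i : Fin (m + 1), ‖(z i.succ - z 0) - v i‖ ≤ 2 * δ := by
      intro i
      have h1 : (z i.succ - z 0) - v i = (z i.succ - X i.succ) - (z 0 - X 0) := by
        simp only [hX, Fin.cons_succ, Fin.cons_zero]; abel
      rw [h1]
      refine (norm_sub_le _ _).trans ?_
      linarith [hz i.succ, hz 0]
    have h2 := perturb (κ := κ * s) (δ := 2 * δ) (by push_cast; nlinarith) hv2 hw
    have hd : ∀ i j, ‖z i - z j‖ ≤ 4 * s := by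
      intro i j
      have h1 : z i - z j = (z i - X i) - (z j - X j) + ((X i - x) - (X j - x)) := by abel
      rw [h1]
      have := norm_add_le ((z i - X i) - (z j - X j)) ((X i - x) - (X j - x))
      have := norm_sub_le (z i - X i) (z j - X j)
      have := norm_sub_le (X i - x) (X j - x)
      linarith [hz i, hz j, hXx i, hXx j]
    constructor
    · have h3 := curv_lower (by positivity) (by positivity) h2 hd
      refine le_trans (le_of_eq ?_) h3
      rw [hL]; congr 1
      have e1 : κ * s / 2 / (m + 1) = κ / (2 * (m + 1)) * s := by field_simp
      rw [e1, mul_pow, mul_pow]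
      field_simp
      ring
    · intro h01
      have h3 := h2 (Pi.single 0 1)
      have e1 : ∑ i : Fin (m + 1), (Pi.single 0 1 : Fin (m + 1) → ℝ) i • (z i.succ - z 0) = 0 := by
        rw [Fin.sum_univ_succ]
        simp [h01]
      rw [e1, norm_zero, Pi.norm_single] at h3
      simp at h3
      have : 0 < κ * s := by positivity
      linarith
  set B : Set (Fin l → EuclideanSpace ℝ (Fin n)) :=
    Set.univ.pi (fun i : Fin l => closedBall (X (Fin.castLE hlm i)) δ) with hB
  have hBm : MeasurableSet B := MeasurableSet.univ_pi fun i => measurableSet_closedBall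
  have hint : ∀ y ∈ B, L ^ p ≤ mengerIntegrand m n l S y ^ p := by
    intro y hy
    have hy' : ∀ i, ‖y i - X (Fin.castLE hlm i)‖ ≤ δ := by
      intro i
      have := hy i (Set.mem_univ _)
      rwa [mem_closedBall, dist_eq_norm] at this
    let z : Fin (m + 2) → EuclideanSpace ℝ (Fin n) := fun i =>
      if h : (i : ℕ) < l then y ⟨i, h⟩ else X i
    have hz : ∀ i, ‖z i - X i‖ ≤ δ := by
      intro i
      by_cases h : (i : ℕ) < l
      · simp only [z, h, dif_pos]
        exact hy' ⟨i, h⟩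
      · simp only [z, h, dif_neg, not_false_eq_true, sub_self, norm_zero]
        exact hδ0.le
    obtain ⟨k1, k2⟩ := key z hz
    have hext : ExtendsIn m n l S y z := by
      constructor
      · intro i h
        simp only [z, h, dif_pos]
      · intro i h
        simp only [z, not_lt.2 h, dif_neg, not_false_eq_true]
        exact hXS i
    have hne : ¬ ∀ i j : Fin l, y i = y j := by
      intro h
      apply k2
      have h0 : ((0 : Fin (m + 2)) : ℕ) < l := by simp; omega
      have h1 : ((1 : Fin (m + 2)) : ℕ) < l := by simp; omega
      rw [hext.1 0 h0, hext.1 1 h1]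
      exact h _ _
    refine ENNReal.rpow_le_rpow ?_ hp.le
    rw [mengerIntegrand, if_neg hne]
    exact k1.trans (le_iSup₂_of_le z hext le_rfl)
  have : IsFiniteMeasure ((μH[(m : ℝ)] : Measure (EuclideanSpace ℝ (Fin n))).restrict S) :=
    ⟨by simpa [lt_top_iff_ne_top] using hfin⟩
  have hμB : ENNReal.ofReal ((a * δ) ^ m) ^ l ≤ (Measure.pi fun _ : Fin l =>
        (μH[(m : ℝ)] : Measure (EuclideanSpace ℝ (Fin n))).restrict S) B := by
    rw [hB, Measure.pi_pi]
    have : ENNReal.ofReal ((a * δ) ^ m) ^ l = ∏ _i : Fin l, ENNReal.ofReal ((a * δ) ^ m) := by simp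
    rw [this]
    refine Finset.prod_le_prod' fun i _ => ?_
    rw [Measure.restrict_apply measurableSet_closedBall, Set.inter_comm]
    exact hmass _ (hXS _) δ hδ0 hδ1
  calc ENNReal.ofReal (((a * δ) ^ m) ^ l *
      ((κ / (2 * (m + 1))) ^ (m + 1) / (4 ^ (m + 2) * s)) ^ p)
      = L ^ p * ENNReal.ofReal ((a * δ) ^ m) ^ l := by
        rw [mul_comm, ENNReal.ofReal_mul (by positivity), hL,
          ENNReal.ofReal_rpow_of_pos (by positivity), ENNReal.ofReal_pow (by positivity)]
    _ ≤ L ^ p * (Measure.pi fun _ : Fin l =>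
        (μH[(m : ℝ)] : Measure (EuclideanSpace ℝ (Fin n))).restrict S) B := mul_le_mul_right hμB _
    _ = ∫⁻ _ in B, L ^ p ∂(Measure.pi fun _ : Fin l =>
        (μH[(m : ℝ)] : Measure (EuclideanSpace ℝ (Fin n))).restrict S) := by
        rw [setLIntegral_const]
    _ ≤ ∫⁻ y in B, mengerIntegrand m n l S y ^ p ∂(Measure.pi fun _ : Fin l =>
        (μH[(m : ℝ)] : Measure (EuclideanSpace ℝ (Fin n))).restrict S) :=
        setLIntegral_mono' hBm hint
    _ ≤ _ := setLIntegral_le_lintegral _ _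

/-- flatness from energy -/
lemma flat_of_energy {m n l : ℕ} {p E a : ℝ} (hm : 1 ≤ m) (hmn : m ≤ n) (hl2 : 2 ≤ l)
    (hlm : l ≤ m + 2) (hp : (m : ℝ) * l < p) (ha : 0 < a) :
    ∃ A α : ℝ, 0 < A ∧ 0 < α ∧ ∀ S : Set (EuclideanSpace ℝ (Fin n)), μH[(m : ℝ)] S ≠ ⊤ →
      mengerEnergy m n l p S ≤ ENNReal.ofReal E → ∀ x ∈ S, ∀ s, 0 < s →
      (∀ y ∈ S, ∀ t, 0 < t → t ≤ s / 100 →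
        ENNReal.ofReal ((a * t) ^ m) ≤ μH[(m : ℝ)] (S ∩ closedBall y t)) →
      ∃ F : Submodule ℝ (EuclideanSpace ℝ (Fin n)), Module.finrank ℝ F = m ∧
        ∀ y ∈ S, ‖y - x‖ ≤ s → offp F (y - x) ≤ A * s ^ α * s := by
  have hp0 : 0 < p := lt_of_le_of_lt (by positivity) hp
  have hm0 : (0 : ℝ) < m := by exact_mod_cast hm
  have hl0 : (0 : ℝ) < l := by exact_mod_cast (by omega : 0 < l)
  set Q : ℝ := (m + 1) * (m * l) + (m + 1) * ((m + 1) * p) with hQ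
  have hQ0 : 0 < Q := by positivity
  -- the constant
  set C : ℝ := ((a * (1 / (100 * (m + 1)))) ^ m) ^ l *
    ((1 / (2 * (m + 1))) ^ (m + 1) / (4 ^ (m + 2))) ^ p * (1 / 2) ^ Q with hC
  have hC0 : 0 < C := by positivity
  set A : ℝ := ((|E| + 1) / C) ^ (1 / Q) with hA
  have hA0 : 0 < A := by positivity
  set α : ℝ := (p - m * l) / Q with hα
  have hα0 : 0 < α := div_pos (by linarith) hQ0
  have halg : ∀ s, 0 < s → ∀ ε κ, ε = A * s ^ α → κ = (ε / 2) ^ (m + 1) →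
      ((a * (κ / (100 * (m + 1)) * s)) ^ m) ^ l *
      ((κ / (2 * (m + 1))) ^ (m + 1) / (4 ^ (m + 2) * s)) ^ p = |E| + 1 := by
    intro s hs ε κ hε hκ
    have hε0 : 0 < ε := by rw [hε]; positivity
    have hκ0 : 0 < κ := by rw [hκ]; positivity
    have e1 : ((a * (κ / (100 * (m + 1)) * s)) ^ m) ^ l =
        ((a * (1 / (100 * (m + 1)))) ^ m) ^ l * (κ ^ ((m : ℝ) * l) * s ^ ((m : ℝ) * l)) := by
      have : a * (κ / (100 * (m + 1)) * s) = a * (1 / (100 * (m + 1))) * (κ * s) := by ring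
      rw [this, mul_pow, mul_pow, ← Real.mul_rpow hκ0.le hs.le]
      congr 1
      rw [← pow_mul, ← Real.rpow_natCast]
      push_cast; rfl
    have ek : κ ^ (m + 1) = κ ^ ((m : ℝ) + 1) := by
      rw [← Real.rpow_natCast]; push_cast; rfl
    have e2 : ((κ / (2 * (m + 1))) ^ (m + 1) / (4 ^ (m + 2) * s)) ^ p =
        ((1 / (2 * (m + 1))) ^ (m + 1) / (4 ^ (m + 2))) ^ p * (κ ^ (((m : ℝ) + 1) * p) * s ^ (-p)) := by
      have : (κ / (2 * (m + 1))) ^ (m + 1) / (4 ^ (m + 2) * s) =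
        ((1 / (2 * (m + 1))) ^ (m + 1) / (4 ^ (m + 2))) * (κ ^ (m + 1) * s⁻¹) := by
        rw [div_pow, div_pow, one_pow]; field_simp
      rw [this, Real.mul_rpow (by positivity) (by positivity),
        Real.mul_rpow (by positivity) (by positivity), Real.inv_rpow hs.le, Real.rpow_neg hs.le,
        Real.rpow_mul hκ0.le, ← ek]
    have e3 : κ ^ ((m : ℝ) * l) * κ ^ (((m : ℝ) + 1) * p) = (1 / 2) ^ Q * ε ^ Q := by
      rw [← Real.rpow_add hκ0, hκ, ← Real.rpow_natCast, ← Real.rpow_mul (by positivity),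
        ← Real.mul_rpow (by positivity) hε0.le]
      congr 1
      · ring
      · rw [hQ]; push_cast; ring
    have e4 : ε ^ Q = (|E| + 1) / C * s ^ (p - m * l) := by
      rw [hε, Real.mul_rpow hA0.le (by positivity), hA, ← Real.rpow_mul (by positivity),
        ← Real.rpow_mul hs.le, one_div_mul_cancel hQ0.ne', Real.rpow_one, hα,
        div_mul_cancel₀ _ hQ0.ne']
    have e5 : s ^ (p - m * l) * (s ^ ((m : ℝ) * l) * s ^ (-p)) = 1 := by
      rw [← Real.rpow_add hs, ← Real.rpow_add hs]
      have : p - m * l + (m * l + -p) = 0 := by ring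
      rw [this, Real.rpow_zero]
    rw [e1, e2]
    set c1 := ((a * (1 / (100 * ((m : ℝ) + 1)))) ^ m) ^ l
    set c2 := ((1 / (2 * ((m : ℝ) + 1))) ^ (m + 1) / (4 ^ (m + 2))) ^ p
    calc c1 * (κ ^ ((m : ℝ) * l) * s ^ ((m : ℝ) * l)) * (c2 * (κ ^ (((m : ℝ) + 1) * p) * s ^ (-p)))
        = c1 * c2 * (κ ^ ((m : ℝ) * l) * κ ^ (((m : ℝ) + 1) * p)) *
          (s ^ ((m : ℝ) * l) * s ^ (-p)) := by ring
      _ = C * ((|E| + 1) / C) * (s ^ (p - m * l) * (s ^ ((m : ℝ) * l) * s ^ (-p))) := by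
          rw [e3, e4, hC]; ring
      _ = |E| + 1 := by rw [e5, mul_one, mul_div_cancel₀ _ hC0.ne']
  refine ⟨A, α, hA0, hα0, fun S hfin hE x hx s hs hmass => ?_⟩
  by_cases hbig : 1 ≤ A * s ^ α
  · obtain ⟨T, -, hT⟩ := exists_extend (V := EuclideanSpace ℝ (Fin n)) (m := m) (by simpa using hmn)
      ⊥ (by simp)
    refine ⟨T, hT, fun y hy hys => (offp_le_norm _ _).trans (hys.trans ?_)⟩
    nlinarith
  · push Not at hbig
    by_contra hcon
    push Not at hcon
    have h1 := energy_lower hm hmn hl2 hlm hp0 hfin hx hs (ε := A * s ^ α) (by positivity) hbig.le ha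
      rfl hmass hcon
    rw [halg s hs _ _ rfl rfl] at h1
    have h2 := h1.trans hE
    rw [ENNReal.ofReal_le_ofReal_iff'] at h2
    rcases h2 with h2 | h2
    · linarith [le_abs_self E]
    · linarith [abs_nonneg E]

end Part5

section Part6

lemma UProp.mono {V : Type*} [NormedAddCommGroup V] [InnerProductSpace ℝ V]
    [FiniteDimensional ℝ V] {m : ℕ} {S : Set V} {r r' K : ℝ} (h : UProp m S r K) (hr : r' ≤ r) :
    UProp m S r' K := by
  intro x hx
  obtain ⟨T, hT, h1⟩ := h x hx
  exact ⟨T, hT, fun u hu hur => h1 u hu (hur.trans hr)⟩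

lemma chart_of_energy {m n l : ℕ} {p E K ε : ℝ} (hm : 1 ≤ m) (hmn : m ≤ n) (hl2 : 2 ≤ l)
    (hlm : l ≤ m + 2) (hp : (m : ℝ) * l < p) (hK : 0 ≤ K) (hε : 0 < ε) (hε1 : ε ≤ 1 / 16) :
    ∃ R : ℝ, 0 < R ∧ ∀ S : Set (EuclideanSpace ℝ (Fin n)), IsCompact S → μH[(m : ℝ)] S ≠ ⊤ →
      mengerEnergy m n l p S ≤ ENNReal.ofReal E → ∀ r, UProp m S r K →
      ∀ ρ, 0 < ρ → ρ ≤ 4 * r → ρ ≤ R → ChProp m S ρ ε := by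
  have hm0 : (0 : ℝ) < m := by exact_mod_cast hm
  obtain ⟨A, α, hA, hα, hflat⟩ := flat_of_energy (E := E) (a := 1 / ((1 + K) * m)) hm hmn hl2 hlm hp
    (by positivity)
  have h2α : (1 : ℝ) < 2 ^ α := Real.one_lt_rpow (by norm_num) hα
  have hDK : 0 ≤ DK m K α := by
    have : 0 < (2 : ℝ) ^ α - 1 := by linarith
    unfold DK; positivity
  set C := (2 * m * (1 + K) + 1) * ((1 + K) + 2 * DK m K α) with hC
  have hC0 : 0 < C := by positivity
  refine ⟨(ε / (C * A)) ^ (1 / α) / 4, by positivity, ?_⟩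
  intro S hS hfin hE r hU ρ hρ hρr hρR
  refine chart_of_flat hS hK hA.le hα hε1 hρ hρr hU ?_ ?_
  · intro x hx s hs hs4
    refine hflat S hfin hE x hx s hs ?_
    intro y hy t ht hts
    refine mass_lower hm hK hU hy ht ?_
    have hr : 0 < r := by linarith
    nlinarith
  · rw [← hC]
    have h1 : (4 * ρ) ^ α ≤ ε / (C * A) := by
      calc (4 * ρ) ^ α ≤ ((ε / (C * A)) ^ (1 / α)) ^ α := by gcongr; linarith
        _ = _ := by rw [← Real.rpow_mul (by positivity), one_div_mul_cancel hα.ne', Real.rpow_one]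
    calc C * (A * (4 * ρ) ^ α) ≤ C * (A * (ε / (C * A))) := by gcongr
      _ = ε := by field_simp

lemma uniform_U {m n l : ℕ} {p E : ℝ} (hm : 1 ≤ m) (hmn : m ≤ n) (hl2 : 2 ≤ l)
    (hlm : l ≤ m + 2) (hp : (m : ℝ) * l < p) :
    ∃ R : ℝ, 0 < R ∧ ∀ S : Set (EuclideanSpace ℝ (Fin n)), IsCompact S → μH[(m : ℝ)] S ≠ ⊤ →
      mengerEnergy m n l p S ≤ ENNReal.ofReal E → (∃ r, 0 < r ∧ ∃ K, 0 ≤ K ∧ UProp m S r K) →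
      UProp m S R 1 := by
  obtain ⟨R, hR, hch⟩ := chart_of_energy (n := n) (E := E) (K := 1) (ε := 1 / 16) hm hmn hl2 hlm hp
    (by norm_num) (by norm_num) le_rfl
  refine ⟨R / 2, by positivity, ?_⟩
  rintro S hS hfin hE ⟨r, hr, K, hK, hU⟩
  obtain ⟨R', hR', hch'⟩ := chart_of_energy (n := n) (E := E) (K := K) (ε := 1 / 16) hm hmn hl2 hlm hp
    hK (by norm_num) le_rfl
  have h0 := (hch' S hS hfin hE r hU (min (4 * r) R') (by positivity) (min_le_left _ _)
    (min_le_right _ _)).toU (by norm_num) (by positivity)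
  set r0 := min (4 * r) R' / 2 with hr0
  have hr00 : 0 < r0 := by positivity
  have hit : ∀ k : ℕ, UProp m S (min (2 ^ k * r0) (R / 2)) 1 := by
    intro k
    induction k with
    | zero => exact h0.mono (by simp)
    | succ k ih =>
      have hpos : 0 < min (2 ^ k * r0) (R / 2) := by positivity
      have h1 := (hch S hS hfin hE _ ih (min (4 * min (2 ^ k * r0) (R / 2)) R) (by positivity)
        (min_le_left _ _) (min_le_right _ _)).toU (by norm_num) (by positivity)
      refine h1.mono ?_
      rw [pow_succ]
      rcases le_total (2 ^ k * r0) (R / 2) with h | h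
      · rw [min_eq_left h]
        rcases le_total (4 * (2 ^ k * r0)) R with h' | h'
        · rw [min_eq_left h']
          refine (min_le_left _ _).trans (by linarith)
        · rw [min_eq_right h']
          exact min_le_right _ _
      · have e : min (4 * (R / 2)) R = R := min_eq_right (by linarith)
        rw [min_eq_right h, e]
        exact min_le_right _ _
  obtain ⟨k, hk⟩ := pow_unbounded_of_one_lt (R / 2 / r0) (one_lt_two (α := ℝ))
  rw [div_lt_iff₀ hr00] at hk
  exact (hit k).mono (by rw [min_eq_right hk.le])

lemma uniform_chart {m n l : ℕ} {p E : ℝ} (hm : 1 ≤ m) (hmn : m ≤ n) (hl2 : 2 ≤ l)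
    (hlm : l ≤ m + 2) (hp : (m : ℝ) * l < p) {ε : ℝ} (hε : 0 < ε) (hε1 : ε ≤ 1 / 16) :
    ∃ R : ℝ, 0 < R ∧ ∀ S : Set (EuclideanSpace ℝ (Fin n)), IsCompact S → μH[(m : ℝ)] S ≠ ⊤ →
      mengerEnergy m n l p S ≤ ENNReal.ofReal E → (∃ r, 0 < r ∧ ∃ K, 0 ≤ K ∧ UProp m S r K) →
      ∀ ρ, 0 < ρ → ρ ≤ R → ChProp m S ρ ε := by
  obtain ⟨R, hR, hU⟩ := uniform_U (n := n) (E := E) hm hmn hl2 hlm hp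
  obtain ⟨R', hR', hch⟩ := chart_of_energy (n := n) (E := E) (K := 1) (ε := ε) hm hmn hl2 hlm hp
    (by norm_num) hε hε1
  refine ⟨min R R', by positivity, fun S hS hfin hE hr ρ hρ hρR => ?_⟩
  exact hch S hS hfin hE R (hU S hS hfin hE hr) ρ hρ (by linarith [min_le_left R R'])
    (hρR.trans (min_le_right R R'))

lemma lip_U {m n : ℕ} {S : Set (EuclideanSpace ℝ (Fin n))} (h : IsLipschitzSubmanifold m n S) :
    ∃ r, 0 < r ∧ ∃ K, 0 ≤ K ∧ UProp m S r K := by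
  obtain ⟨-, hS, hloc⟩ := h
  have := hS.induction_on (p := fun s => ∃ r : ℝ, 0 < r ∧ ∃ K : ℝ, 0 ≤ K ∧ ∀ x ∈ s,
    ∃ T : Submodule ℝ (EuclideanSpace ℝ (Fin n)), Module.finrank ℝ T = m ∧
    ∀ u ∈ T, ‖u‖ ≤ r → ∃ y ∈ S, ‖y - x - u‖ ≤ K * ‖u‖ ∧ T.starProjection (y - x) = u) ?_ ?_ ?_ ?_
  · exact this
  · exact ⟨1, one_pos, 0, le_rfl, fun x hx => hx.elim⟩
  · rintro s t hst ⟨r, hr, K, hK, h⟩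
    exact ⟨r, hr, K, hK, fun x hx => h x (hst hx)⟩
  · rintro s t ⟨r, hr, K, hK, h⟩ ⟨r', hr', K', hK', h'⟩
    refine ⟨min r r', by positivity, max K K', by positivity, ?_⟩
    rintro x (hx | hx)
    · obtain ⟨T, hT, h1⟩ := h x hx
      refine ⟨T, hT, fun u hu hur => ?_⟩
      obtain ⟨y, hy, h2, h3⟩ := h1 u hu (hur.trans (min_le_left _ _))
      exact ⟨y, hy, h2.trans (by gcongr; exact le_max_left _ _), h3⟩
    · obtain ⟨T, hT, h1⟩ := h' x hx
      refine ⟨T, hT, fun u hu hur => ?_⟩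
      obtain ⟨y, hy, h2, h3⟩ := h1 u hu (hur.trans (min_le_right _ _))
      exact ⟨y, hy, h2.trans (by gcongr; exact le_max_right _ _), h3⟩
  · intro x hx
    obtain ⟨r, hr, T, hT, f, ⟨K, hf⟩, heq⟩ := hloc x hx
    refine ⟨S ∩ ball x (r / 2), inter_mem_nhdsWithin _ (ball_mem_nhds _ (by positivity)), ?_⟩
    refine ⟨r / (2 * (1 + K)), by positivity, K, K.2, ?_⟩
    rintro y ⟨hy, hyb⟩
    refine ⟨T, hT, fun u hu hur => ?_⟩
    have hy' : y ∈ S ∩ ball x r := ⟨hy, ball_subset_ball (by linarith) hyb⟩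
    rw [heq] at hy'
    obtain ⟨⟨ξ, hξ⟩, -⟩ := hy'
    simp only at hξ
    set y' : EuclideanSpace ℝ (Fin n) := x + ((ξ + ⟨u, hu⟩ : T) : EuclideanSpace ℝ (Fin n)) +
      (f (ξ + ⟨u, hu⟩) : EuclideanSpace ℝ (Fin n)) with hy'
    set w : Tᗮ := f (ξ + ⟨u, hu⟩) - f ξ with hw
    have hwn : ‖(w : EuclideanSpace ℝ (Fin n))‖ ≤ K * ‖u‖ := by
      have := hf.dist_le_mul (ξ + ⟨u, hu⟩) ξ
      rw [dist_eq_norm, dist_eq_norm, add_sub_cancel_left] at this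
      exact this
    have e1 : y' - y = u + w := by
      rw [hy', ← hξ, hw]; push_cast; abel
    have hK : (0 : ℝ) ≤ K := K.2
    have hyy : ‖y' - y‖ ≤ r / 2 := by
      rw [e1]
      have h1 := norm_add_le u (w : EuclideanSpace ℝ (Fin n))
      have h2 : (1 + (K : ℝ)) * ‖u‖ ≤ (1 + K) * (r / (2 * (1 + K))) := by gcongr
      have h3 : (1 + (K : ℝ)) * (r / (2 * (1 + K))) = r / 2 := by field_simp
      linarith
    have hyS : y' ∈ S ∩ ball x r := by
      rw [heq]
      refine ⟨⟨ξ + ⟨u, hu⟩, rfl⟩, ?_⟩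
      rw [mem_ball, dist_eq_norm] at hyb ⊢
      have := norm_sub_le_norm_sub_add_norm_sub y' y x
      linarith
    refine ⟨y', hyS.1, ?_, ?_⟩
    · rw [e1, add_sub_cancel_left]; exact hwn
    · rw [e1, map_add, proj_of_mem hu, (Submodule.starProjection_apply_eq_zero_iff T).2 w.2, add_zero]

lemma lip_finite {m n : ℕ} {S : Set (EuclideanSpace ℝ (Fin n))} (h : IsLipschitzSubmanifold m n S) :
    μH[(m : ℝ)] S ≠ ⊤ := by
  obtain ⟨-, hS, hloc⟩ := h
  refine hS.induction_on (p := fun s => μH[(m : ℝ)] s ≠ ⊤) ?_ ?_ ?_ ?_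
  · simp
  · intro s t hst ht
    exact ne_top_of_le_ne_top ht (measure_mono hst)
  · intro s t hs ht
    exact ne_top_of_le_ne_top (ENNReal.add_ne_top.2 ⟨hs, ht⟩) (measure_union_le s t)
  · intro x hx
    obtain ⟨r, hr, T, hT, f, ⟨K, hf⟩, heq⟩ := hloc x hx
    refine ⟨S ∩ ball x r, inter_mem_nhdsWithin _ (ball_mem_nhds _ hr), ?_⟩
    let g : T → EuclideanSpace ℝ (Fin n) := fun ξ =>
            x + (ξ : EuclideanSpace ℝ (Fin n)) + (f ξ : EuclideanSpace ℝ (Fin n))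
    have hg : LipschitzWith (1 + K) g := by
      refine LipschitzWith.of_dist_le_mul fun a b => ?_
      have h1 := hf.dist_le_mul a b
      rw [dist_eq_norm, dist_eq_norm] at h1 ⊢
      have e : g a - g b = ((a - b : T) : EuclideanSpace ℝ (Fin n)) +
          ((f a - f b : Tᗮ) : EuclideanSpace ℝ (Fin n)) := by
        simp only [g]; push_cast; abel
      rw [e]
      have h2 := norm_add_le ((a - b : T) : EuclideanSpace ℝ (Fin n))
        ((f a - f b : Tᗮ) : EuclideanSpace ℝ (Fin n))
      rw [Submodule.norm_coe, Submodule.norm_coe] at h2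
      rw [NNReal.coe_add, NNReal.coe_one]
      linarith
    have hsub : S ∩ ball x r ⊆ g '' (closedBall 0 r) := by
      intro y hy
      rw [heq] at hy
      obtain ⟨⟨ξ, hξ⟩, hyb⟩ := hy
      refine ⟨ξ, ?_, hξ⟩
      rw [mem_ball, dist_eq_norm] at hyb
      rw [mem_closedBall, dist_zero_right]
      simp only at hξ
      have e : T.starProjection (y - x) = ξ := by
        rw [← hξ, add_assoc, add_sub_cancel_left, map_add, proj_of_mem ξ.2,
          (Submodule.starProjection_apply_eq_zero_iff T).2 (f ξ).2, add_zero]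
      have h1 := proj_norm_le T (y - x)
      rw [e, Submodule.norm_coe] at h1
      linarith
    have h1 := hg.hausdorffMeasure_image_le (d := (m : ℝ)) (by positivity) (closedBall 0 r)
    refine ne_top_of_le_ne_top ?_ ((measure_mono hsub).trans h1)
    refine ENNReal.mul_ne_top (ENNReal.rpow_ne_top_of_nonneg (by positivity) ENNReal.coe_ne_top) ?_
    have h2 : (μH[(m : ℝ)] : Measure T) = μH[(Module.finrank ℝ T : ℝ)] := by rw [hT]
    rw [h2]
    exact (isCompact_closedBall (0 : T) r).measure_lt_top.ne

end Part6

section Part7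

section Limit

variable {V : Type*} [NormedAddCommGroup V] [InnerProductSpace ℝ V] [FiniteDimensional ℝ V]

/-- the two sets are `η`-close in the Hausdorff sense -/
def HD (η : ℝ) (A B : Set V) : Prop :=
  (∀ a ∈ A, ∃ b ∈ B, ‖a - b‖ ≤ η) ∧ (∀ b ∈ B, ∃ a ∈ A, ‖a - b‖ ≤ η)

lemma tendsto_of_norm_le {u : ℕ → V} {x : V} {h : ℕ → ℝ} (hh : Tendsto h atTop (𝓝 0))
    (hu : ∀ j, ‖u j - x‖ ≤ h j) : Tendsto u atTop (𝓝 x) :=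
  tendsto_iff_norm_sub_tendsto_zero.2 (squeeze_zero (fun _ => norm_nonneg _) hu hh)

lemma HD.mem_limit {S : ℕ → Set V} {S0 : Set V} (hcl : IsClosed S0) {h : ℕ → ℝ}
    (hh : Tendsto h atTop (𝓝 0)) (hHD : ∀ j, HD (h j) (S j) S0) {y : ℕ → V} {y0 : V}
    (hy : ∀ j, y j ∈ S j) (hy0 : Tendsto y atTop (𝓝 y0)) : y0 ∈ S0 := by
  choose b hb hb2 using fun j => (hHD j).1 (y j) (hy j)
  have h1 : Tendsto (fun j => y j - b j) atTop (𝓝 0) :=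
    tendsto_of_norm_le hh (by simpa using hb2)
  have h2 : Tendsto b atTop (𝓝 y0) := by
    have := hy0.sub h1
    simpa using this
  exact hcl.mem_of_tendsto h2 (Eventually.of_forall hb)

lemma ChProp.limit {m : ℕ} {S : ℕ → Set V} {S0 : Set V} (hcl : IsClosed S0) {h : ℕ → ℝ}
    (hh : Tendsto h atTop (𝓝 0)) (hHD : ∀ j, HD (h j) (S j) S0) {ρ ε : ℝ} (hρ : 0 < ρ)
    (hch : ∀ j, ChProp m (S j) ρ ε) : ChProp m S0 (ρ / 2) ε := by
  intro x hx
  choose a ha ha2 using fun j => (hHD j).2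
  have hlim : ∀ y (hy : y ∈ S0), Tendsto (fun j => a j y hy) atTop (𝓝 y) := fun y hy =>
    tendsto_of_norm_le hh fun j => ha2 j y hy
  choose T hT hT1 hT2 using fun j => hch j (a j x hx) (ha j x hx)
  choose e he heT using fun j => exists_frame (hT j)
  have hbd : ∀ j, e j ∈ closedBall (0 : Fin m → V) 1 := by
    intro j
    rw [mem_closedBall, dist_zero_right, pi_norm_le_iff_of_nonneg zero_le_one]
    intro i
    rw [(he j).1 i]
  obtain ⟨e0, -, φ, hφ, he0⟩ := (isCompact_closedBall (0 : Fin m → V) 1).tendsto_subseq hbd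
  have he0i : ∀ i, Tendsto (fun j => e (φ j) i) atTop (𝓝 (e0 i)) := fun i =>
    (tendsto_pi_nhds.1 he0) i
  have ho : Orthonormal ℝ e0 := by
    rw [orthonormal_iff_ite]
    intro i k
    have h1 : Tendsto (fun j => inner ℝ (e (φ j) i) (e (φ j) k)) atTop (𝓝 (inner ℝ (e0 i) (e0 k))) :=
      (he0i i).inner (he0i k)
    have h2 : (fun j => inner ℝ (e (φ j) i) (e (φ j) k)) = fun _ => if i = k then (1 : ℝ) else 0 := by
      ext j; exact orthonormal_iff_ite.1 (he (φ j)) i k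
    rw [h2] at h1
    exact tendsto_nhds_unique h1 tendsto_const_nhds
  have hP : ∀ (v : ℕ → V) (v0 : V) (θ : ℕ → ℕ), Tendsto θ atTop atTop → Tendsto v atTop (𝓝 v0) →
      Tendsto (fun j => (T (φ (θ j))).starProjection (v j)) atTop
        (𝓝 ((Submodule.span ℝ (Set.range e0)).starProjection v0)) := by
    intro v v0 θ hθ hv
    have h1 : (fun j => (T (φ (θ j))).starProjection (v j)) =
        fun j => ∑ i, inner ℝ (e (φ (θ j)) i) (v j) • e (φ (θ j)) i := by
      ext1 j
      rw [← heT, frame_proj (he _)]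
    rw [h1, frame_proj ho]
    refine tendsto_finset_sum _ fun i _ => ?_
    have h2 := (he0i i).comp hθ
    exact (h2.inner hv).smul h2
  refine ⟨Submodule.span ℝ (Set.range e0), frame_finrank ho, ?_, ?_⟩
  · intro y hy z hz hyx hzx
    have hxl := (hlim x hx).comp hφ.tendsto_atTop
    have hyl := (hlim y hy).comp hφ.tendsto_atTop
    have hzl := (hlim z hz).comp hφ.tendsto_atTop
    have e1 : ∀ᶠ j in atTop, ‖a (φ j) y hy - a (φ j) x hx‖ < ρ :=
      (hyl.sub hxl).norm.eventually_lt_const (by linarith)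
    have e2 : ∀ᶠ j in atTop, ‖a (φ j) z hz - a (φ j) x hx‖ < ρ :=
      (hzl.sub hxl).norm.eventually_lt_const (by linarith)
    have hd := hyl.sub hzl
    have l1 := (hd.sub (hP _ _ id tendsto_id hd)).norm
    have l2 := hd.norm.const_mul ε
    refine le_of_tendsto_of_tendsto l1 l2 ?_
    filter_upwards [e1, e2] with j h1 h2
    exact hT1 (φ j) _ (ha _ _ _) _ (ha _ _ _) h1.le h2.le
  · intro u hu hur
    set c : Fin m → ℝ := fun i => inner ℝ (e0 i) u with hc
    have hu2 : u = ∑ i, c i • e0 i := by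
      rw [← frame_proj ho, proj_of_mem hu]
    set uj : ℕ → V := fun j => ∑ i, c i • e (φ j) i with huj
    have hnorm : ∀ j, ‖uj j‖ = ‖u‖ := by
      intro j
      have h1 : ‖uj j‖ ^ 2 = ‖u‖ ^ 2 := by
        rw [← real_inner_self_eq_norm_sq, ← real_inner_self_eq_norm_sq]
        conv_rhs => rw [hu2]
        rw [huj, (he (φ j)).inner_sum, ho.inner_sum]
      exact (pow_left_inj₀ (norm_nonneg _) (norm_nonneg _) two_ne_zero).1 h1
    have hmem : ∀ j, uj j ∈ T (φ j) := by
      intro j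
      rw [← heT]
      exact Submodule.sum_mem _ fun i _ => Submodule.smul_mem _ _ (Submodule.subset_span ⟨i, rfl⟩)
    choose y hy hy1 hy2 using fun j => hT2 (φ j) (uj j) (hmem j) (by rw [hnorm]; linarith)
    have hxl := (hlim x hx).comp hφ.tendsto_atTop
    have hyb : ∀ j, y j - a (φ j) x hx ∈ closedBall (0 : V) (2 * ‖u‖) := by
      intro j
      rw [mem_closedBall, dist_zero_right, ← hnorm j]
      exact hy1 j
    obtain ⟨w, hw, θ, hθ, hwl⟩ := (isCompact_closedBall (0 : V) (2 * ‖u‖)).tendsto_subseq hyb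
    have hxl' := hxl.comp hθ.tendsto_atTop
    have hyl : Tendsto (fun j => y (θ j)) atTop (𝓝 (w + x)) := by
      have := hwl.add hxl'
      simpa [Function.comp_def] using this
    have hyS : w + x ∈ S0 := HD.mem_limit (S := fun j => S (φ (θ j))) (h := fun j => h (φ (θ j))) hcl
      (hh.comp (hφ.tendsto_atTop.comp hθ.tendsto_atTop)) (fun j => hHD _) (fun j => hy (θ j)) hyl
    refine ⟨w + x, hyS, ?_, ?_⟩
    · simpa using hw
    · have l1 := hP _ _ θ hθ.tendsto_atTop hwl
      have l2 : Tendsto (fun j => uj (θ j)) atTop (𝓝 u) := by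
        rw [hu2]
        refine tendsto_finset_sum _ fun i _ => ?_
        exact ((he0i i).comp hθ.tendsto_atTop).const_smul _
      have l3 : (fun j => (T (φ (θ j))).starProjection ((fun j => y j - a (φ j) x hx) (θ j)))
          = fun j => uj (θ j) := by
        ext1 j
        exact hy2 (θ j)
      rw [add_sub_cancel_right]
      refine tendsto_nhds_unique ?_ l2
      rw [← l3]
      exact l1

end Limit

lemma lip_of_ch {m n : ℕ} {S : Set (EuclideanSpace ℝ (Fin n))} (hne : S.Nonempty)
    (hS : IsCompact S) {ρ ε : ℝ} (hρ : 0 < ρ) (hε : ε ≤ 1 / 2) (hch : ChProp m S ρ ε) :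
    IsLipschitzSubmanifold m n S := by
  classical
  refine ⟨hne, hS, fun x hx => ?_⟩
  obtain ⟨T, hT, h1, h2⟩ := hch x hx
  let N : Set T := {ξ | ∃ y ∈ S, ‖y - x‖ ≤ ρ ∧ T.starProjection (y - x) = ξ}
  have hmemo : ∀ v : EuclideanSpace ℝ (Fin n), v - T.starProjection v ∈ Tᗮ := fun v =>
    Submodule.sub_starProjection_mem_orthogonal v
  let f0 : T → Tᗮ := fun ξ => if h : ∃ y ∈ S, ‖y - x‖ ≤ ρ ∧ T.starProjection (y - x) = ξ then
    ⟨(h.choose - x) - T.starProjection (h.choose - x), hmemo _⟩ else 0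
  have hf0 : ∀ ξ ∈ N, ∃ y ∈ S, ‖y - x‖ ≤ ρ ∧ T.starProjection (y - x) = ξ ∧
      (f0 ξ : EuclideanSpace ℝ (Fin n)) = (y - x) - T.starProjection (y - x) := by
    intro ξ hξ
    have hξ' : ∃ y ∈ S, ‖y - x‖ ≤ ρ ∧ T.starProjection (y - x) = ξ := hξ
    refine ⟨hξ'.choose, hξ'.choose_spec.1, hξ'.choose_spec.2.1, hξ'.choose_spec.2.2, ?_⟩
    simp only [f0, dif_pos hξ']
  have hslope : ∀ y ∈ S, ∀ z ∈ S, ‖y - x‖ ≤ ρ → ‖z - x‖ ≤ ρ →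
      offp T (y - z) ≤ ‖T.starProjection (y - z)‖ := by
    intro y hy z hz hyx hzx
    have e1 := h1 y hy z hz hyx hzx
    have e2 := norm_le_proj_add T (y - z)
    have e3 := mul_le_mul_of_nonneg_right hε (norm_nonneg (y - z))
    linarith
  have hlip : LipschitzOnWith 1 f0 N := by
    refine LipschitzOnWith.of_dist_le_mul fun ξ hξ ζ hζ => ?_
    obtain ⟨y, hy, hyx, hyξ, hfy⟩ := hf0 ξ hξ
    obtain ⟨z, hz, hzx, hzζ, hfz⟩ := hf0 ζ hζ
    rw [NNReal.coe_one, one_mul, dist_eq_norm, dist_eq_norm, ← Submodule.norm_coe,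
      ← Submodule.norm_coe, Submodule.coe_sub, Submodule.coe_sub, hfy, hfz, ← hyξ, ← hzζ, ← map_sub]
    have e := hslope y hy z hz hyx hzx
    unfold offp at e
    rw [sub_sub_sub_cancel_right]
    refine le_trans (le_of_eq ?_) e
    congr 1
    rw [sub_sub_sub_comm, ← map_sub, sub_sub_sub_cancel_right]
  obtain ⟨f, hf, hfeq⟩ := hlip.extend_finite_dimension
  refine ⟨ρ / 2, by positivity, T, hT, f, ⟨_, hf⟩, ?_⟩
  have huniq : ∀ y ∈ S, ‖y - x‖ ≤ ρ → ∀ ξ : T, T.starProjection (y - x) = ξ →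
      x + (ξ : EuclideanSpace ℝ (Fin n)) + (f ξ : EuclideanSpace ℝ (Fin n)) = y := by
    intro y hy hyx ξ hξ
    have hN : ξ ∈ N := ⟨y, hy, hyx, hξ⟩
    obtain ⟨z, hz, hzx, hzξ, hfz⟩ := hf0 ξ hN
    have e := hslope y hy z hz hyx hzx
    have e2 : T.starProjection (y - z) = 0 := by
      rw [← sub_sub_sub_cancel_right y z x, map_sub, hξ, hzξ, sub_self]
    have e3 := norm_le_proj_add T (y - z)
    rw [e2, norm_zero] at e e3
    have e4 : y = z := by
      have : ‖y - z‖ = 0 := le_antisymm (by linarith) (norm_nonneg _)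
      rwa [norm_eq_zero, sub_eq_zero] at this
    rw [← hfeq hN, hfz, hzξ, e4]
    abel
  ext w
  constructor
  · rintro ⟨hw, hwb⟩
    refine ⟨⟨⟨T.starProjection (w - x), proj_mem _ _⟩, ?_⟩, hwb⟩
    rw [mem_ball, dist_eq_norm] at hwb
    exact huniq w hw (by linarith) _ rfl
  · rintro ⟨⟨ξ, hξ⟩, hwb⟩
    refine ⟨?_, hwb⟩
    rw [mem_ball, dist_eq_norm] at hwb
    simp only at hξ
    have hP : T.starProjection (w - x) = ξ := by
      rw [← hξ, add_assoc, add_sub_cancel_left, map_add, proj_of_mem ξ.2,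
        (Submodule.starProjection_apply_eq_zero_iff T).2 (f ξ).2, add_zero]
    have hξn := proj_norm_le T (w - x)
    rw [hP] at hξn
    obtain ⟨y, hy, hy1, hy2⟩ := h2 ξ ξ.2 (by linarith)
    rw [← hξ, huniq y hy (by linarith) ξ hy2]
    exact hy

end Part7

section Part8

lemma exists_small (l : List ℝ) (h : ∀ a ∈ l, 0 < a) : ∃ δ : ℝ, 0 < δ ∧ ∀ a ∈ l, δ ≤ a := by
  induction l with
  | nil => exact ⟨1, one_pos, by simp⟩
  | cons a l ih =>
    obtain ⟨δ, h1, h2⟩ := ih fun b hb => h b (List.mem_cons_of_mem _ hb)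
    refine ⟨min a δ, lt_min (h a List.mem_cons_self) h1, fun b hb => ?_⟩
    rcases List.mem_cons.1 hb with rfl | hb
    · exact min_le_left _ _
    · exact (min_le_right _ _).trans (h2 b hb)

section Proj

variable {V : Type*} [NormedAddCommGroup V] [InnerProductSpace ℝ V] [FiniteDimensional ℝ V]

lemma ang_of {m : ℕ} {T F : Submodule ℝ V} (hT : Module.finrank ℝ T = m) {t η : ℝ} (ht : 0 < t)
    (hη : 0 ≤ η) (hmη : (m : ℝ) * η ≤ 1 / 2)
    (h : ∀ u ∈ T, ‖u‖ = t → ∃ w, T.starProjection w = u ∧ offp T w ≤ η * t ∧ offp F w ≤ η * t) :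
    Ang T F (4 * m * η) := by
  intro f hf
  refine (plane_compare (F := T) (F' := F) (K := η) hT hT ht hη hη hmη (fun u hu hut => ?_) f hf).1
  obtain ⟨w, h1, h2, h3⟩ := h u hu hut
  refine ⟨w, h1, ?_, h2, h3⟩
  rw [← h1]; exact h2

/-- graph bound: if the off part is at most half the norm, the projection controls. -/
lemma norm_le_two_proj {T : Submodule ℝ V} {v : V} {ε : ℝ} (hε : ε ≤ 1 / 2)
    (h : offp T v ≤ ε * ‖v‖) : ‖v‖ ≤ 2 * ‖T.starProjection v‖ := by
  have e := norm_le_proj_add T v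
  have := mul_le_mul_of_nonneg_right hε (norm_nonneg v)
  linarith

def Qp (S0 S' C : Set V) (δ : ℝ) (ψ : V → V) : Prop :=
  (∀ y ∈ S', ‖ψ y - y‖ ≤ δ) ∧
  (∀ y ∈ S', ∀ z ∈ S', ‖(ψ y - y) - (ψ z - z)‖ ≤ δ * ‖y - z‖) ∧
  (∀ y' ∈ S', ∀ z' ∈ S', ∃ y ∈ S0, ∃ z ∈ S0, ‖ψ y' - y‖ ≤ δ ∧ ‖ψ z' - z‖ ≤ δ ∧
    ‖(ψ y' - y) - (ψ z' - z)‖ ≤ δ * ‖y' - z'‖) ∧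
  (∀ y ∈ S', y ∈ C → ψ y ∈ S0)

/-- chart data at a point -/
def ChAt (m : ℕ) (S : Set V) (x : V) (T : Submodule ℝ V) (ρ ε : ℝ) : Prop :=
  Module.finrank ℝ T = m ∧
    (∀ y ∈ S, ∀ z ∈ S, ‖y - x‖ ≤ ρ → ‖z - x‖ ≤ ρ → offp T (y - z) ≤ ε * ‖y - z‖) ∧
    (∀ u ∈ T, ‖u‖ ≤ ρ / 2 → ∃ y ∈ S, ‖y - x‖ ≤ 2 * ‖u‖ ∧ T.starProjection (y - x) = u)

lemma claim1 {m : ℕ} {S : Set V} {c : V} {T : Submodule ℝ V} {ρ ε : ℝ} (h : ChAt m S c T ρ ε)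
    (hε : ε ≤ 1 / 2) {v w g k : V} (hg : g ∈ S) (hk : k ∈ S) (hgc : ‖g - c‖ ≤ ρ)
    (hkc : ‖k - c‖ ≤ ρ) (hgv : T.starProjection (g - v) = 0) (hkw : T.starProjection (k - w) = 0) :
    ‖g - k‖ ≤ 2 * ‖v - w‖ := by
  have e1 := h.2.1 g hg k hk hgc hkc
  have e2 := norm_le_two_proj hε e1
  have e3 : T.starProjection (g - k) = T.starProjection (v - w) := by
    have : g - k = (g - v) - (k - w) + (v - w) := by abel
    rw [this, map_add, map_sub, hgv, hkw, sub_zero, zero_add]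
  rw [e3] at e2
  linarith [proj_norm_le T (v - w)]

lemma ch_ang {m : ℕ} (hm : 1 ≤ m) {S : Set V} {x y : V} {T T' : Submodule ℝ V} {ρ ε ρ' : ℝ}
    (hx : ChAt m S x T ρ ε) (hy : ChAt m S y T' ρ' ε) (hyS : y ∈ S) (hρ' : 0 < ρ') (hε0 : 0 ≤ ε)
    (hε : ε ≤ 1 / (16 * m)) (hxy : ‖y - x‖ + ρ' ≤ ρ) : Ang T' T (1 / 2) := by
  have hm' : (0 : ℝ) < m := by exact_mod_cast hm
  have hmε : (m : ℝ) * ε ≤ 1 / 16 := by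
    rw [le_div_iff₀ (by positivity)] at hε
    linarith
  have hε2 : ε ≤ 1 / 2 := by
    have : (1 : ℝ) ≤ m := by exact_mod_cast hm
    nlinarith
  refine (ang_of (t := ρ' / 2) (η := 2 * ε) hy.1 (by positivity) (by positivity) (by linarith)
    fun u hu hut => ?_).mono (by linarith)
  obtain ⟨z, hz, hz1, hz2⟩ := hy.2.2 u hu hut.le
  have hzy : ‖z - y‖ ≤ ρ' := by rw [hut] at hz1; linarith
  refine ⟨z - y, hz2, ?_, ?_⟩
  · have := hy.2.1 z hz y hyS hzy (by simpa using hρ'.le)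
    have := mul_le_mul_of_nonneg_left hzy hε0
    linarith
  · have e0 : ‖z - x‖ ≤ ‖z - y‖ + ‖y - x‖ := by
      simpa using norm_add_le (z - y) (y - x)
    have := hx.2.1 z hz y hyS (by linarith) (by linarith)
    have := mul_le_mul_of_nonneg_left hzy hε0
    linarith

lemma claim2 {m : ℕ} (hm : 1 ≤ m) {S : Set V} {c : V} {T : Submodule ℝ V} {ρ ε ρ' ε' δ t : ℝ}
    (h : ChAt m S c T ρ ε) (h' : ChProp m S ρ' ε') (hρ' : 0 < ρ') (hε0 : 0 ≤ ε')
    (hεε : ε' ≤ ε) (hε : ε ≤ 1 / (16 * m)) (hρρ : ρ' ≤ ρ / 2) (hδ : δ ≤ ρ / 8) (hδ1 : δ ≤ 1)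
    (hδ2 : 3 * δ + 4 * t ≤ ρ') (ht : 0 ≤ t) {v w g k y z : V} (hg : g ∈ S) (hk : k ∈ S)
    (hgc : ‖g - c‖ ≤ ρ / 4) (hδ0 : 0 ≤ δ)
    (hkc : ‖k - c‖ ≤ ρ / 4) (hgv : T.starProjection (g - v) = 0) (hkw : T.starProjection (k - w) = 0)
    (hvc : ‖v - c‖ ≤ ρ / 8) (hwc : ‖w - c‖ ≤ ρ / 8) (hy : y ∈ S) (hz : z ∈ S)
    (hvy : ‖v - y‖ ≤ δ) (hwz : ‖w - z‖ ≤ δ) (hab : ‖(v - y) - (w - z)‖ ≤ δ * t)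
    (hvw : ‖v - w‖ ≤ 2 * t) : ‖(g - v) - (k - w)‖ ≤ (3 * δ + 21 * ε') * t := by
  have hε2 : ε ≤ 1 / 2 := by
    have : (1 : ℝ) ≤ m := by exact_mod_cast hm
    refine hε.trans ?_
    rw [div_le_div_iff₀ (by positivity) (by positivity)]
    linarith
  have hyc : ‖y - c‖ ≤ ρ / 4 := by
    have : ‖y - c‖ ≤ ‖v - c‖ + ‖v - y‖ := by
      have := norm_sub_le (v - c) (v - y)
      rwa [show v - c - (v - y) = y - c by abel] at this
    linarith
  have hzc : ‖z - c‖ ≤ ρ / 4 := by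
    have : ‖z - c‖ ≤ ‖w - c‖ + ‖w - z‖ := by
      have := norm_sub_le (w - c) (w - z)
      rwa [show w - c - (w - z) = z - c by abel] at this
    linarith
  have hρ : 0 < ρ := by linarith
  have h0 : ∀ a : V, T.starProjection (a - a) = 0 := fun a => by simp
  have e1 := claim1 h hε2 hg hk (by linarith) (by linarith) hgv hkw
  have e2 := claim1 h hε2 hg hy (by linarith) (by linarith) hgv (h0 y)
  have e3 := claim1 h hε2 hk hz (by linarith) (by linarith) hkw (h0 z)
  have e4 : ‖y - z‖ ≤ 3 * t := by
    have := norm_sub_le (v - w) ((v - y) - (w - z))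
    rw [show v - w - ((v - y) - (w - z)) = y - z by abel] at this
    have := mul_le_mul_of_nonneg_right hδ1 ht
    linarith
  obtain ⟨T', hT'⟩ : ∃ T', ChAt m S y T' ρ' ε' := h' y hy
  have hang : Ang T' T (1 / 2) := by
    refine ch_ang hm (ε := ε) h ⟨hT'.1, fun a ha b hb hay hby => ?_, hT'.2.2⟩ hy hρ' (by linarith) hε (by linarith)
    exact (hT'.2.1 a ha b hb hay hby).trans (by gcongr)
  have e5 : offp T' (g - k) ≤ ε' * (4 * t) := by
    refine (hT'.2.1 g hg k hk (by linarith) ?_).trans (by gcongr; linarith)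
    have : ‖k - y‖ ≤ ‖k - z‖ + ‖y - z‖ := by
      have := norm_sub_le (k - z) (y - z)
      rwa [sub_sub_sub_cancel_right] at this
    linarith
  have e6 : offp T' (y - z) ≤ ε' * (3 * t) := by
    refine (hT'.2.1 y hy z hz (by simpa using hρ'.le) ?_).trans (by gcongr)
    rw [norm_sub_rev]
    linarith
  set d := (g - k) - (y - z) with hd
  have e7 : offp T' d ≤ 7 * ε' * t := by
    have := offp_sub_le T' (g - k) (y - z)
    linarith
  have e8 : ‖T.starProjection d‖ ≤ δ * t := by
    have : d = (g - v) - (k - w) + ((v - y) - (w - z)) := by rw [hd]; abel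
    rw [this, map_add, map_sub, hgv, hkw, sub_zero, zero_add]
    exact (proj_norm_le _ _).trans hab
  have e9 := norm_le_two_proj le_rfl (hang _ (proj_mem T' d))
  have e10 : ‖T.starProjection (T'.starProjection d)‖ ≤ ‖T.starProjection d‖ + offp T' d := by
    have h1 := norm_sub_le (T.starProjection d) (T.starProjection (d - T'.starProjection d))
    rw [← map_sub, sub_sub_cancel] at h1
    have h2 := proj_norm_le T (d - T'.starProjection d)
    unfold offp
    linarith
  have e11 := norm_le_proj_add T' d
  have e12 : (g - v) - (k - w) = d - ((v - y) - (w - z)) := by rw [hd]; abel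
  have e13 := norm_sub_le d ((v - y) - (w - z))
  rw [e12]
  linarith

def bump (c : V) (ρ : ℝ) (v : V) : ℝ := max 0 (min 1 (2 - 32 / ρ * ‖v - c‖))

lemma bump_nonneg (c : V) (ρ : ℝ) (v : V) : 0 ≤ bump c ρ v := le_max_left _ _
lemma bump_le_one (c : V) (ρ : ℝ) (v : V) : bump c ρ v ≤ 1 := max_le zero_le_one (min_le_left _ _)
lemma bump_lip (c : V) {ρ : ℝ} (hρ : 0 < ρ) (v w : V) :
    |bump c ρ v - bump c ρ w| ≤ 32 / ρ * ‖v - w‖ := by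
  unfold bump
  rw [max_comm 0, max_comm 0]
  refine (abs_max_sub_max_le_abs _ _ _).trans ?_
  rw [min_comm 1, min_comm 1]
  refine (abs_min_sub_min_le_max _ _ _ _).trans ?_
  rw [sub_self, abs_zero]
  refine max_le ?_ (by positivity)
  have e : (2 - 32 / ρ * ‖v - c‖) - (2 - 32 / ρ * ‖w - c‖) = 32 / ρ * (‖w - c‖ - ‖v - c‖) := by ring
  rw [e, abs_mul, abs_of_pos (by positivity : 0 < 32 / ρ)]
  gcongr
  refine (abs_norm_sub_norm_le _ _).trans ?_
  rw [sub_sub_sub_cancel_right, norm_sub_rev]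
lemma bump_zero (c : V) {ρ : ℝ} (hρ : 0 < ρ) {v : V} (h : ρ / 16 ≤ ‖v - c‖) : bump c ρ v = 0 := by
  unfold bump
  apply max_eq_left
  refine (min_le_right _ _).trans ?_
  have : 32 / ρ * (ρ / 16) ≤ 32 / ρ * ‖v - c‖ := by gcongr
  have e : 32 / ρ * (ρ / 16) = 2 := by field_simp; norm_num
  linarith
lemma bump_one (c : V) {ρ : ℝ} (hρ : 0 < ρ) {v : V} (h : ‖v - c‖ ≤ ρ / 32) : bump c ρ v = 1 := by
  unfold bump
  have : 32 / ρ * ‖v - c‖ ≤ 32 / ρ * (ρ / 32) := by gcongr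
  have e : 32 / ρ * (ρ / 32) = 1 := by field_simp
  rw [min_eq_left (by linarith)]
  simp

lemma glue {c : V} {ρ : ℝ} (hρ : 0 < ρ) {φ : V → V} {v w : V} {δ η t : ℝ} (hη : 0 ≤ η)
    (hδ : 0 ≤ δ) (hvw : ‖v - w‖ ≤ 2 * t) (hv : ‖v - c‖ ≤ ρ / 8 → ‖φ v‖ ≤ 3 * δ)
    (hw : ‖w - c‖ ≤ ρ / 8 → ‖φ w‖ ≤ 3 * δ)
    (h : ‖v - c‖ ≤ ρ / 8 → ‖w - c‖ ≤ ρ / 8 → ‖φ v - φ w‖ ≤ η * t) :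
    ‖bump c ρ v • φ v - bump c ρ w • φ w‖ ≤ (η + 192 * δ / ρ) * t := by
  have ht : 0 ≤ t := by linarith [norm_nonneg (v - w)]
  have hb := bump_lip c hρ v w
  have hk : ∀ x : V, ‖x‖ ≤ 3 * δ → |bump c ρ v - bump c ρ w| * ‖x‖ ≤ 192 * δ / ρ * t := by
    intro x hx
    calc |bump c ρ v - bump c ρ w| * ‖x‖ ≤ (32 / ρ * (2 * t)) * (3 * δ) := by
          gcongr
          exact hb.trans (by gcongr)
      _ = 192 * δ / ρ * t := by ring
  have hηt : 0 ≤ η * t := by positivity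
  by_cases h1 : ‖v - c‖ ≤ ρ / 8 <;> by_cases h2 : ‖w - c‖ ≤ ρ / 8
  · have e : bump c ρ v • φ v - bump c ρ w • φ w
        = bump c ρ w • (φ v - φ w) + (bump c ρ v - bump c ρ w) • φ v := by
      rw [smul_sub, sub_smul]; abel
    rw [e]
    refine (norm_add_le _ _).trans ?_
    rw [norm_smul, norm_smul, Real.norm_eq_abs, Real.norm_eq_abs, abs_of_nonneg (bump_nonneg c ρ w)]
    have e1 := hk _ (hv h1)
    have e2 : bump c ρ w * ‖φ v - φ w‖ ≤ 1 * (η * t) := 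
      mul_le_mul (bump_le_one c ρ w) (h h1 h2) (norm_nonneg _) zero_le_one
    linarith
  · have e0 : bump c ρ w = 0 := bump_zero c hρ (by linarith)
    have e1 := hk _ (hv h1)
    rw [e0, sub_zero] at e1
    rw [e0, zero_smul, sub_zero, norm_smul, Real.norm_eq_abs]
    linarith
  · have e0 : bump c ρ v = 0 := bump_zero c hρ (by linarith)
    have e1 := hk _ (hw h2)
    rw [e0, zero_sub, abs_neg] at e1
    rw [e0, zero_smul, zero_sub, norm_neg, norm_smul, Real.norm_eq_abs]
    linarith
  · have e0 : bump c ρ v = 0 := bump_zero c hρ (by linarith)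
    have e1 : bump c ρ w = 0 := bump_zero c hρ (by linarith)
    rw [e0, e1, zero_smul, zero_smul, sub_zero, norm_zero]
    positivity

/-- a regular set -/
def Reg (m : ℕ) (R : ℝ → ℝ) (S : Set V) : Prop :=
  ∀ ε, 0 < ε → ε ≤ 1 / 16 → ∀ ρ, 0 < ρ → ρ ≤ R ε → ChProp m S ρ ε

set_option maxHeartbeats 1000000 in
lemma chart_step {m : ℕ} (hm : 1 ≤ m) {S : Set V} {R : ℝ → ℝ} (hR : ∀ ε, 0 < ε → ε ≤ 1 / 16 → 0 < R ε)
    (hS : Reg m R S) {c : V} (hc : c ∈ S) : ∃ s > 0, ∀ η > 0, ∃ δ > 0, ∀ (S' C : Set V) (ψ : V → V),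
      Qp S S' C δ ψ → ∃ ψ', Qp S S' (C ∪ ball c s) η ψ' := by
  have hm1 : (1 : ℝ) ≤ m := by exact_mod_cast hm
  set ε : ℝ := 1 / (16 * m) with hεd
  have hε0 : 0 < ε := by positivity
  have hε16 : ε ≤ 1 / 16 := by
    rw [hεd, div_le_div_iff₀ (by positivity) (by positivity)]; linarith
  set ρ := R ε with hρd
  have hρ : 0 < ρ := hR ε hε0 hε16
  obtain ⟨T, hT⟩ : ∃ T, ChAt m S c T ρ ε := hS ε hε0 hε16 ρ hρ le_rfl c hc
  have hG : ∀ v, ∃ g, ‖v - c‖ ≤ ρ / 8 → g ∈ S ∧ ‖g - c‖ ≤ ρ / 4 ∧ T.starProjection (g - v) = 0 := by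
    intro v
    by_cases hv : ‖v - c‖ ≤ ρ / 8
    · have hu := (proj_norm_le T (v - c)).trans hv
      obtain ⟨g, hg, hg1, hg2⟩ := hT.2.2 _ (proj_mem T (v - c)) (by linarith)
      refine ⟨g, fun _ => ⟨hg, by linarith, ?_⟩⟩
      rw [← sub_sub_sub_cancel_right g v c, map_sub, hg2, sub_self]
    · exact ⟨0, fun h => absurd h hv⟩
  choose G hG using hG
  have h0 : ∀ a : V, T.starProjection (a - a) = 0 := fun a => by simp
  have hGy : ∀ v, ‖v - c‖ ≤ ρ / 8 → ∀ y ∈ S, ‖v - y‖ ≤ ρ / 8 → ‖G v - y‖ ≤ 2 * ‖v - y‖ := by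
    intro v hv y hy hvy
    obtain ⟨g1, g2, g3⟩ := hG v hv
    have hyc : ‖y - c‖ ≤ ρ / 4 := by
      have := norm_sub_le (v - c) (v - y)
      rw [show v - c - (v - y) = y - c by abel] at this
      linarith
    exact claim1 hT (by linarith) g1 hy (by linarith) (by linarith) g3 (h0 y)
  refine ⟨ρ / 64, by positivity, fun η hη => ?_⟩
  obtain ⟨ε', hε'0, hε'⟩ := exists_small [ε, η / 84] (by simp [hε0, hη])
  simp only [List.mem_cons, List.not_mem_nil, or_false, forall_eq_or_imp, forall_eq] at hε'
  obtain ⟨hε'1, hε'2⟩ := hε'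
  obtain ⟨ρ', hρ'0, hρ'⟩ := exists_small [R ε', ρ / 2] (by
    simp only [List.mem_cons, List.not_mem_nil, or_false, forall_eq_or_imp, forall_eq]
    exact ⟨hR ε' hε'0 (by linarith), by positivity⟩)
  simp only [List.mem_cons, List.not_mem_nil, or_false, forall_eq_or_imp, forall_eq] at hρ'
  obtain ⟨hρ'1, hρ'2⟩ := hρ'
  have hch := hS ε' hε'0 (by linarith) ρ' hρ'0 hρ'1
  obtain ⟨δ, hδ0, hδ⟩ := exists_small [1, ρ / 64, ρ' / 8, η / 12, η * (ρ' / 8) / 12,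
      η / 2 / (1 + 192 / ρ)] (by
    simp only [List.mem_cons, List.not_mem_nil, or_false, forall_eq_or_imp, forall_eq]
    refine ⟨one_pos, ?_, ?_, ?_, ?_, ?_⟩ <;> positivity)
  simp only [List.mem_cons, List.not_mem_nil, or_false, forall_eq_or_imp, forall_eq] at hδ
  obtain ⟨d1, d2, d3, d4, d5, d6⟩ := hδ
  have d7 : δ + 192 * δ / ρ ≤ η / 2 := by
    rw [le_div_iff₀ (by positivity)] at d6
    calc δ + 192 * δ / ρ = δ * (1 + 192 / ρ) := by ring
      _ ≤ _ := d6
  refine ⟨δ, hδ0, fun S' C ψ hQ => ?_⟩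
  obtain ⟨q1, q2, q3, q4⟩ := hQ
  have hφ : ∀ v, ‖v - c‖ ≤ ρ / 8 → ∀ y ∈ S, ‖v - y‖ ≤ δ → ‖G v - v‖ ≤ 3 * δ := by
    intro v hv y hy hvy
    have e1 := hGy v hv y hy (by linarith)
    have := norm_sub_le (G v - y) (v - y)
    rw [sub_sub_sub_cancel_right] at this
    linarith
  set φ : V → V := fun v => G v - v with hφd
  have hΦ : ∀ v, ∀ y ∈ S, ‖v - y‖ ≤ δ → ‖bump c ρ v • φ v‖ ≤ 3 * δ := by
    intro v y hy hvy
    by_cases hv : ‖v - c‖ ≤ ρ / 8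
    · rw [norm_smul, Real.norm_eq_abs, abs_of_nonneg (bump_nonneg c ρ v)]
      have := mul_le_mul (bump_le_one c ρ v) (hφ v hv y hy hvy) (norm_nonneg _) zero_le_one
      linarith
    · rw [bump_zero c hρ (by linarith), zero_smul, norm_zero]; positivity
  have key : ∀ y' ∈ S', ∀ z' ∈ S', ‖bump c ρ (ψ y') • φ (ψ y') - bump c ρ (ψ z') • φ (ψ z')‖
      ≤ (η / 2 + 192 * δ / ρ) * ‖y' - z'‖ := by
    intro y' hy' z' hz'
    obtain ⟨y, hy, z, hz, hy2, hz2, hyz⟩ := q3 y' hy' z' hz'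
    have hvw : ‖ψ y' - ψ z'‖ ≤ 2 * ‖y' - z'‖ := by
      have := q2 y' hy' z' hz'
      have h2 := norm_add_le ((ψ y' - y') - (ψ z' - z')) (y' - z')
      rw [show ψ y' - y' - (ψ z' - z') + (y' - z') = ψ y' - ψ z' by abel] at h2
      have := mul_le_mul_of_nonneg_right d1 (norm_nonneg (y' - z'))
      linarith
    refine glue hρ (by positivity) hδ0.le hvw (fun hv => hφ _ hv y hy hy2) (fun hw => hφ _ hw z hz hz2)
      fun hv hw => ?_
    by_cases ht : ‖y' - z'‖ ≤ ρ' / 8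
    · obtain ⟨g1, g2, g3⟩ := hG _ hv
      obtain ⟨k1, k2, k3⟩ := hG _ hw
      refine (claim2 hm hT hch hρ'0 hε'0.le hε'1 le_rfl hρ'2 (by linarith) d1 (by linarith)
        (norm_nonneg _) g1 k1 g2 hδ0.le k2 g3 k3 hv hw hy hz hy2 hz2 hyz hvw).trans ?_
      gcongr
      linarith
    · have e1 := hφ _ hv y hy hy2
      have e2 := hφ _ hw z hz hz2
      have e3 := norm_sub_le (φ (ψ y')) (φ (ψ z'))
      have e4 : η / 2 * (ρ' / 8) ≤ η / 2 * ‖y' - z'‖ := by gcongr; linarith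
      have e5 : ‖φ (ψ y')‖ ≤ 3 * δ := e1
      have e6 : ‖φ (ψ z')‖ ≤ 3 * δ := e2
      linarith
  have hδη : δ + (η / 2 + 192 * δ / ρ) ≤ η := by linarith
  have key2 : ∀ (y' z' a : V), y' ∈ S' → z' ∈ S' → ‖a‖ ≤ δ * ‖y' - z'‖ → 
      ‖a + (bump c ρ (ψ y') • φ (ψ y') - bump c ρ (ψ z') • φ (ψ z'))‖ ≤ η * ‖y' - z'‖ := by
    intro y' z' a hy' hz' ha
    refine (norm_add_le _ _).trans ?_
    have := key y' hy' z' hz'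
    have := mul_le_mul_of_nonneg_right hδη (norm_nonneg (y' - z'))
    linarith
  refine ⟨fun y => ψ y + bump c ρ (ψ y) • φ (ψ y), ?_, ?_, ?_, ?_⟩
  · intro y' hy'
    obtain ⟨y, hy, z, hz, hy2, hz2, hyz⟩ := q3 y' hy' y' hy'
    have e1 := hΦ _ y hy hy2
    have e2 := norm_add_le (ψ y' - y') (bump c ρ (ψ y') • φ (ψ y'))
    rw [show ψ y' + bump c ρ (ψ y') • φ (ψ y') - y' = ψ y' - y' + bump c ρ (ψ y') • φ (ψ y') by abel]
    have := q1 y' hy'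
    linarith
  · intro y hy z hz
    have := key2 y z _ hy hz (q2 y hy z hz)
    refine le_trans (le_of_eq ?_) this
    congr 1
    beta_reduce
    abel
  · intro y' hy' z' hz'
    obtain ⟨y, hy, z, hz, hy2, hz2, hyz⟩ := q3 y' hy' z' hz'
    refine ⟨y, hy, z, hz, ?_, ?_, ?_⟩
    · have e1 := hΦ _ y hy hy2
      have e2 := norm_add_le (ψ y' - y) (bump c ρ (ψ y') • φ (ψ y'))
      rw [show ψ y' + bump c ρ (ψ y') • φ (ψ y') - y = ψ y' - y + bump c ρ (ψ y') • φ (ψ y') by abel]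
      linarith
    · have e1 := hΦ _ z hz hz2
      have e2 := norm_add_le (ψ z' - z) (bump c ρ (ψ z') • φ (ψ z'))
      rw [show ψ z' + bump c ρ (ψ z') • φ (ψ z') - z = ψ z' - z + bump c ρ (ψ z') • φ (ψ z') by abel]
      linarith
    · have := key2 y' z' _ hy' hz' hyz
      refine le_trans (le_of_eq ?_) this
      congr 1
      beta_reduce
      abel
  · rintro y hy (hyC | hyb)
    · have hψ := q4 y hy hyC
      by_cases hv : ‖ψ y - c‖ ≤ ρ / 8
      · have e := hGy _ hv _ hψ (by rw [sub_self, norm_zero]; positivity)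
        rw [sub_self, norm_zero, mul_zero] at e
        have : φ (ψ y) = 0 := by
          have := norm_le_zero_iff.1 e
          exact this
        simp only [this, smul_zero, add_zero]
        exact hψ
      · simp only [bump_zero c hρ (by linarith : ρ / 16 ≤ ‖ψ y - c‖), zero_smul, add_zero]
        exact hψ
    · rw [mem_ball, dist_eq_norm] at hyb
      have e1 := q1 y hy
      have e2 : ‖ψ y - c‖ ≤ ‖ψ y - y‖ + ‖y - c‖ := by simpa using norm_add_le (ψ y - y) (y - c)
      have e3 := bump_one c hρ (by linarith : ‖ψ y - c‖ ≤ ρ / 32)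
      simp only [e3, one_smul, hφd, add_sub_cancel]
      exact (hG _ (by linarith)).1

lemma chart_cover {m : ℕ} (hm : 1 ≤ m) {S : Set V} (hSc : IsCompact S) {R : ℝ → ℝ}
    (hR : ∀ ε, 0 < ε → ε ≤ 1 / 16 → 0 < R ε) (hS : Reg m R S) : ∃ U, IsOpen U ∧ S ⊆ U ∧
      ∀ η > 0, ∃ δ > 0, ∀ (S' C : Set V) (ψ : V → V),
      Qp S S' C δ ψ → ∃ ψ', Qp S S' (C ∪ U) η ψ' := by
  refine hSc.induction_on (p := fun s => ∃ U, IsOpen U ∧ s ⊆ U ∧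
      ∀ η > 0, ∃ δ > 0, ∀ (S' C : Set V) (ψ : V → V),
      Qp S S' C δ ψ → ∃ ψ', Qp S S' (C ∪ U) η ψ') ?_ ?_ ?_ ?_
  · refine ⟨∅, isOpen_empty, le_rfl, fun η hη => ⟨η, hη, fun S' C ψ h => ⟨ψ, ?_⟩⟩⟩
    rwa [union_empty]
  · rintro s t hst ⟨U, h1, h2, h3⟩
    exact ⟨U, h1, hst.trans h2, h3⟩
  · rintro s t ⟨U, h1, h2, h3⟩ ⟨U', h1', h2', h3'⟩
    refine ⟨U ∪ U', h1.union h1', union_subset_union h2 h2', fun η hη => ?_⟩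
    obtain ⟨δ', hδ', h4'⟩ := h3' η hη
    obtain ⟨δ, hδ, h4⟩ := h3 δ' hδ'
    refine ⟨δ, hδ, fun S' C ψ h => ?_⟩
    obtain ⟨ψ1, hψ1⟩ := h4 S' C ψ h
    obtain ⟨ψ2, hψ2⟩ := h4' S' _ ψ1 hψ1
    rw [union_assoc] at hψ2
    exact ⟨ψ2, hψ2⟩
  · intro x hx
    obtain ⟨s, hs, h⟩ := chart_step hm hR hS hx
    exact ⟨ball x s, mem_nhdsWithin_of_mem_nhds (ball_mem_nhds x hs), ball x s, isOpen_ball, le_rfl, h⟩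

end Proj

end Part8

section Part9

section Surj

variable {V : Type*} [NormedAddCommGroup V] [InnerProductSpace ℝ V] [FiniteDimensional ℝ V]

set_option maxHeartbeats 1000000 in
lemma qp_id {m : ℕ} (hm : 1 ≤ m) {R : ℝ → ℝ} (hR : ∀ ε, 0 < ε → ε ≤ 1 / 16 → 0 < R ε)
    {δ : ℝ} (hδ : 0 < δ) : ∃ h > 0, ∀ S0 S' : Set V, Reg m R S0 → Reg m R S' → HD h S' S0 →
      Qp S0 S' ∅ δ id := by
  have hm1 : (1 : ℝ) ≤ m := by exact_mod_cast hm
  obtain ⟨ε, hε0, hε⟩ := exists_small [1 / 16, 1 / (8 * m), δ / 2 / (3 + 16 * m)] (by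
    simp only [List.mem_cons, List.not_mem_nil, or_false, forall_eq_or_imp, forall_eq]
    refine ⟨?_, ?_, ?_⟩ <;> positivity)
  simp only [List.mem_cons, List.not_mem_nil, or_false, forall_eq_or_imp, forall_eq] at hε
  obtain ⟨ε1, ε2, ε3⟩ := hε
  rw [le_div_iff₀ (by positivity)] at ε2 ε3
  obtain ⟨ρ, hρ0, hρ⟩ := exists_small [1, R ε] (by
    simp only [List.mem_cons, List.not_mem_nil, or_false, forall_eq_or_imp, forall_eq]
    exact ⟨one_pos, hR ε hε0 ε1⟩)
  simp only [List.mem_cons, List.not_mem_nil, or_false, forall_eq_or_imp, forall_eq] at hρ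
  obtain ⟨ρ1, ρ2⟩ := hρ
  obtain ⟨h, hh0, hh⟩ := exists_small [ρ / 8, ε * (ρ / 8) / 2, δ / 2, δ * ρ / 8] (by
    simp only [List.mem_cons, List.not_mem_nil, or_false, forall_eq_or_imp, forall_eq]
    refine ⟨?_, ?_, ?_, ?_⟩ <;> positivity)
  simp only [List.mem_cons, List.not_mem_nil, or_false, forall_eq_or_imp, forall_eq] at hh
  obtain ⟨h1, h2, h3, h4⟩ := hh
  refine ⟨h, hh0, fun S0 S' hS0 hS' hHD => ⟨?_, ?_, ?_, ?_⟩⟩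
  · intro y _; simpa using hδ.le
  · intro y _ z _; simp only [id, sub_self, norm_zero]; positivity
  · intro y' hy' z' hz'
    obtain ⟨y, hy, hyy⟩ := hHD.1 y' hy'
    simp only [id]
    by_cases ht : ‖y' - z'‖ ≤ ρ / 4
    · obtain ⟨T0, hT0⟩ : ∃ T, ChAt m S0 y T ρ ε := hS0 ε hε0 ε1 ρ hρ0 ρ2 y hy
      obtain ⟨T', hT'⟩ : ∃ T, ChAt m S' y' T ρ ε := hS' ε hε0 ε1 ρ hρ0 ρ2 y' hy'
      have hang : Ang T' T0 (4 * m * (4 * ε)) := by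
        refine ang_of hT'.1 (t := ρ / 8) (by positivity) (by positivity) (by linarith) fun u hu hut => ?_
        obtain ⟨b', hb', hb1, hb2⟩ := hT'.2.2 u hu (by linarith)
        rw [hut] at hb1
        refine ⟨b' - y', hb2, ?_, ?_⟩
        · refine (hT'.2.1 b' hb' y' hy' (by linarith) (by simpa using hρ0.le)).trans ?_
          have := mul_le_mul_of_nonneg_left hb1 hε0.le
          have : 0 ≤ ε * (ρ / 8) := by positivity
          linarith
        · obtain ⟨b, hb, hbb⟩ := hHD.1 b' hb'
          have e1 : ‖(b' - y') - (b - y)‖ ≤ 2 * h := by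
            rw [show (b' - y') - (b - y) = (b' - b) - (y' - y) by abel]
            linarith [norm_sub_le (b' - b) (y' - y)]
          have e2 : ‖b - y‖ ≤ 2 * (ρ / 8) + 2 * h := by
            have := norm_sub_le (b' - y') ((b' - y') - (b - y))
            rw [sub_sub_cancel] at this
            linarith
          have e3 := hT0.2.1 b hb y hy (by linarith) (by simpa using hρ0.le)
          have e4 := offp_le_add T0 (b' - y') (b - y)
          have e5 := mul_le_mul_of_nonneg_left e2 hε0.le
          have e6 := mul_le_mul_of_nonneg_right ε1 hh0.le
          have : 0 ≤ ε * (ρ / 8) := by positivity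
          linarith
      set v := z' - y' with hv
      have hvn : ‖v‖ = ‖y' - z'‖ := norm_sub_rev _ _
      have hPv := proj_norm_le T0 v
      obtain ⟨z, hz, hz1, hz2⟩ := hT0.2.2 _ (proj_mem T0 v) (by linarith)
      have a1 := norm_sub_le_of_proj_eq T0 hz2.symm
      have a2 := hT0.2.1 z hz y hy (by linarith) (by simpa using hρ0.le)
      have a3 := hT'.2.1 z' hz' y' hy' (by linarith) (by simpa using hρ0.le)
      have a4 := offp_le_add T0 v (T'.starProjection v)
      have a5 := hang _ (proj_mem T' v)
      have a6 := mul_le_mul_of_nonneg_left (proj_norm_le T' v) (by positivity : 0 ≤ 4 * (m : ℝ) * (4 * ε))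
      have a7 : ‖v - T'.starProjection v‖ ≤ ε * ‖v‖ := a3
      have a8 := mul_le_mul_of_nonneg_left (hz1.trans (mul_le_mul_of_nonneg_left hPv two_pos.le)) hε0.le
      have a9 := mul_le_mul_of_nonneg_right ε3 (norm_nonneg v)
      have a10 : ‖v - (z - y)‖ ≤ δ / 2 * ‖v‖ := by linarith
      have a11 := mul_le_mul_of_nonneg_left (by linarith : ‖v‖ ≤ 1) hδ.le
      refine ⟨y, hy, z, hz, by linarith, ?_, ?_⟩
      · have := norm_add_le (v - (z - y)) (y' - y)
        rw [show v - (z - y) + (y' - y) = z' - z by rw [hv]; abel] at this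
        linarith
      · rw [show y' - y - (z' - z) = -(v - (z - y)) by rw [hv]; abel, norm_neg, ← hvn]
        have : 0 ≤ δ * ‖v‖ := by positivity
        linarith
    · obtain ⟨z, hz, hzz⟩ := hHD.1 z' hz'
      refine ⟨y, hy, z, hz, by linarith, by linarith, ?_⟩
      have e1 := norm_sub_le (y' - y) (z' - z)
      have : δ * (ρ / 4) ≤ δ * ‖y' - z'‖ := by gcongr; linarith
      linarith
  · intro y _ h; exact absurd h (by simp)

set_option maxHeartbeats 1000000 in
lemma surj_of {m : ℕ} (hm : 1 ≤ m) {R : ℝ → ℝ} (hR : ∀ ε, 0 < ε → ε ≤ 1 / 16 → 0 < R ε) :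
    ∃ η0 > 0, ∀ η, 0 < η → η ≤ η0 → ∀ (S0 S' : Set V) (ψ : V → V), Reg m R S0 → Reg m R S' →
      IsCompact S' → HD η0 S' S0 → (∀ y ∈ S', ψ y ∈ S0) → (∀ y ∈ S', ‖ψ y - y‖ ≤ η) →
      (∀ y ∈ S', ∀ z ∈ S', ‖(ψ y - y) - (ψ z - z)‖ ≤ η * ‖y - z‖) → ∀ y ∈ S0, ∃ x ∈ S', ψ x = y := by
  have hm1 : (1 : ℝ) ≤ m := by exact_mod_cast hm
  set ε : ℝ := 1 / (64 * m) with hεd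
  have hε0 : 0 < ε := by positivity
  have hmε : (m : ℝ) * ε = 1 / 64 := by rw [hεd]; field_simp
  have hεm : ε ≤ m * ε := by nlinarith
  obtain ⟨η0, hη0, hη⟩ := exists_small [ε, R ε / 8] (by
    simp only [List.mem_cons, List.not_mem_nil, or_false, forall_eq_or_imp, forall_eq]
    exact ⟨hε0, by have := hR ε hε0 (by linarith); positivity⟩)
  simp only [List.mem_cons, List.not_mem_nil, or_false, forall_eq_or_imp, forall_eq] at hη
  obtain ⟨η1, η2⟩ := hη
  refine ⟨η0, hη0, fun η hη hηη S0 S' ψ hS0 hS' hSc hHD hψ hψ1 hψ2 y hy => ?_⟩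
  set ρ := R ε with hρd
  have hρ : 0 < ρ := hR ε hε0 (by linarith)
  have hLip : ∀ a ∈ S', ∀ b ∈ S', ‖ψ a - ψ b‖ ≤ 2 * ‖a - b‖ := by
    intro a ha b hb
    have e1 := hψ2 a ha b hb
    have e2 := norm_add_le ((ψ a - a) - (ψ b - b)) (a - b)
    rw [show ψ a - a - (ψ b - b) + (a - b) = ψ a - ψ b by abel] at e2
    have := mul_le_mul_of_nonneg_right (by linarith : η ≤ 1) (norm_nonneg (a - b))
    linarith
  have hcont : ContinuousOn (fun x => ‖ψ x - y‖) S' := by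
    have : LipschitzOnWith 2 ψ S' := LipschitzOnWith.of_dist_le_mul fun a ha b hb => by
      rw [dist_eq_norm, dist_eq_norm]; exact hLip a ha b hb
    exact (this.continuousOn.sub continuousOn_const).norm
  obtain ⟨x1, hx1, hx1y⟩ := hHD.2 y hy
  obtain ⟨x, hx, hmin⟩ := hSc.exists_isMinOn ⟨x1, hx1⟩ hcont
  have hmin' : ∀ a ∈ S', ‖ψ x - y‖ ≤ ‖ψ a - y‖ := fun a ha => hmin ha
  refine ⟨x, hx, ?_⟩
  set v := y - ψ x with hv
  have hvn : ‖v‖ = ‖ψ x - y‖ := norm_sub_rev _ _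
  have hvs : ‖v‖ ≤ ρ / 4 := by
    have e1 := hmin' x1 hx1
    have e2 := norm_add_le (ψ x1 - x1) (x1 - y)
    rw [sub_add_sub_cancel] at e2
    have := hψ1 x1 hx1
    linarith
  obtain ⟨T, hT⟩ : ∃ T, ChAt m S' x T ρ ε := hS' ε hε0 (by linarith) ρ hρ le_rfl x hx
  obtain ⟨T0, hT0⟩ : ∃ T, ChAt m S0 (ψ x) T ρ ε := hS0 ε hε0 (by linarith) ρ hρ le_rfl _ (hψ x hx)
  have hang : Ang T0 T (4 * m * (6 * ε)) := by
    intro f hf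
    refine (plane_compare (F := T0) (F' := T) (T := T) (K := 1) (t := ρ / 4) hT.1 hT0.1 (by positivity) zero_le_one
      (by positivity) (by linarith) (fun u hu hut => ?_) f hf).1
    obtain ⟨b, hb, hb1, hb2⟩ := hT.2.2 u hu (by linarith)
    rw [hut] at hb1
    have e1 := hT.2.1 b hb x hx (by linarith) (by simpa using hρ.le)
    have e2 := mul_le_mul_of_nonneg_left hb1 hε0.le
    have e0 : 0 ≤ ε * (ρ / 4) := by positivity
    refine ⟨b - x, hb2, ?_, ?_, by linarith⟩
    · have e3 : ‖b - x - u‖ ≤ ε * ‖b - x‖ := by rw [← hb2]; exact e1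
      have e4 := mul_le_mul_of_nonneg_right (by linarith : ε ≤ 1 / 2) (norm_nonneg (b - x))
      linarith
    · have e3 := hLip b hb x hx
      have e4 := hT0.2.1 _ (hψ b hb) _ (hψ x hx) (by linarith) (by simpa using hρ.le)
      have e5 := offp_le_add T0 (b - x) (ψ b - ψ x)
      have e6 := hψ2 b hb x hx
      have e7 : ‖b - x - (ψ b - ψ x)‖ ≤ η * ‖b - x‖ := by
        rw [show b - x - (ψ b - ψ x) = -(ψ b - b - (ψ x - x)) by abel, norm_neg]; exact e6
      have e8 := mul_le_mul_of_nonneg_right (hηη.trans η1) (norm_nonneg (b - x))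
      have e9 := mul_le_mul_of_nonneg_left e3 hε0.le
      linarith
  have hPv := proj_norm_le T v
  obtain ⟨b, hb, hb1, hb2⟩ := hT.2.2 _ (proj_mem T v) (by linarith)
  have a0 := norm_nonneg v
  have a1 := hT0.2.1 y hy _ (hψ x hx) (by linarith) (by simpa using hρ.le)
  have a2 := hang _ (proj_mem T0 v)
  have a3 := offp_le_add T v (T0.starProjection v)
  have a4 : ‖v - T0.starProjection v‖ ≤ ε * ‖v‖ := a1
  have a5 := mul_le_mul_of_nonneg_left (proj_norm_le T0 v) (by positivity : 0 ≤ 4 * (m : ℝ) * (6 * ε))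
  have a6 := hT.2.1 b hb x hx (by linarith) (by simpa using hρ.le)
  have hbx : ‖b - x‖ ≤ 2 * ‖v‖ := by linarith
  have a7 := mul_le_mul_of_nonneg_left hbx hε0.le
  have a8 := norm_sub_le_of_proj_eq T hb2
  have a9 := hψ2 b hb x hx
  have a10 := mul_le_mul_of_nonneg_right (hηη.trans η1) (norm_nonneg (b - x))
  have a11 := norm_add_le (ψ b - b - (ψ x - x)) (b - x - v)
  rw [show ψ b - b - (ψ x - x) + (b - x - v) = ψ b - y by rw [hv]; abel] at a11
  have a12 := hmin' b hb
  have a13 := mul_le_mul_of_nonneg_right hεm a0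
  have a14 : (m : ℝ) * ε * ‖v‖ = 1 / 64 * ‖v‖ := by rw [hmε]
  have : ‖v‖ = 0 := by linarith
  have := norm_eq_zero.1 this
  rw [hv, sub_eq_zero] at this
  exact this.symm

lemma proj_exists {m : ℕ} (hm : 1 ≤ m) {R : ℝ → ℝ} (hR : ∀ ε, 0 < ε → ε ≤ 1 / 16 → 0 < R ε)
    {S0 : Set V} (hSc : IsCompact S0) (hS0 : Reg m R S0) {η : ℝ} (hη : 0 < η) :
    ∃ h > 0, ∀ S', IsCompact S' → Reg m R S' → HD h S' S0 → ∃ ψ : V → V, 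
      (∀ y ∈ S', ‖ψ y - y‖ ≤ η) ∧ 
      (∀ y ∈ S', ∀ z ∈ S', ‖(ψ y - y) - (ψ z - z)‖ ≤ η * ‖y - z‖) ∧ ψ '' S' = S0 := by
  obtain ⟨η0, hη0, hsurj⟩ := surj_of (V := V) hm hR
  obtain ⟨U, hU, hSU, hcov⟩ := chart_cover hm hSc hR hS0
  obtain ⟨δ, hδ, hcov⟩ := hcov (min η η0) (lt_min hη hη0)
  obtain ⟨h, hh, hid⟩ := qp_id (V := V) hm hR hδ
  obtain ⟨h', hh', hthick⟩ := hSc.exists_thickening_subset_open hU hSU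
  refine ⟨min (min h (h' / 2)) η0, lt_min (lt_min hh (by positivity)) hη0, fun S' hS'c hS' hHD => ?_⟩
  have hmono : ∀ a, min (min h (h' / 2)) η0 ≤ a → HD a S' S0 := fun a ha =>
    ⟨fun x hx => (hHD.1 x hx).imp fun _ h => ⟨h.1, h.2.trans ha⟩,
      fun x hx => (hHD.2 x hx).imp fun _ h => ⟨h.1, h.2.trans ha⟩⟩
  obtain ⟨ψ, q1, q2, q3, q4⟩ := hcov S' ∅ id (hid S0 S' hS0 hS' (hmono h ((min_le_left _ _).trans (min_le_left _ _))))
  have hsub : S' ⊆ U := by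
    intro x hx
    apply hthick
    obtain ⟨y, hy, hxy⟩ := (hmono (h' / 2) ((min_le_left _ _).trans (min_le_right _ _))).1 x hx
    rw [mem_thickening_iff]
    exact ⟨y, hy, by rw [dist_eq_norm]; linarith⟩
  have q4' : ∀ y ∈ S', ψ y ∈ S0 := fun y hy => q4 y hy (by simp [hsub hy])
  refine ⟨ψ, fun y hy => (q1 y hy).trans (min_le_left _ _), fun y hy z hz => (q2 y hy z hz).trans ?_, ?_⟩
  · gcongr; exact min_le_left _ _
  · apply Subset.antisymm
    · rintro _ ⟨y, hy, rfl⟩; exact q4' y hy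
    · intro y hy
      exact hsurj _ (lt_min hη hη0) (min_le_right _ _) S0 S' ψ hS0 hS' hS'c (hmono η0 (min_le_right _ _)) q4' q1 q2 y hy

end Surj

end Part9

section Part10

lemma AmbientIsotopic.refl (n : ℕ) (S : Set (EuclideanSpace ℝ (Fin n))) : AmbientIsotopic n S S := by
  refine ⟨fun x => x.1, continuous_fst, fun t _ => IsEmbedding.id, fun x => rfl, ?_⟩
  simp

lemma AmbientIsotopic.trans {n : ℕ} {S1 S2 S3 : Set (EuclideanSpace ℝ (Fin n))}
    (h1 : AmbientIsotopic n S1 S2) (h2 : AmbientIsotopic n S2 S3) : AmbientIsotopic n S1 S3 := by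
  obtain ⟨H, hc, he, hid, him⟩ := h1
  obtain ⟨H', hc', he', hid', him'⟩ := h2
  refine ⟨fun x => H (H' (x.1, max 0 (2 * x.2 - 1)), min 1 (2 * x.2)), by fun_prop, ?_, ?_, ?_⟩
  · rintro t ⟨ht0, ht1⟩
    have e1 := he (min 1 (2 * t)) ⟨le_min zero_le_one (by linarith), min_le_left _ _⟩
    have e2 := he' (max 0 (2 * t - 1)) ⟨le_max_left _ _, max_le zero_le_one (by linarith)⟩
    exact e1.comp e2
  · intro x
    have e1 : min (1 : ℝ) (2 * 1) = 1 := by norm_num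
    have e2 : max (0 : ℝ) (2 * 1 - 1) = 1 := by norm_num
    simp only [e1, e2, hid, hid']
  · have e1 : min (1 : ℝ) (2 * 0) = 0 := by norm_num
    have e2 : max (0 : ℝ) (2 * 0 - 1) = 0 := by norm_num
    simp only [e1, e2]
    rw [← him, ← him', image_image]

lemma iso_of_lip {n : ℕ} {φ : EuclideanSpace ℝ (Fin n) → EuclideanSpace ℝ (Fin n)} 
    (h : LipschitzWith (1 / 2) φ)
    (S : Set (EuclideanSpace ℝ (Fin n))) : AmbientIsotopic n ((fun x => x + φ x) '' S) S := by
  have hc := h.continuous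
  refine ⟨fun x => x.1 + (1 - x.2) • φ x.1, by fun_prop, ?_, ?_, ?_⟩
  · rintro t ⟨ht0, ht1⟩
    have hl : ∀ x y, ‖φ x - φ y‖ ≤ 1 / 2 * ‖x - y‖ := fun x y => by
      have := h.dist_le_mul x y
      rw [dist_eq_norm, dist_eq_norm] at this
      simpa using this
    have hb : ∀ x y, ‖(1 - t) • φ x - (1 - t) • φ y‖ ≤ 1 / 2 * ‖x - y‖ := fun x y => by
      rw [← smul_sub, norm_smul, Real.norm_eq_abs, abs_of_nonneg (by linarith)]
      have := mul_le_mul_of_nonneg_right (by linarith : 1 - t ≤ 1) (norm_nonneg (φ x - φ y))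
      linarith [hl x y]
    have ha : AntilipschitzWith 2 (fun x => x + (1 - t) • φ x) := by
      refine AntilipschitzWith.of_le_mul_dist fun x y => ?_
      rw [dist_eq_norm, dist_eq_norm]
      have e := norm_sub_le (x + (1 - t) • φ x - (y + (1 - t) • φ y)) ((1 - t) • φ x - (1 - t) • φ y)
      rw [show (x + (1 - t) • φ x - (y + (1 - t) • φ y)) - ((1 - t) • φ x - (1 - t) • φ y) = x - y by abel] at e
      have := hb x y
      push_cast
      linarith
    have hL : LipschitzWith 2 (fun x => x + (1 - t) • φ x) := by
      refine LipschitzWith.of_dist_le_mul fun x y => ?_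
      rw [dist_eq_norm, dist_eq_norm]
      have e := norm_add_le (x - y) ((1 - t) • φ x - (1 - t) • φ y)
      rw [show x - y + ((1 - t) • φ x - (1 - t) • φ y) = (x + (1 - t) • φ x - (y + (1 - t) • φ y)) by abel] at e
      have := hb x y
      have := norm_nonneg (x - y)
      push_cast
      linarith
    exact (ha.isUniformEmbedding hL.uniformContinuous).isEmbedding
  · intro x; simp
  · simp

lemma iso_translate {n : ℕ} (a : EuclideanSpace ℝ (Fin n)) (S : Set (EuclideanSpace ℝ (Fin n))) :
    AmbientIsotopic n ((fun x => x + a) '' S) S :=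
  iso_of_lip (φ := fun _ => a) ((LipschitzWith.const a).weaken (zero_le)) S

lemma iso_of_psi (n : ℕ) : ∃ η0 > 0, ∀ η, 0 < η → η ≤ η0 → ∀ (S' : Set (EuclideanSpace ℝ (Fin n)))
    (ψ : EuclideanSpace ℝ (Fin n) → EuclideanSpace ℝ (Fin n)),
    (∀ y ∈ S', ∀ z ∈ S', ‖(ψ y - y) - (ψ z - z)‖ ≤ η * ‖y - z‖) → AmbientIsotopic n (ψ '' S') S' := by
  set L := lipschitzExtensionConstant (EuclideanSpace ℝ (Fin n)) with hL
  have hLpos : 0 < L := lipschitzExtensionConstant_pos _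
  refine ⟨1 / (2 * L), by positivity, fun η hη hη0 S' ψ h => ?_⟩
  have h1 : LipschitzOnWith (Real.toNNReal η) (fun y => ψ y - y) S' := by
    refine LipschitzOnWith.of_dist_le_mul fun x hx y hy => ?_
    rw [dist_eq_norm, dist_eq_norm]
    rw [Real.coe_toNNReal η hη.le]
    exact h x hx y hy
  obtain ⟨φ, hφ, heq⟩ := h1.extend_finite_dimension
  have h2 : LipschitzWith (1 / 2) φ := by
    refine hφ.weaken ?_
    rw [← hL, ← NNReal.coe_le_coe]
    push_cast
    rw [le_div_iff₀ (by positivity)] at hη0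
    rw [Real.coe_toNNReal η hη.le]
    linarith
  have h3 := iso_of_lip h2 S'
  have h4 : (fun x => x + φ x) '' S' = ψ '' S' := by
    apply image_congr
    intro x hx
    rw [← heq hx]
    simp
  rwa [h4] at h3

section Compactness
variable {V : Type*} [NormedAddCommGroup V] [InnerProductSpace ℝ V] [FiniteDimensional ℝ V]

lemma ChProp.translate {m : ℕ} {S : Set V} {ρ ε : ℝ} (h : ChProp m S ρ ε) (a : V) :
    ChProp m ((fun x => x + a) '' S) ρ ε := by
  rintro _ ⟨x, hx, rfl⟩
  obtain ⟨T, hT, h1, h2⟩ := h x hx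
  refine ⟨T, hT, ?_, ?_⟩
  · rintro _ ⟨y, hy, rfl⟩ _ ⟨z, hz, rfl⟩ 
    simp only [add_sub_add_right_eq_sub]
    exact h1 y hy z hz
  · intro u hu hur
    obtain ⟨y, hy, hy1, hy2⟩ := h2 u hu hur
    refine ⟨y + a, ⟨y, hy, rfl⟩, ?_⟩
    simp only [add_sub_add_right_eq_sub]
    exact ⟨hy1, hy2⟩

lemma hausdorff_subseq {S : ℕ → Set V} {d : ℝ} (hne : ∀ j, (S j).Nonempty)
    (hc : ∀ j, IsCompact (S j)) (hd : ∀ j, S j ⊆ closedBall 0 d) :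
    ∃ (S0 : Set V) (φ : ℕ → ℕ) (h : ℕ → ℝ), StrictMono φ ∧ IsCompact S0 ∧ S0.Nonempty ∧
      Tendsto h atTop (𝓝 0) ∧ ∀ j, HD (h j) (S (φ j)) S0 := by
  classical
  let B := closedBall (0 : V) d
  have hcl : ∀ j, IsCompact ((↑) ⁻¹' (S j) : Set B) := fun j =>
    (Topology.IsInducing.subtypeVal.isCompact_preimage_iff (by rw [Subtype.range_coe]; exact hd j)).2 (hc j)
  let K : ℕ → TopologicalSpace.NonemptyCompacts B := fun j =>
    ⟨⟨(↑) ⁻¹' (S j), hcl j⟩, by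
      obtain ⟨x, hx⟩ := hne j
      exact ⟨⟨x, hd j hx⟩, hx⟩⟩
  obtain ⟨K0, -, φ, hφ, hlim⟩ := isCompact_univ.tendsto_subseq (fun j => mem_univ (K j))
  have hfin : ∀ j, hausdorffEDist (K (φ j) : Set B) K0 ≠ ⊤ := fun j =>
    hausdorffEDist_ne_top_of_nonempty_of_bounded (K (φ j)).nonempty K0.nonempty
      (K (φ j)).isCompact.isBounded K0.isCompact.isBounded
  refine ⟨(↑) '' (K0 : Set B), φ, fun j => dist (K (φ j)) K0 + 1 / ((j : ℝ) + 1), hφ,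
    K0.isCompact.image continuous_subtype_val, K0.nonempty.image _, ?_, fun j => ⟨?_, ?_⟩⟩
  · have h1 : Tendsto (fun j => dist (K (φ j)) K0) atTop (𝓝 0) := tendsto_iff_dist_tendsto_zero.1 hlim
    have h2 := h1.add (tendsto_one_div_add_atTop_nhds_zero_nat (𝕜 := ℝ))
    simpa using h2
  · intro a ha
    have hlt : hausdorffDist (K (φ j) : Set B) K0 < dist (K (φ j)) K0 + 1 / ((j : ℝ) + 1) := by
      rw [NonemptyCompacts.dist_eq]
      have : 0 < 1 / ((j : ℝ) + 1) := by positivity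
      linarith
    obtain ⟨y, hy, hxy⟩ := exists_dist_lt_of_hausdorffDist_lt (x := (⟨a, hd _ ha⟩ : B)) 
      (s := (K (φ j) : Set B)) ha hlt (hfin j)
    refine ⟨y, ⟨y, hy, rfl⟩, ?_⟩
    rw [← dist_eq_norm]
    exact hxy.le
  · rintro _ ⟨b, hb, rfl⟩
    have hlt : hausdorffDist (K (φ j) : Set B) K0 < dist (K (φ j)) K0 + 1 / ((j : ℝ) + 1) := by
      rw [NonemptyCompacts.dist_eq]
      have : 0 < 1 / ((j : ℝ) + 1) := by positivity
      linarith
    obtain ⟨y, hy, hxy⟩ := exists_dist_lt_of_hausdorffDist_lt' hb hlt (hfin j)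
    refine ⟨y, hy, ?_⟩
    rw [← dist_eq_norm]
    exact hxy.le

lemma diam_limit {S : ℕ → Set V} {S0 : Set V} {h : ℕ → ℝ} {d : ℝ} (hd0 : 0 ≤ d) (hSc : ∀ j, IsCompact (S j))
    (hh : Tendsto h atTop (𝓝 0)) (hHD : ∀ j, HD (h j) (S j) S0)
    (hd : ∀ j, diam (S j) ≤ d) : diam S0 ≤ d := by
  refine diam_le_of_forall_dist_le hd0 fun x hx y hy => ?_
  have h1 : Tendsto (fun j => d + 2 * h j) atTop (𝓝 (d + 2 * 0)) := (hh.const_mul 2).const_add d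
  rw [mul_zero, add_zero] at h1
  refine ge_of_tendsto' h1 fun j => ?_
  obtain ⟨a, ha, hax⟩ := (hHD j).2 x hx
  obtain ⟨b, hb, hby⟩ := (hHD j).2 y hy
  have e1 := (dist_le_diam_of_mem (hSc j).isBounded ha hb).trans (hd j)
  have e2 := dist_triangle4 x a b y
  rw [dist_comm x a, dist_eq_norm a x, dist_eq_norm b y] at e2
  linarith

end Compactness

end Part10

section Part11

lemma curv_translate (m n : ℕ) (z : Fin (m + 2) → EuclideanSpace ℝ (Fin n))
    (a : EuclideanSpace ℝ (Fin n)) : mengerCurv m n (fun i => z i + a) = mengerCurv m n z := by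
  have hr : Set.range (fun i => z i + a) = (IsometryEquiv.addRight a) '' (Set.range z) := by
    rw [← Set.range_comp]; rfl
  have hc : convexHull ℝ ((IsometryEquiv.addRight a) '' (Set.range z))
      = (IsometryEquiv.addRight a) '' (convexHull ℝ (Set.range z)) := by
    have h := AffineMap.image_convexHull (𝕜 := ℝ)
      (AffineMap.id ℝ (EuclideanSpace ℝ (Fin n)) + AffineMap.const ℝ _ a) (Set.range z)
    exact h.symm
  unfold mengerCurv
  rw [hr, hc, IsometryEquiv.hausdorffMeasure_image]
  congr 2
  exact (IsometryEquiv.addRight a).isometry.ediam_image _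

lemma curv_degenerate (m n : ℕ) (z : Fin (m + 2) → EuclideanSpace ℝ (Fin n))
    (h : ¬ LinearIndependent ℝ (fun i : Fin (m + 1) => z i.succ - z 0)) :
    mengerCurv m n z = 0 := by
  have hvol : μH[(m + 1 : ℝ)] (convexHull ℝ (Set.range z)) = 0 := by
    rw [linearIndependent_iff_card_le_finrank_span] at h
    set W := Submodule.span ℝ (Set.range (fun i : Fin (m + 1) => z i.succ - z 0)) with hW
    have hfin : Module.finrank ℝ W < m + 1 := by
      have := not_le.1 h
      rw [Fintype.card_fin] at this
      exact this
    let g : W → EuclideanSpace ℝ (Fin n) := fun w => (w : EuclideanSpace ℝ (Fin n)) + z 0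
    have hg : Isometry g := by
      intro a b; simp only [g, edist_add_right]; rfl
    have hsub : convexHull ℝ (Set.range z) ⊆ Set.range g := by
      apply convexHull_min
      · rintro _ ⟨i, rfl⟩
        refine Fin.cases ?_ (fun i => ?_) i
        · exact ⟨0, by simp [g]⟩
        · exact ⟨⟨z i.succ - z 0, Submodule.subset_span ⟨i, rfl⟩⟩, by simp [g]⟩
      · rintro _ ⟨a, rfl⟩ _ ⟨b, rfl⟩ s t hs ht hst
        refine ⟨s • a + t • b, ?_⟩
        simp only [g, Submodule.coe_add, Submodule.coe_smul, smul_add]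
        have : z 0 = s • z 0 + t • z 0 := by rw [← add_smul, hst, one_smul]
        nth_rw 1 [this]; abel
    refine measure_mono_null hsub ?_
    rw [← Set.image_univ, hg.hausdorffMeasure_image (Or.inl (by positivity))]
    rw [Real.hausdorffMeasure_of_finrank_lt]
    · simp
    · exact_mod_cast hfin
  unfold mengerCurv
  rw [hvol, ENNReal.zero_div]

lemma curv_compare (m n : ℕ) (z : Fin (m + 2) → EuclideanSpace ℝ (Fin n))
    (h : LinearIndependent ℝ (fun i : Fin (m + 1) => z i.succ - z 0)) :
    ∃ C : ℝ, 0 ≤ C ∧ ∀ z' : Fin (m + 2) → EuclideanSpace ℝ (Fin n),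
      μH[(m + 1 : ℝ)] (convexHull ℝ (Set.range z)) * ENNReal.ofReal (1 - C * dist z' z) ^ (m + 1)
        / (ediam (Set.range z) + 2 * edist z' z) ^ (m + 2) ≤ mengerCurv m n z' := by
  have hinj := LinearMap.ker_eq_bot.2 ((linearIndependent_iff_injective_fintypeLinearCombination).1 h)
  obtain ⟨P0, hP0⟩ := LinearMap.exists_leftInverse_of_injective _ hinj
  let P := LinearMap.toContinuousLinearMap P0
  have hP : ∀ a : Fin (m + 1) → ℝ, P (∑ i, a i • (z i.succ - z 0)) = a := by
    intro a
    have := LinearMap.congr_fun hP0 a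
    simpa [P, Fintype.linearCombination_apply] using this
  refine ⟨2 * (m + 1) * ‖P‖, by positivity, fun z' => ?_⟩
  set δ := dist z' z with hδ
  have hδ0 : 0 ≤ δ := dist_nonneg
  set C := 2 * (m + 1) * ‖P‖ with hC
  by_cases hk : 1 - C * δ ≤ 0
  · rw [ENNReal.ofReal_of_nonpos hk]; simp
  push Not at hk
  let L : EuclideanSpace ℝ (Fin n) →ₗ[ℝ] EuclideanSpace ℝ (Fin n) :=
    LinearMap.id + ∑ i : Fin (m + 1),
      (LinearMap.proj i ∘ₗ P.toLinearMap).smulRight ((z' i.succ - z i.succ) - (z' 0 - z 0))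
  have hL : ∀ v, L v = v + ∑ i : Fin (m + 1), (P v i) • ((z' i.succ - z i.succ) - (z' 0 - z 0)) := by
    intro v; simp [L]
  let f : EuclideanSpace ℝ (Fin n) →ᵃ[ℝ] EuclideanSpace ℝ (Fin n) :=
    L.toAffineMap + AffineMap.const ℝ _ (z' 0 - L (z 0))
  have hf : ∀ v, f v = L v + (z' 0 - L (z 0)) := fun v => rfl
  have hfz : ∀ i, f (z i) = z' i := by
    intro i
    refine Fin.cases ?_ (fun i => ?_) i
    · rw [hf]; abel
    · have h1 : f (z i.succ) = z' 0 + L (z i.succ - z 0) := by rw [hf, map_sub]; abel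
      have h2 : P (z i.succ - z 0) = Pi.single i 1 := by
        have := hP (Pi.single i 1)
        rw [← this]; congr 1
        simp [Pi.single_apply]
      rw [h1, hL, h2]
      simp only [Pi.single_apply, ite_smul, one_smul, zero_smul, Finset.sum_ite_eq', Finset.mem_univ, if_true]
      abel
  have hb : ∀ v, ‖L v - v‖ ≤ C * δ * ‖v‖ := by
    intro v
    rw [hL, add_sub_cancel_left]
    refine (norm_sum_le _ _).trans ?_
    have : ∀ i ∈ (Finset.univ : Finset (Fin (m + 1))),
        ‖(P v i) • ((z' i.succ - z i.succ) - (z' 0 - z 0))‖ ≤ (‖P‖ * ‖v‖) * (2 * δ) := by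
      intro i _
      rw [norm_smul]
      refine mul_le_mul ((norm_le_pi_norm (P v) i).trans (P.le_opNorm v)) ?_ (norm_nonneg _) (by positivity)
      refine (norm_sub_le _ _).trans ?_
      have e1 : ‖z' i.succ - z i.succ‖ ≤ δ := by rw [← dist_eq_norm]; exact dist_le_pi_dist z' z _
      have e2 : ‖z' 0 - z 0‖ ≤ δ := by rw [← dist_eq_norm]; exact dist_le_pi_dist z' z _
      linarith
    refine (Finset.sum_le_card_nsmul _ _ _ this).trans (le_of_eq ?_)
    simp only [Finset.card_univ, Fintype.card_fin, nsmul_eq_mul, hC]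
    push_cast; ring
  set κ := Real.toNNReal (1 - C * δ) with hκ
  have hκ' : (κ : ℝ) = 1 - C * δ := Real.coe_toNNReal _ hk.le
  have hκ0 : κ ≠ 0 := by
    intro h0; rw [h0] at hκ'; simp at hκ'; linarith
  have hanti : AntilipschitzWith κ⁻¹ f := by
    apply AntilipschitzWith.of_le_mul_dist
    intro v w
    have h1 : f v - f w = (v - w) + (L (v - w) - (v - w)) := by
      rw [hf, hf, map_sub]; abel
    have h2 := hb (v - w)
    have h3 : ‖v - w‖ ≤ ‖f v - f w‖ + ‖L (v - w) - (v - w)‖ := by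
      have : v - w = (f v - f w) - (L (v - w) - (v - w)) := by rw [h1]; abel
      calc ‖v - w‖ = ‖(f v - f w) - (L (v - w) - (v - w))‖ := by rw [← this]
        _ ≤ _ := norm_sub_le _ _
    rw [dist_eq_norm, dist_eq_norm, NNReal.coe_inv, hκ', inv_mul_eq_div, le_div_iff₀ hk]
    linarith
  have himg : f '' convexHull ℝ (Set.range z) = convexHull ℝ (Set.range z') := by
    rw [AffineMap.image_convexHull, ← Set.range_comp]
    congr 2
    funext i; exact hfz i
  have hvol := hanti.le_hausdorffMeasure_image (d := (m + 1 : ℝ)) (by positivity) (convexHull ℝ (Set.range z))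
  rw [himg] at hvol
  have hdiam : ediam (Set.range z') ≤ ediam (Set.range z) + 2 * edist z' z := by
    apply Metric.ediam_le
    rintro _ ⟨i, rfl⟩ _ ⟨j, rfl⟩
    calc edist (z' i) (z' j) ≤ edist (z' i) (z i) + edist (z i) (z j) + edist (z j) (z' j) := edist_triangle4 _ _ _ _
      _ ≤ edist z' z + ediam (Set.range z) + edist z' z := by
          gcongr
          · exact edist_le_pi_edist z' z i
          · exact Metric.edist_le_ediam_of_mem ⟨i, rfl⟩ ⟨j, rfl⟩
          · rw [edist_comm]; exact edist_le_pi_edist z' z j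
      _ = _ := by ring
  unfold mengerCurv
  refine ENNReal.div_le_div ?_ ?_
  · have e : ENNReal.ofReal (1 - C * δ) = (κ : ℝ≥0∞) := rfl
    rw [e]
    calc μH[(m + 1 : ℝ)] (convexHull ℝ (Set.range z)) * (κ : ℝ≥0∞) ^ (m + 1)
        ≤ (((κ⁻¹ : ℝ≥0) : ℝ≥0∞) ^ (m + 1 : ℝ) * μH[(m + 1 : ℝ)] (convexHull ℝ (Set.range z'))) * (κ : ℝ≥0∞) ^ (m + 1) := by
          gcongr
      _ = _ := by
          have : ((m : ℝ) + 1) = ((m + 1 : ℕ) : ℝ) := by push_cast; rfl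
          nth_rw 1 [this]
          rw [ENNReal.rpow_natCast, mul_right_comm, ← mul_pow, ← ENNReal.coe_mul, inv_mul_cancel₀ hκ0]
          simp
  · exact pow_le_pow_left' hdiam _

lemma curv_lsc (m n : ℕ) : LowerSemicontinuous (mengerCurv m n) := by
  intro z c hc
  by_cases h : LinearIndependent ℝ (fun i : Fin (m + 1) => z i.succ - z 0)
  swap
  · rw [curv_degenerate m n z h] at hc; exact absurd hc (by simp)
  obtain ⟨C, hC0, hC⟩ := curv_compare m n z h
  have hd0 : ediam (Set.range z) ≠ 0 := by
    intro h0
    have h1 : z (Fin.succ 0) - z 0 ≠ 0 := h.ne_zero 0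
    apply h1
    have := Metric.ediam_eq_zero_iff.1 h0 ⟨Fin.succ 0, rfl⟩ ⟨0, rfl⟩
    rw [this, sub_self]
  have hdt : ediam (Set.range z) ≠ ⊤ := (Set.finite_range z).isBounded.ediam_ne_top
  have ht : Tendsto (fun z' => μH[(m + 1 : ℝ)] (convexHull ℝ (Set.range z)) * ENNReal.ofReal (1 - C * dist z' z) ^ (m + 1)
        / (ediam (Set.range z) + 2 * edist z' z) ^ (m + 2)) (𝓝 z) (𝓝 (mengerCurv m n z)) := by
    have hd : Tendsto (fun z' => dist z' z) (𝓝 z) (𝓝 0) := tendsto_iff_dist_tendsto_zero.1 tendsto_id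
    have hed : Tendsto (fun z' => edist z' z) (𝓝 z) (𝓝 0) := tendsto_iff_edist_tendsto_0.1 tendsto_id
    have h1 : Tendsto (fun z' => ENNReal.ofReal (1 - C * dist z' z)) (𝓝 z) (𝓝 1) := by
      have := ENNReal.tendsto_ofReal ((tendsto_const_nhds (x := (1 : ℝ))).sub (hd.const_mul C))
      simpa using this
    have h2 : Tendsto (fun z' => ediam (Set.range z) + 2 * edist z' z) (𝓝 z) (𝓝 (ediam (Set.range z))) := by
      have := (tendsto_const_nhds (x := ediam (Set.range z))).add
        (ENNReal.Tendsto.const_mul (a := 2) hed (Or.inr (by simp)))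
      simpa using this
    have h3 := ENNReal.Tendsto.const_mul (a := μH[(m + 1 : ℝ)] (convexHull ℝ (Set.range z)))
      (ENNReal.Tendsto.pow (n := m + 1) h1) (Or.inl (by simp))
    have h4 := ENNReal.Tendsto.div h3 (Or.inr (pow_ne_zero _ hd0)) (ENNReal.Tendsto.pow (n := m + 2) h2)
      (Or.inl (ENNReal.pow_ne_top hdt))
    have e : mengerCurv m n z = μH[(m + 1 : ℝ)] (convexHull ℝ (Set.range z)) / ediam (Set.range z) ^ (m + 2) := rfl
    rw [e]
    simpa using h4
  filter_upwards [ht.eventually_const_lt hc] with z' hz'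
  exact hz'.trans_le (hC z')

lemma mengerSup_lsc (m n l : ℕ) (S : Set (EuclideanSpace ℝ (Fin n))) :
    LowerSemicontinuous (mengerSup m n l S) := by
  intro y c hc
  unfold mengerSup at hc
  simp only [lt_iSup_iff] at hc
  obtain ⟨z, hz, hcz⟩ := hc
  let F : (Fin l → EuclideanSpace ℝ (Fin n)) → (Fin (m + 2) → EuclideanSpace ℝ (Fin n)) :=
    fun y' i => if h : (i : ℕ) < l then y' ⟨i, h⟩ else z i
  have hF : Continuous F := by
    refine continuous_pi fun i => ?_
    by_cases h : (i : ℕ) < l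
    · simp only [F, h, dite_true]; exact continuous_apply _
    · simp only [F, h, dite_false]; exact continuous_const
  have hFy : F y = z := by
    funext i
    by_cases h : (i : ℕ) < l
    · simp only [F, h, dite_true]; exact (hz.1 i h).symm
    · simp only [F, h, dite_false]
  have := hF.continuousAt.eventually (hFy.symm ▸ curv_lsc m n z c hcz : ∀ᶠ w in 𝓝 (F y), c < mengerCurv m n w)
  filter_upwards [this] with y' hy'
  refine hy'.trans_le ?_
  refine le_iSup₂_of_le (F y') ⟨fun i h => ?_, fun i h => ?_⟩ le_rfl
  · simp only [F, h, dite_true]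
  · simp only [F, not_lt.2 h, dite_false]; exact hz.2 i h

lemma mengerIntegrand_lsc (m n l : ℕ) (S : Set (EuclideanSpace ℝ (Fin n))) :
    LowerSemicontinuous (mengerIntegrand m n l S) := by
  intro y c hc
  unfold mengerIntegrand at hc
  split_ifs at hc with hd
  · exact absurd hc (by simp)
  push Not at hd
  obtain ⟨i, j, hij⟩ := hd
  have h1 : ∀ᶠ y' : Fin l → EuclideanSpace ℝ (Fin n) in 𝓝 y, y' i ≠ y' j :=
    (isOpen_ne_fun (continuous_apply i) (continuous_apply j)).mem_nhds hij
  filter_upwards [h1, mengerSup_lsc m n l S y c hc] with y' h1 h2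
  unfold mengerIntegrand
  rw [if_neg (fun h => h1 (h i j))]
  exact h2

lemma mengerIntegrand_meas (m n l : ℕ) (S : Set (EuclideanSpace ℝ (Fin n))) :
    Measurable (mengerIntegrand m n l S) := (mengerIntegrand_lsc m n l S).measurable

lemma integrand_liminf {m n l : ℕ} {S0 : Set (EuclideanSpace ℝ (Fin n))}
    {S : ℕ → Set (EuclideanSpace ℝ (Fin n))} {G : ℕ → EuclideanSpace ℝ (Fin n) → EuclideanSpace ℝ (Fin n)}
    {a : ℕ → EuclideanSpace ℝ (Fin n)} (hG : ∀ j, ∀ x ∈ S0, G j x ∈ S j)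
    (hlim : ∀ x ∈ S0, Tendsto (fun j => G j x + a j) atTop (𝓝 x))
    (y : Fin l → EuclideanSpace ℝ (Fin n)) (hy : ∀ i, y i ∈ S0) (c : ℝ≥0∞)
    (hc : c < mengerIntegrand m n l S0 y) :
    ∀ᶠ j in atTop, c < mengerIntegrand m n l (S j) (fun i => G j (y i)) := by
  unfold mengerIntegrand at hc
  split_ifs at hc with hd
  · exact absurd hc (by simp)
  push Not at hd
  obtain ⟨i, k, hik⟩ := hd
  unfold mengerSup at hc
  simp only [lt_iSup_iff] at hc
  obtain ⟨z, hz, hcz⟩ := hc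
  have hzS : ∀ i, z i ∈ S0 := by
    intro i
    by_cases h : (i : ℕ) < l
    · rw [hz.1 i h]; exact hy _
    · exact hz.2 i (not_lt.1 h)
  have ht : Tendsto (fun j => fun i => G j (z i) + a j) atTop (𝓝 z) :=
    tendsto_pi_nhds.2 fun i => hlim _ (hzS i)
  have h1 := ht.eventually (curv_lsc m n z c hcz)
  have h2 := ((hlim _ (hy i)).prodMk_nhds (hlim _ (hy k))).eventually (isOpen_ne_fun continuous_fst continuous_snd |>.mem_nhds hik)
  filter_upwards [h1, h2] with j h1 h2
  unfold mengerIntegrand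
  rw [if_neg (fun h => h2 (by simp only [h i k]))]
  rw [curv_translate m n (fun i => G j (z i)) (a j)] at h1
  refine h1.trans_le (le_iSup₂_of_le (fun i => G j (z i)) ⟨fun i h => ?_, fun i h => hG j _ (hzS i)⟩ le_rfl)
  simp only [hz.1 i h]

end Part11

section Part12

lemma outer_pi_mono {α : Type*} {l : ℕ} (μ ν : OuterMeasure α) (h : μ ≤ ν) :
    OuterMeasure.pi (fun _ : Fin l => μ) ≤ OuterMeasure.pi (fun _ : Fin l => ν) := by
  rw [OuterMeasure.le_pi]
  intro s _
  exact (OuterMeasure.pi_pi_le _ s).trans (Finset.prod_le_prod' fun i _ => h (s i))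

lemma pi_mono_meas {α : Type*} [MeasurableSpace α] {l : ℕ} (μ ν : Measure α) (h : μ ≤ ν) :
    Measure.pi (fun _ : Fin l => μ) ≤ Measure.pi (fun _ : Fin l => ν) := by
  rw [Measure.le_iff]
  intro s hs
  rw [Measure.pi_def, Measure.pi_def, toMeasure_apply _ _ hs, toMeasure_apply _ _ hs]
  refine outer_pi_mono _ _ ?_ s
  intro t
  exact h t

lemma pi_smul_meas {α : Type*} [MeasurableSpace α] {l : ℕ} (c : ℝ≥0) (μ : Measure α) [IsFiniteMeasure μ] :
    Measure.pi (fun _ : Fin l => c • μ) = c ^ l • Measure.pi (fun _ : Fin l => μ) := by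
  apply Measure.pi_eq
  intro s _
  rw [Measure.smul_apply, Measure.pi_pi]
  simp only [Measure.smul_apply, ENNReal.smul_def, smul_eq_mul, Finset.prod_mul_distrib]
  simp

lemma map_le_of {m n : ℕ} {S S0 : Set (EuclideanSpace ℝ (Fin n))} (hS0 : MeasurableSet S0)
    {θ G : EuclideanSpace ℝ (Fin n) → EuclideanSpace ℝ (Fin n)} {c : ℝ≥0}
    (hθ : LipschitzOnWith c θ S) (hGc : Continuous G) (hG : ∀ x ∈ S0, G x ∈ S ∧ θ (G x) = x) :
    ((μH[(m : ℝ)] : Measure (EuclideanSpace ℝ (Fin n))).restrict S0).map G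
      ≤ c ^ m • (μH[(m : ℝ)] : Measure (EuclideanSpace ℝ (Fin n))).restrict S := by
  rw [Measure.le_iff]
  intro A hA
  rw [Measure.map_apply hGc.measurable hA, Measure.restrict_apply (hGc.measurable hA),
    Measure.smul_apply, Measure.restrict_apply hA]
  have hsub : G ⁻¹' A ∩ S0 ⊆ θ '' (A ∩ S) := by
    rintro x ⟨hxA, hx⟩
    exact ⟨G x, ⟨hxA, (hG x hx).1⟩, (hG x hx).2⟩
  refine (measure_mono hsub).trans ?_
  refine ((hθ.mono inter_subset_right).hausdorffMeasure_image_le (d := (m : ℝ)) (by positivity)).trans ?_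
  rw [ENNReal.rpow_natCast, ENNReal.smul_def, smul_eq_mul, ENNReal.coe_pow]

lemma energy_pull {m n l : ℕ} {p : ℝ} {S S0 : Set (EuclideanSpace ℝ (Fin n))} (hS0 : MeasurableSet S0)
    (hf0 : μH[(m : ℝ)] S0 ≠ ⊤) (hf : μH[(m : ℝ)] S ≠ ⊤)
    {θ G : EuclideanSpace ℝ (Fin n) → EuclideanSpace ℝ (Fin n)} {c : ℝ≥0}
    (hθ : LipschitzOnWith c θ S) (hGc : Continuous G) (hG : ∀ x ∈ S0, G x ∈ S ∧ θ (G x) = x) :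
    ∫⁻ y, mengerIntegrand m n l S (fun i => G (y i)) ^ p
      ∂(Measure.pi fun _ : Fin l => (μH[(m : ℝ)] : Measure (EuclideanSpace ℝ (Fin n))).restrict S0)
      ≤ ((c ^ m) ^ l : ℝ≥0) * mengerEnergy m n l p S := by
  haveI : IsFiniteMeasure ((μH[(m : ℝ)] : Measure (EuclideanSpace ℝ (Fin n))).restrict S0) :=
    ⟨by rw [Measure.restrict_apply_univ]; exact hf0.lt_top⟩
  haveI : IsFiniteMeasure ((μH[(m : ℝ)] : Measure (EuclideanSpace ℝ (Fin n))).restrict S) :=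
    ⟨by rw [Measure.restrict_apply_univ]; exact hf.lt_top⟩
  have hmeas : Measurable (fun y => mengerIntegrand m n l S y ^ p) :=
    (mengerIntegrand_meas m n l S).pow_const p
  have hGm : Measurable (fun (y : Fin l → EuclideanSpace ℝ (Fin n)) i => G (y i)) :=
    measurable_pi_lambda _ fun i => hGc.measurable.comp (measurable_pi_apply i)
  rw [← lintegral_map (f := fun y => mengerIntegrand m n l S y ^ p) hmeas hGm]
  rw [Measure.pi_map_pi (μ := fun _ : Fin l => (μH[(m : ℝ)] : Measure (EuclideanSpace ℝ (Fin n))).restrict S0)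
    (f := fun _ => G) (fun i => hGc.measurable.aemeasurable)]
  refine (lintegral_mono' (pi_mono_meas _ _ (map_le_of hS0 hθ hGc hG)) le_rfl).trans ?_
  rw [pi_smul_meas, lintegral_smul_measure, ENNReal.smul_def, smul_eq_mul]
  rfl

lemma energy_lsc {m n l : ℕ} {p : ℝ} (hp : 0 < p) {S0 : Set (EuclideanSpace ℝ (Fin n))}
    {S : ℕ → Set (EuclideanSpace ℝ (Fin n))} {θ G : ℕ → EuclideanSpace ℝ (Fin n) → EuclideanSpace ℝ (Fin n)}
    {a : ℕ → EuclideanSpace ℝ (Fin n)} {c : ℕ → ℝ≥0} {I : ℝ≥0∞} (hS0 : IsClosed S0)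
    (hf0 : μH[(m : ℝ)] S0 ≠ ⊤) (hf : ∀ j, μH[(m : ℝ)] (S j) ≠ ⊤)
    (hθ : ∀ j, LipschitzOnWith (c j) (θ j) (S j)) (hGc : ∀ j, Continuous (G j))
    (hG : ∀ j, ∀ x ∈ S0, G j x ∈ S j ∧ θ j (G j x) = x)
    (hlim : ∀ x ∈ S0, Tendsto (fun j => G j x + a j) atTop (𝓝 x))
    (hc : Tendsto c atTop (𝓝 1)) (hI : Tendsto (fun j => mengerEnergy m n l p (S j)) atTop (𝓝 I)) :
    mengerEnergy m n l p S0 ≤ I := by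
  set μ := (Measure.pi fun _ : Fin l => (μH[(m : ℝ)] : Measure (EuclideanSpace ℝ (Fin n))).restrict S0) with hμ
  haveI : IsFiniteMeasure ((μH[(m : ℝ)] : Measure (EuclideanSpace ℝ (Fin n))).restrict S0) :=
    ⟨by rw [Measure.restrict_apply_univ]; exact hf0.lt_top⟩
  have hae : ∀ᵐ y ∂μ, ∀ i, y i ∈ S0 := by
    rw [ae_all_iff]
    intro i
    exact (Measure.tendsto_eval_ae_ae (i := i)).eventually (ae_restrict_mem hS0.measurableSet)
  have hpt : ∀ᵐ y ∂μ, mengerIntegrand m n l S0 y ^ p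
      ≤ liminf (fun j => mengerIntegrand m n l (S j) (fun i => G j (y i)) ^ p) atTop := by
    filter_upwards [hae] with y hy
    refine le_of_forall_lt fun b hb => ?_
    obtain ⟨b', hb1, hb2⟩ := exists_between hb
    have h1 : b' ^ (p⁻¹) < mengerIntegrand m n l S0 y := by
      have := ENNReal.rpow_lt_rpow hb2 (inv_pos.2 hp)
      rwa [ENNReal.rpow_rpow_inv hp.ne'] at this
    have h2 := integrand_liminf (fun j x hx => (hG j x hx).1) hlim y hy _ h1
    refine hb1.trans_le (le_liminf_of_le (by isBoundedDefault) ?_)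
    filter_upwards [h2] with j hj
    have := ENNReal.rpow_lt_rpow hj hp
    rw [ENNReal.rpow_inv_rpow hp.ne'] at this
    exact this.le
  have hlim2 : Tendsto (fun j => (((c j ^ m) ^ l : ℝ≥0) : ℝ≥0∞) * mengerEnergy m n l p (S j)) atTop (𝓝 I) := by
    have h1 : Tendsto (fun j => (((c j ^ m) ^ l : ℝ≥0) : ℝ≥0∞)) atTop (𝓝 1) := by
      have := (ENNReal.continuous_coe.tendsto _).comp ((hc.pow m).pow l)
      simpa [Function.comp_def] using this
    have := ENNReal.Tendsto.mul h1 (Or.inl one_ne_zero) hI (Or.inr ENNReal.one_ne_top)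
    simpa using this
  calc mengerEnergy m n l p S0 = ∫⁻ y, mengerIntegrand m n l S0 y ^ p ∂μ := rfl
    _ ≤ ∫⁻ y, liminf (fun j => mengerIntegrand m n l (S j) (fun i => G j (y i)) ^ p) atTop ∂μ :=
        lintegral_mono_ae hpt
    _ ≤ liminf (fun j => ∫⁻ y, mengerIntegrand m n l (S j) (fun i => G j (y i)) ^ p ∂μ) atTop := by
        apply lintegral_liminf_le
        intro j
        exact ((mengerIntegrand_meas m n l (S j)).comp
          (measurable_pi_lambda _ fun i => (hGc j).measurable.comp (measurable_pi_apply i))).pow_const p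
    _ ≤ liminf (fun j => (((c j ^ m) ^ l : ℝ≥0) : ℝ≥0∞) * mengerEnergy m n l p (S j)) atTop := by
        refine liminf_le_liminf (Eventually.of_forall fun j => ?_)
        exact energy_pull hS0.measurableSet hf0 (hf j) (hθ j) (hGc j) (hG j)
    _ = I := hlim2.liminf_eq

lemma inverse_ext {n : ℕ} {S' S0 : Set (EuclideanSpace ℝ (Fin n))} {η : ℝ} (hη : 0 < η) (hη2 : η ≤ 1 / 2)
    {ψ : EuclideanSpace ℝ (Fin n) → EuclideanSpace ℝ (Fin n)}
    (h1 : ∀ y ∈ S', ∀ z ∈ S', ‖(ψ y - y) - (ψ z - z)‖ ≤ η * ‖y - z‖) (h2 : ψ '' S' = S0) :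
    ∃ G : EuclideanSpace ℝ (Fin n) → EuclideanSpace ℝ (Fin n), Continuous G ∧
      ∀ x ∈ S0, G x ∈ S' ∧ ψ (G x) = x := by
  have hex : ∀ x, ∃ y, x ∈ S0 → y ∈ S' ∧ ψ y = x := by
    intro x
    by_cases hx : x ∈ S0
    · rw [← h2] at hx; obtain ⟨y, hy, e⟩ := hx; exact ⟨y, fun _ => ⟨hy, e⟩⟩
    · exact ⟨x, fun h => absurd h hx⟩
  choose g hg using hex
  have hlip : LipschitzOnWith 2 g S0 := by
    apply LipschitzOnWith.of_dist_le_mul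
    intro x hx y hy
    obtain ⟨a1, a2⟩ := hg x hx
    obtain ⟨b1, b2⟩ := hg y hy
    have h := h1 _ a1 _ b1
    rw [a2, b2] at h
    have e : g x - g y = (x - y) - ((x - g x) - (y - g y)) := by abel
    have h3 : ‖g x - g y‖ ≤ ‖x - y‖ + ‖(x - g x) - (y - g y)‖ := by
      calc ‖g x - g y‖ = ‖(x - y) - ((x - g x) - (y - g y))‖ := by rw [← e]
        _ ≤ _ := norm_sub_le _ _
    have h4 : η * ‖g x - g y‖ ≤ 1 / 2 * ‖g x - g y‖ := mul_le_mul_of_nonneg_right hη2 (norm_nonneg _)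
    rw [dist_eq_norm, dist_eq_norm]
    push_cast
    linarith
  obtain ⟨G, hG, he⟩ := hlip.extend_finite_dimension
  refine ⟨G, hG.continuous, fun x hx => ?_⟩
  rw [← he hx]; exact hg x hx

end Part12

lemma energy_one {m n : ℕ} {p : ℝ} (hp : 0 < p) (S : Set (EuclideanSpace ℝ (Fin n))) :
    mengerEnergy m n 1 p S = 0 := by
  unfold mengerEnergy
  have : ∀ y : Fin 1 → EuclideanSpace ℝ (Fin n), mengerIntegrand m n 1 S y ^ p = 0 := by
    intro y
    unfold mengerIntegrand
    rw [if_pos (fun i j => by rw [Subsingleton.elim i j]), ENNReal.zero_rpow_of_pos hp]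
  simp [this]

lemma minimiser_core {m n l : ℕ} {p E d : ℝ}
    (hm : 1 ≤ m) (hmn : m < n) (hl2 : 2 ≤ l) (hlm : l ≤ m + 2)
    (hp : (m : ℝ) * l < p) (hd : 0 < d) {M₀ : Set (EuclideanSpace ℝ (Fin n))} {I : ℝ≥0∞}
    {S : ℕ → Set (EuclideanSpace ℝ (Fin n))}
    (hL : ∀ j, IsLipschitzSubmanifold m n (S j)) (hSE : ∀ j, mengerEnergy m n l p (S j) ≤ ENNReal.ofReal E)
    (hSd : ∀ j, diam (S j) ≤ d) (hiso : ∀ j, AmbientIsotopic n (S j) M₀)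
    (hI : Tendsto (fun j => mengerEnergy m n l p (S j)) atTop (𝓝 I)) :
    ∃ S₀ : Set (EuclideanSpace ℝ (Fin n)),
      IsLipschitzSubmanifold m n S₀ ∧ diam S₀ ≤ d ∧ AmbientIsotopic n S₀ M₀ ∧
      mengerEnergy m n l p S₀ ≤ I := by
  have hp0 : 0 < p := lt_of_le_of_lt (by positivity) hp
  have hR : ∀ ε : ℝ, ∃ R : ℝ, 0 < ε → ε ≤ 1 / 16 → 0 < R ∧ ∀ j, ∀ ρ, 0 < ρ → ρ ≤ R → ChProp m (S j) ρ ε := by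
    intro ε
    by_cases h : 0 < ε ∧ ε ≤ 1 / 16
    · obtain ⟨R, hR0, hR⟩ := uniform_chart (E := E) hm hmn.le hl2 hlm hp h.1 h.2
      exact ⟨R, fun _ _ => ⟨hR0, fun j => hR (S j) (hL j).2.1 (lip_finite (hL j)) (hSE j) (lip_U (hL j))⟩⟩
    · exact ⟨0, fun h1 h2 => absurd ⟨h1, h2⟩ h⟩
  choose R0 hR0 using hR
  let R : ℝ → ℝ := fun ε => R0 ε / 2
  have hRpos : ∀ ε, 0 < ε → ε ≤ 1 / 16 → 0 < R ε := fun ε h1 h2 => half_pos (hR0 ε h1 h2).1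
  choose x hx using fun j => (hL j).1
  let S' : ℕ → Set (EuclideanSpace ℝ (Fin n)) := fun j => (fun y => y + (- x j)) '' S j
  have hS'c : ∀ j, IsCompact (S' j) := fun j => (hL j).2.1.image (by fun_prop)
  have hS'ne : ∀ j, (S' j).Nonempty := fun j => (hL j).1.image _
  have hS'b : ∀ j, S' j ⊆ closedBall 0 d := by
    rintro j _ ⟨y, hy, rfl⟩
    rw [mem_closedBall_zero_iff]
    have : dist y (x j) ≤ diam (S j) := dist_le_diam_of_mem (hL j).2.1.isBounded hy (hx j)
    rw [dist_eq_norm, sub_eq_add_neg] at this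
    exact this.trans (hSd j)
  have hS'd : ∀ j, diam (S' j) ≤ d := by
    intro j
    have : diam (S' j) = diam (S j) := (IsometryEquiv.addRight (- x j)).isometry.diam_image _
    rw [this]; exact hSd j
  have hS'ch : ∀ j ε, 0 < ε → ε ≤ 1 / 16 → ∀ ρ, 0 < ρ → ρ ≤ R0 ε → ChProp m (S' j) ρ ε :=
    fun j ε h1 h2 ρ h3 h4 => ((hR0 ε h1 h2).2 j ρ h3 h4).translate _
  have hS'reg : ∀ j, Reg m R (S' j) := by
    intro j ε h1 h2 ρ h3 h4
    refine hS'ch j ε h1 h2 ρ h3 (h4.trans ?_)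
    have := (hR0 ε h1 h2).1
    simp only [R]; linarith
  obtain ⟨S0, φ, h, hφ, hS0c, hS0ne, hh, hHD⟩ := hausdorff_subseq hS'ne hS'c hS'b
  have hS0reg : Reg m R S0 := by
    intro ε h1 h2 ρ h3 h4
    have := ChProp.limit (m := m) (ρ := 2 * ρ) (ε := ε) hS0c.isClosed hh hHD (by linarith)
      (fun j => hS'ch (φ j) ε h1 h2 (2 * ρ) (by linarith) (by simp only [R] at h4; linarith))
    rwa [mul_div_cancel_left₀ _ (two_ne_zero)] at this
  have hS0L : IsLipschitzSubmanifold m n S0 := by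
    have h0 := hRpos (1 / 16) (by norm_num) le_rfl
    exact lip_of_ch hS0ne hS0c h0 (by norm_num) (hS0reg (1 / 16) (by norm_num) le_rfl _ h0 le_rfl)
  have hS0d : diam S0 ≤ d := diam_limit hd.le (fun j => hS'c (φ j)) hh hHD (fun j => hS'd (φ j))
  obtain ⟨η0, hη0, hη0'⟩ := iso_of_psi n
  let η : ℕ → ℝ := fun k => min (1 / ((k : ℝ) + 1)) (min η0 (1 / 2))
  have hηpos : ∀ k, 0 < η k := fun k => lt_min (by positivity) (lt_min hη0 (by norm_num))
  have hηlim : Tendsto η atTop (𝓝 0) := by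
    refine squeeze_zero (fun k => (hηpos k).le) (fun k => min_le_left _ _) ?_
    exact tendsto_one_div_add_atTop_nhds_zero_nat
  have hstep : ∀ k : ℕ, ∃ J, k ≤ J ∧ ∃ ψ : EuclideanSpace ℝ (Fin n) → EuclideanSpace ℝ (Fin n),
      (∀ y ∈ S' J, ‖ψ y - y‖ ≤ η k) ∧
      (∀ y ∈ S' J, ∀ z ∈ S' J, ‖(ψ y - y) - (ψ z - z)‖ ≤ η k * ‖y - z‖) ∧ ψ '' S' J = S0 := by
    intro k
    obtain ⟨h0, hh0, hproj⟩ := proj_exists hm hRpos hS0c hS0reg (hηpos k)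
    obtain ⟨j, hj1, hj2⟩ := ((hh.eventually (gt_mem_nhds hh0)).and (eventually_ge_atTop k)).exists
    refine ⟨φ j, hj2.trans (hφ.id_le j), hproj (S' (φ j)) (hS'c _) (hS'reg _) ?_⟩
    refine ⟨fun a ha => ?_, fun b hb => ?_⟩
    · obtain ⟨b, hb, hab⟩ := (hHD j).1 a ha
      exact ⟨b, hb, hab.trans hj1.le⟩
    · obtain ⟨a, ha, hab⟩ := (hHD j).2 b hb
      exact ⟨a, ha, hab.trans hj1.le⟩
  choose J hJ ψ hψ1 hψ2 hψ3 using hstep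
  have hJt : Tendsto J atTop atTop := tendsto_atTop_mono hJ tendsto_id
  choose g hgc hg using fun k => inverse_ext (hηpos k) ((min_le_right _ _).trans (min_le_right _ _)) (hψ2 k) (hψ3 k)
  refine ⟨S0, hS0L, hS0d, ?_, ?_⟩
  · have e1 : AmbientIsotopic n S0 (S' (J 0)) := by
      have := hη0' (η 0) (hηpos 0) ((min_le_right _ _).trans (min_le_left _ _)) (S' (J 0)) (ψ 0) (hψ2 0)
      rwa [hψ3 0] at this
    exact (e1.trans (iso_translate _ _)).trans (hiso _)
  · refine energy_lsc (S := fun k => S (J k)) (θ := fun k y => ψ k (y + (- x (J k))))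
      (G := fun k y => g k y + x (J k)) (a := fun k => - x (J k)) (c := fun k => 1 + Real.toNNReal (η k))
      hp0 hS0c.isClosed (lip_finite hS0L) (fun k => lip_finite (hL _)) ?_ (fun k => (hgc k).add continuous_const) ?_ ?_ ?_
      (hI.comp hJt)
    · intro k
      apply LipschitzOnWith.of_dist_le_mul
      intro y hy z hz
      have := hψ2 k (y + (- x (J k))) ⟨y, hy, rfl⟩ (z + (- x (J k))) ⟨z, hz, rfl⟩
      rw [add_sub_add_right_eq_sub] at this
      rw [dist_eq_norm, dist_eq_norm, NNReal.coe_add, Real.coe_toNNReal _ (hηpos k).le, NNReal.coe_one, add_mul, one_mul]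
      have e : ψ k (y + (- x (J k))) - ψ k (z + (- x (J k))) = (y - z) +
        ((ψ k (y + (- x (J k))) - (y + (- x (J k)))) - (ψ k (z + (- x (J k))) - (z + (- x (J k))))) := by abel
      rw [e]
      exact (norm_add_le _ _).trans (by linarith)
    · intro k y hy
      obtain ⟨h1, h2⟩ := hg k y hy
      obtain ⟨w, hw, hwe⟩ := h1
      have hwe' : w + (- x (J k)) = g k y := hwe
      constructor
      · have : g k y + x (J k) = w := by rw [← hwe']; abel
        simp only [this]; exact hw
      · simp only [add_neg_cancel_right]; exact h2
    · intro y hy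
      simp only [add_neg_cancel_right]
      rw [tendsto_iff_norm_sub_tendsto_zero]
      refine squeeze_zero (fun k => norm_nonneg _) (fun k => ?_) hηlim
      obtain ⟨h1, h2⟩ := hg k y hy
      have := hψ1 k _ h1
      rwa [h2, norm_sub_rev] at this
    · have : Tendsto (fun k => (1 : ℝ≥0) + Real.toNNReal (η k)) atTop (𝓝 (1 + Real.toNNReal 0)) :=
        tendsto_const_nhds.add ((continuous_real_toNNReal.tendsto 0).comp hηlim)
      simpa using this

/-- **Existence of minimisers in isotopy classes** (Corollary 3 for the energies `𝓔_p^l`):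
in every ambient isotopy class represented in `𝒜(E,d)` the energy `𝓔_p^l` attains its
infimum. -/
theorem exists_energy_minimiser_in_isotopy_class (m n l : ℕ) (p E d : ℝ)
    (hm : 1 ≤ m) (hmn : m < n) (hl1 : 1 ≤ l) (hl2 : l ≤ m + 2)
    (hp : (m : ℝ) * l < p) (hE : 0 < E) (hd : 0 < d)
    (M₀ : Set (EuclideanSpace ℝ (Fin n)))
    (hM : IsLipschitzSubmanifold m n M₀)
    (hME : mengerEnergy m n l p M₀ ≤ ENNReal.ofReal E)
    (hMd : Metric.diam M₀ ≤ d) :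
    ∃ S₀ : Set (EuclideanSpace ℝ (Fin n)),
      IsLipschitzSubmanifold m n S₀ ∧ mengerEnergy m n l p S₀ ≤ ENNReal.ofReal E ∧
      Metric.diam S₀ ≤ d ∧ AmbientIsotopic n S₀ M₀ ∧
      mengerEnergy m n l p S₀
        = ⨅ (S : Set (EuclideanSpace ℝ (Fin n)))
            (_ : IsLipschitzSubmanifold m n S ∧ mengerEnergy m n l p S ≤ ENNReal.ofReal E ∧
                 Metric.diam S ≤ d ∧ AmbientIsotopic n S M₀),
            mengerEnergy m n l p S := by
  
  have hp0 : 0 < p := lt_of_le_of_lt (by positivity) hp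
  rcases Nat.lt_or_ge 1 l with hl | hl
  swap
  · obtain rfl : l = 1 := le_antisymm hl hl1
    refine ⟨M₀, hM, hME, hMd, AmbientIsotopic.refl n M₀, ?_⟩
    rw [energy_one hp0]
    refine (le_antisymm ?_ (zero_le)).symm
    exact iInf₂_le_of_le M₀ ⟨hM, hME, hMd, AmbientIsotopic.refl n M₀⟩ (energy_one hp0 M₀).le
  let C : Set (Set (EuclideanSpace ℝ (Fin n))) :=
    {S | IsLipschitzSubmanifold m n S ∧ mengerEnergy m n l p S ≤ ENNReal.ofReal E ∧
                 Metric.diam S ≤ d ∧ AmbientIsotopic n S M₀}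
  have hCne : C.Nonempty := ⟨M₀, hM, hME, hMd, AmbientIsotopic.refl n M₀⟩
  obtain ⟨u, -, hu, huC⟩ := exists_seq_tendsto_sInf (hCne.image (mengerEnergy m n l p)) (OrderBot.bddBelow _)
  choose S hS hSu using huC
  rw [sInf_image] at hu
  have hu' : Tendsto (fun j => mengerEnergy m n l p (S j)) atTop (𝓝 (⨅ S ∈ C, mengerEnergy m n l p S)) := by
    simpa only [hSu] using hu
  obtain ⟨S0, h1, h2, h3, h4⟩ := minimiser_core hm hmn hl hl2 hp hd (fun j => (hS j).1)
    (fun j => (hS j).2.1) (fun j => (hS j).2.2.1) (fun j => (hS j).2.2.2) hu'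
  have hE0 : mengerEnergy m n l p S0 ≤ ENNReal.ofReal E :=
    h4.trans (iInf₂_le_of_le M₀ ⟨hM, hME, hMd, AmbientIsotopic.refl n M₀⟩ hME)
  refine ⟨S0, h1, hE0, h2, h3, le_antisymm h4 ?_⟩
  exact iInf₂_le_of_le S0 ⟨h1, hE0, h2, h3⟩ le_rfl
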